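/- Let p be an odd prime, q = p^a, K = SL₂(𝔽_q) and Z the centre of K (so Z = {±I} has order 2). Let A be a proper subgroup of K such that q+1 divides the order of the image of A in K/Z. Then -I ∈ A, and either A has order 2(q+1) and A/⟨-I⟩ is isomorphic to the dihedral group of order q+1, or one of the following holds: q = 5 and A ≅ SL₂(𝔽₃); q = 7 and A has order 48, has a unique element of order 2, and A modulo its centre is isomorphic to the symmetric group on 4 letters; q = 9 and A ≅ SL₂(𝔽₅); q = 11 and A ≅ SL₂(𝔽₃) or A ≅ SL₂(𝔽₅); q = 19 and A ≅ SL₂(𝔽₅); q = 23 and A has order 48, has a unique element of order 2, and A modulo its centre is isomorphic to the symmetric group on 4 letters; q = 29 and A ≅ SL₂(𝔽₅); q = 59 and A ≅ SL₂(𝔽₅). -/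

import Mathlib

instance : Fact (Even (Fintype.card (Fin 2))) := ⟨⟨1, rfl⟩⟩

namespace Dickson

open Matrix MulAction

/-- The special linear group of degree two. -/
abbrev SL₂ (R : Type*) [CommRing R] := Matrix.SpecialLinearGroup (Fin 2) R

section Basic

variable {F : Type*} [Field F]

theorem coe_mul_self {R : Type*} [CommRing R] (g : SL₂ R) :
    (g.1 * g.1 : Matrix (Fin 2) (Fin 2) R) = g.1.trace • g.1 - 1 := by
  have hd := g.2
  rw [det_fin_two] at hd
  ext i j
  fin_cases i <;> fin_cases j <;> simp [Matrix.mul_apply, Fin.sum_univ_two, trace_fin_two] <;>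
    first | ring1 | linear_combination -1 * hd

theorem trace_mul_inv (g h : SL₂ F) :
    (g * h⁻¹).1.trace = g.1.trace * h.1.trace - (g * h).1.trace := by
  simp [Matrix.SpecialLinearGroup.coe_mul, Matrix.SpecialLinearGroup.coe_inv, adjugate_fin_two, trace_fin_two, Matrix.mul_apply, Fin.sum_univ_two]
  ring

theorem trace_inv (g : SL₂ F) : (g⁻¹).1.trace = g.1.trace := by
  simp [Matrix.SpecialLinearGroup.coe_inv, adjugate_fin_two, trace_fin_two]
  ring

theorem trace_mul_mul_left (g h : SL₂ F) :
    (g * (g * h)).1.trace = g.1.trace * (g * h).1.trace - h.1.trace := by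
  have := coe_mul_self g
  have e : ((g * (g * h)).1 : Matrix (Fin 2) (Fin 2) F) = g.1.trace • (g * h).1 - h.1 := by
    simp only [Matrix.SpecialLinearGroup.coe_mul]
    rw [← Matrix.mul_assoc, this]
    simp [sub_mul]
  rw [e]
  simp

theorem mul_self_eq_neg_one_iff (g : SL₂ F) : g * g = -1 ↔ g.1.trace = 0 := by
  have h := coe_mul_self g
  constructor
  · intro hg
    have h1 : (g * g).1 = -1 := by rw [hg]; simp
    rw [Matrix.SpecialLinearGroup.coe_mul, h] at h1
    have h2 : g.1.trace • g.1 = 0 := by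
      have := congrArg (· + 1) h1
      simpa using this
    rcases smul_eq_zero.mp h2 with h3 | h3
    · exact h3
    · rw [h3]; simp
  · intro hg
    refine Matrix.SpecialLinearGroup.ext _ _ fun i j => ?_
    rw [Matrix.SpecialLinearGroup.coe_mul, h, hg]
    simp

theorem eq_one_or_eq_neg_one_of_mul_self (h2 : (2 : F) ≠ 0) {g : SL₂ F} (hg : g * g = 1) :
    g = 1 ∨ g = -1 := by
  have h := coe_mul_self g
  have h1 : (g.1 * g.1 : Matrix (Fin 2) (Fin 2) F) = 1 := by
    rw [← Matrix.SpecialLinearGroup.coe_mul, hg]; simp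
  rw [h1] at h
  have e00 := congrFun (congrFun h 0) 0
  have e01 := congrFun (congrFun h 0) 1
  have e10 := congrFun (congrFun h 1) 0
  have e11 := congrFun (congrFun h 1) 1
  simp at e00 e01 e10 e11
  have ht : g.1.trace ≠ 0 := by
    intro h0; rw [h0] at e00; apply h2; linear_combination e00
  have e01' : g.1 0 1 = 0 := by tauto
  have e10' : g.1 1 0 = 0 := by tauto
  have hd := g.2
  rw [det_fin_two, e01', e10'] at hd
  have heq : g.1 0 0 = g.1 1 1 := by
    apply mul_left_cancel₀ ht; linear_combination e11 - e00
  have : (g.1 0 0 - 1) * (g.1 0 0 + 1) = 0 := by rw [← heq] at hd; linear_combination hd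
  rcases mul_eq_zero.mp this with h3 | h3
  · left
    have h3' : g.1 0 0 = 1 := by linear_combination h3
    refine Matrix.SpecialLinearGroup.ext _ _ fun i j => ?_; fin_cases i <;> fin_cases j <;> simp [e01', e10', h3', ← heq]
  · right
    have h3' : g.1 0 0 = -1 := by linear_combination h3
    refine Matrix.SpecialLinearGroup.ext _ _ fun i j => ?_; fin_cases i <;> fin_cases j <;> simp [e01', e10', h3', ← heq]

theorem one_ne_neg_one (h2 : (2 : F) ≠ 0) : (1 : SL₂ F) ≠ -1 := by
  intro h
  have h1 : (1 : SL₂ F).1 0 0 = (-1 : SL₂ F).1 0 0 := by rw [← h]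
  simp at h1
  apply h2; linear_combination h1

theorem trace_one : (1 : SL₂ F).1.trace = 2 := by
  simp

theorem trace_neg (g : SL₂ F) : (-g).1.trace = -g.1.trace := by
  simp

/-- Twice the traceless part of a matrix of degree two. -/
def tracelessPart (m : Matrix (Fin 2) (Fin 2) F) : Matrix (Fin 2) (Fin 2) F :=
  (2 : F) • m - m.trace • (1 : Matrix (Fin 2) (Fin 2) F)

theorem trace_tracelessPart (m : Matrix (Fin 2) (Fin 2) F) : (tracelessPart m).trace = 0 := by
  simp [tracelessPart, trace_fin_two]; ring

theorem neg_det_tracelessPart (g : SL₂ F) :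
    -(tracelessPart g.1).det = g.1.trace ^ 2 - 4 := by
  have hd := g.2
  rw [det_fin_two] at hd
  simp [tracelessPart, trace_fin_two, det_fin_two]
  linear_combination -4 * hd

theorem tracelessPart_ne_zero (h2 : (2 : F) ≠ 0) {g : SL₂ F} (h₁ : g ≠ 1) (h₂ : g ≠ -1) :
    tracelessPart g.1 ≠ 0 := by
  intro h
  have e00 := congrFun (congrFun h 0) 0
  have e01 := congrFun (congrFun h 0) 1
  have e10 := congrFun (congrFun h 1) 0
  simp [tracelessPart, trace_fin_two, h2] at e00 e01 e10
  have heq : g.1 0 0 = g.1 1 1 := by linear_combination e00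
  have hd := g.2
  rw [det_fin_two, e01, e10, ← heq] at hd
  have : g * g = 1 := by
    ext i j
    fin_cases i <;> fin_cases j <;> simp [Matrix.mul_apply, Fin.sum_univ_two, e01, e10, ← heq]
    · linear_combination hd
    · linear_combination hd
  rcases eq_one_or_eq_neg_one_of_mul_self h2 this with h | h <;> contradiction

theorem commute_tracelessPart_iff (h2 : (2 : F) ≠ 0) (m h : Matrix (Fin 2) (Fin 2) F) :
    Commute (tracelessPart m) h ↔ Commute m h := by
  unfold Commute SemiconjBy tracelessPart
  simp only [sub_mul, mul_sub, Matrix.smul_mul, Matrix.mul_smul, Matrix.one_mul, Matrix.mul_one,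
    sub_left_inj]
  constructor
  · intro h'
    have := congrArg (fun x => (2 : F)⁻¹ • x) h'
    simpa [smul_smul, h2] using this
  · intro h'; rw [h']

theorem exists_smul_of_commute (h2 : (2 : F) ≠ 0) {h m : Matrix (Fin 2) (Fin 2) F}
    (hh : h.trace = 0) (hm : m.trace = 0) (h0 : h ≠ 0) (hc : Commute h m) :
    ∃ μ : F, m = μ • h := by
  have e00 := congrFun (congrFun hc.eq 0) 0
  have e01 := congrFun (congrFun hc.eq 0) 1
  have e10 := congrFun (congrFun hc.eq 1) 0
  simp only [Matrix.mul_apply, Fin.sum_univ_two] at e00 e01 e10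
  rw [trace_fin_two] at hh hm
  have hh' : h 1 1 = - h 0 0 := by linear_combination hh
  have hm' : m 1 1 = - m 0 0 := by linear_combination hm
  rw [hh', hm'] at e01 e10
  have f01 : h 0 0 * m 0 1 = m 0 0 * h 0 1 := by
    apply mul_left_cancel₀ h2; linear_combination e01
  have f10 : h 0 0 * m 1 0 = m 0 0 * h 1 0 := by
    apply mul_left_cancel₀ h2; linear_combination -e10
  have f : h 0 1 * m 1 0 = m 0 1 * h 1 0 := by linear_combination e00
  by_cases ha : h 0 0 = 0
  · by_cases hb : h 0 1 = 0
    · have hcc : h 1 0 ≠ 0 := by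
        intro hcc; apply h0; ext i j; fin_cases i <;> fin_cases j <;> simp [ha, hb, hcc, hh']
      refine ⟨m 1 0 / h 1 0, ?_⟩
      ext i j; fin_cases i <;> fin_cases j <;> simp [hh', hm'] <;> field_simp <;> grind
    · refine ⟨m 0 1 / h 0 1, ?_⟩
      ext i j; fin_cases i <;> fin_cases j <;> simp [hh', hm'] <;> field_simp <;> grind
  · refine ⟨m 0 0 / h 0 0, ?_⟩
    ext i j; fin_cases i <;> fin_cases j <;> simp [hh', hm'] <;> field_simp <;> grind

end Basic

/-- Traceless matrices `h` of degree two whose square is a scalar matrix with entry in `E`. -/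
def Pole (F : Type*) [Field F] (E : Set F) :=
  {h : Matrix (Fin 2) (Fin 2) F // h.trace = 0 ∧ -h.det ∈ E}

section Pole

variable {F : Type*} [Field F] {E : Set F}

instance [Finite F] : Finite (Pole F E) := by unfold Pole; infer_instance

theorem coe_mul_coe_inv (g : SL₂ F) : (g.1 * (g⁻¹).1 : Matrix (Fin 2) (Fin 2) F) = 1 := by
  rw [← Matrix.SpecialLinearGroup.coe_mul]; simp

theorem coe_inv_mul_coe (g : SL₂ F) : ((g⁻¹).1 * g.1 : Matrix (Fin 2) (Fin 2) F) = 1 := by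
  rw [← Matrix.SpecialLinearGroup.coe_mul]; simp

instance : MulAction (SL₂ F) (Pole F E) where
  smul g h := ⟨g.1 * h.1 * (g⁻¹).1, by
    constructor
    · rw [Matrix.trace_mul_comm, ← Matrix.mul_assoc, coe_inv_mul_coe, Matrix.one_mul]
      exact h.2.1
    · rw [Matrix.det_mul, Matrix.det_mul, g.2, (g⁻¹).2, one_mul, mul_one]
      exact h.2.2⟩
  one_smul h := by
    apply Subtype.ext
    change (1 : SL₂ F).1 * h.1 * ((1 : SL₂ F)⁻¹).1 = h.1
    simp
  mul_smul g k h := by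
    apply Subtype.ext
    change (g * k).1 * h.1 * ((g * k)⁻¹).1 = g.1 * (k.1 * h.1 * (k⁻¹).1) * (g⁻¹).1
    rw [_root_.mul_inv_rev]
    simp only [Matrix.SpecialLinearGroup.coe_mul, Matrix.mul_assoc]

theorem Pole.coe_smul (g : SL₂ F) (h : Pole F E) : (g • h).1 = g.1 * h.1 * (g⁻¹).1 := rfl

theorem Pole.smul_eq_iff (g : SL₂ F) (h k : Pole F E) : g • h = k ↔ g.1 * h.1 = k.1 * g.1 := by
  constructor
  · intro e
    have e : g.1 * h.1 * (g⁻¹).1 = k.1 := congrArg Subtype.val e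
    rw [← e, Matrix.mul_assoc, coe_inv_mul_coe, Matrix.mul_one]
  · intro e
    apply Subtype.ext
    rw [Pole.coe_smul, e, Matrix.mul_assoc, coe_mul_coe_inv, Matrix.mul_one]

theorem Pole.smul_eq_self_iff (g : SL₂ F) (h : Pole F E) : g • h = h ↔ Commute g.1 h.1 :=
  Pole.smul_eq_iff g h h

theorem Pole.mul_self (h : Pole F E) : (h.1 * h.1 : Matrix (Fin 2) (Fin 2) F) =
    (-h.1.det) • (1 : Matrix (Fin 2) (Fin 2) F) := by
  have h1 := h.2.1
  rw [trace_fin_two] at h1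
  have h2 : h.1 1 1 = - h.1 0 0 := by linear_combination h1
  rw [det_fin_two]
  ext i j
  fin_cases i <;> fin_cases j <;> simp [Matrix.mul_apply, Fin.sum_univ_two, h2] <;> ring

theorem Pole.ne_zero (hE : 0 ∉ E) (h : Pole F E) : h.1 ≠ 0 := by
  intro h0
  apply hE
  have := h.2.2
  rw [h0] at this
  simpa using this

/-- The poles fixed by a non-scalar matrix are the multiples of its traceless part. -/
theorem fixed_iff (h2 : (2 : F) ≠ 0) {g : SL₂ F} (h₁ : g ≠ 1) (h₂ : g ≠ -1) (h : Pole F E) :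
    g • h = h ↔ ∃ μ : F, h.1 = μ • tracelessPart g.1 := by
  rw [Pole.smul_eq_self_iff, ← commute_tracelessPart_iff h2]
  constructor
  · intro hc
    exact exists_smul_of_commute h2 (trace_tracelessPart _) h.2.1 (tracelessPart_ne_zero h2 h₁ h₂) hc
  · rintro ⟨μ, hμ⟩
    rw [hμ]
    exact (Commute.refl _).smul_right μ

/-- Poles fixed by a non-scalar `g` correspond to scalars `μ` with `μ² (tr(g)² - 4) ∈ E`. -/
noncomputable def fixedEquiv (h2 : (2 : F) ≠ 0) {g : SL₂ F} (h₁ : g ≠ 1) (h₂ : g ≠ -1) :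
    {h : Pole F E // g • h = h} ≃ {μ : F // μ ^ 2 * (g.1.trace ^ 2 - 4) ∈ E} := by
  symm
  refine Equiv.ofBijective (fun μ => ⟨⟨μ.1 • tracelessPart g.1, ?_, ?_⟩, ?_⟩) ⟨?_, ?_⟩
  · rw [trace_smul, trace_tracelessPart, smul_zero]
  · have := neg_det_tracelessPart g
    rw [det_smul, Fintype.card_fin, ← mul_neg, this]
    exact μ.2
  · exact (fixed_iff h2 h₁ h₂ _).mpr ⟨μ.1, rfl⟩
  · intro μ ν h
    have h := congrArg (fun x => x.1.1) h
    exact Subtype.ext (smul_left_injective F (tracelessPart_ne_zero h2 h₁ h₂) h)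
  · rintro ⟨h, hh⟩
    obtain ⟨μ, hμ⟩ := (fixed_iff h2 h₁ h₂ h).mp hh
    refine ⟨⟨μ, ?_⟩, ?_⟩
    · have := h.2.2
      rw [hμ, det_smul] at this
      rw [← neg_det_tracelessPart]
      simpa using this
    · apply Subtype.ext; apply Subtype.ext; exact hμ.symm

end Pole

section Stabilizer

variable {F : Type*} [Field F] {E : Set F}

theorem two_smul_eq_of_smul_eq (h2 : (2 : F) ≠ 0) (hE : 0 ∉ E) {g : SL₂ F} {h : Pole F E}
    (hg : g • h = h) :
    (g.1 : Matrix (Fin 2) (Fin 2) F) = (g.1.trace / 2) • (1 : Matrix (Fin 2) (Fin 2) F) +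
      ((g.1 * h.1).trace / (2 * -h.1.det)) • h.1 := by
  have h0 := Pole.ne_zero hE h
  have he : h.1.det ≠ 0 := fun e => hE (by simpa [e] using h.2.2)
  rw [Pole.smul_eq_self_iff, ← commute_tracelessPart_iff h2] at hg
  obtain ⟨μ, hμ⟩ := exists_smul_of_commute h2 h.2.1 (trace_tracelessPart _) h0 hg.symm
  have e1 : (g.1 : Matrix (Fin 2) (Fin 2) F) = (g.1.trace / 2) • (1 : Matrix (Fin 2) (Fin 2) F) +
      (μ / 2) • h.1 := by
    have : (2 : F) • g.1 = μ • h.1 + g.1.trace • (1 : Matrix (Fin 2) (Fin 2) F) := by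
      rw [← hμ, tracelessPart]; simp
    have := congrArg (fun x => (2 : F)⁻¹ • x) this
    simp only [smul_smul, smul_add, inv_mul_cancel₀ h2, one_smul] at this
    rw [this, add_comm, div_eq_inv_mul, div_eq_inv_mul]
    simp [h.2.1]
    left
    field_simp
  have e2 : (g.1 * h.1).trace = μ * -h.1.det := by
    have h1 := h.2.1
    rw [e1, add_mul, Matrix.smul_mul, Matrix.smul_mul, Pole.mul_self, Matrix.one_mul, trace_add,
      trace_smul, trace_smul, trace_smul, h1, trace_fin_two]
    simp
    field_simp
  rw [e2]
  have e3 : μ * -h.1.det / (2 * -h.1.det) = μ / 2 := by field_simp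
  rw [e3]
  exact e1

variable (δ : AlgebraicClosure F)

/-- An eigenvalue of a matrix commuting with a given pole. -/
noncomputable def eigenvalue (h : Pole F E) (g : SL₂ F) : AlgebraicClosure F :=
  algebraMap F _ (g.1.trace / 2) + algebraMap F _ ((g.1 * h.1).trace / (2 * -h.1.det)) * δ

theorem eigenvalue_mul_eq (h2 : (2 : F) ≠ 0) (hE : 0 ∉ E) {h : Pole F E}
    (hδ : δ ^ 2 = algebraMap F _ (-h.1.det)) {g : SL₂ F} (hg : g • h = h) :
    eigenvalue δ h g * (algebraMap F _ (g.1.trace / 2) -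
      algebraMap F _ ((g.1 * h.1).trace / (2 * -h.1.det)) * δ) = 1 := by
  have e := two_smul_eq_of_smul_eq h2 hE hg
  set α := g.1.trace / 2
  set β := (g.1 * h.1).trace / (2 * -h.1.det)
  have hd := g.2
  have h1 := h.2.1
  rw [trace_fin_two] at h1
  have h11 : h.1 1 1 = - h.1 0 0 := by linear_combination h1
  have : α ^ 2 - β ^ 2 * (-h.1.det) = 1 := by
    rw [e] at hd
    rw [det_fin_two] at hd ⊢
    simp [h11] at hd ⊢
    linear_combination hd
  have := congrArg (algebraMap F (AlgebraicClosure F)) this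
  simp only [map_sub, map_mul, map_pow, ← hδ, map_one] at this
  unfold eigenvalue
  linear_combination this

/-- The eigenvalue character on the stabilizer of a pole. -/
noncomputable def eigenvalueHom (h2 : (2 : F) ≠ 0) (hE : 0 ∉ E) (h : Pole F E)
    (hδ : δ ^ 2 = algebraMap F _ (-h.1.det)) :
    stabilizer (SL₂ F) h →* AlgebraicClosure F where
  toFun g := eigenvalue δ h g.1
  map_one' := by
    simp [eigenvalue, h.2.1, h2]
  map_mul' g k := by
    have he : h.1.det ≠ 0 := fun e => hE (by simpa [e] using h.2.2)
    have eg := two_smul_eq_of_smul_eq h2 hE g.2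
    have ek := two_smul_eq_of_smul_eq h2 hE k.2
    unfold eigenvalue
    set α := g.1.1.trace / 2
    set β := (g.1.1 * h.1).trace / (2 * -h.1.det)
    set α' := k.1.1.trace / 2
    set β' := (k.1.1 * h.1).trace / (2 * -h.1.det)
    have hm := Pole.mul_self h
    have e1 : (g * k).1.1 = (α * α' + β * β' * -h.1.det) • (1 : Matrix (Fin 2) (Fin 2) F) +
        (α * β' + β * α') • h.1 := by
      change g.1.1 * k.1.1 = _
      rw [eg, ek]
      simp only [add_mul, mul_add, Matrix.smul_mul, Matrix.mul_smul, Matrix.one_mul,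
        Matrix.mul_one, hm]
      module
    have e2 : (g * k).1.1 * h.1 = (α * α' + β * β' * -h.1.det) • h.1 +
        ((α * β' + β * α') * -h.1.det) • (1 : Matrix (Fin 2) (Fin 2) F) := by
      rw [e1, add_mul, Matrix.smul_mul, Matrix.smul_mul, hm, Matrix.one_mul]
      module
    have t1 : (g * k).1.1.trace / 2 = α * α' + β * β' * -h.1.det := by
      rw [e1]; simp [h.2.1]; field_simp
    have t2 : ((g * k).1.1 * h.1).trace / (2 * -h.1.det) = α * β' + β * α' := by
      rw [e2]; simp [h.2.1]; field_simp
    rw [t1, t2]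
    simp only [map_add, map_mul, ← hδ]
    ring

theorem eigenvalueHom_injective (h2 : (2 : F) ≠ 0) (hE : 0 ∉ E) (h : Pole F E)
    (hδ : δ ^ 2 = algebraMap F _ (-h.1.det)) :
    Function.Injective (eigenvalueHom δ h2 hE h hδ) := by
  have he : h.1.det ≠ 0 := fun e => hE (by simpa [e] using h.2.2)
  have hδ0 : δ ≠ 0 := by
    rintro rfl
    rw [zero_pow two_ne_zero, eq_comm, map_eq_zero] at hδ
    exact he (neg_eq_zero.mp hδ)
  have h2' : (2 : AlgebraicClosure F) ≠ 0 := by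
    have := (map_ne_zero (algebraMap F (AlgebraicClosure F))).mpr h2
    rwa [map_ofNat] at this
  rw [injective_iff_map_eq_one]
  intro g hg
  have hg' : eigenvalue δ h g.1 = 1 := hg
  have hm := eigenvalue_mul_eq δ h2 hE hδ g.2
  rw [hg', one_mul] at hm
  have e := two_smul_eq_of_smul_eq h2 hE g.2
  unfold eigenvalue at hg'
  set α := g.1.1.trace / 2
  set β := (g.1.1 * h.1).trace / (2 * -h.1.det)
  have hα : α = 1 := by
    apply (algebraMap F (AlgebraicClosure F)).injective
    apply mul_left_cancel₀ h2'
    rw [map_one]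
    linear_combination hg' + hm
  have hβ : β = 0 := by
    apply (algebraMap F (AlgebraicClosure F)).injective
    apply mul_right_cancel₀ hδ0
    apply mul_left_cancel₀ h2'
    rw [map_zero]
    linear_combination hg' - hm
  apply Subtype.ext
  apply Subtype.ext
  rw [e, hα, hβ]
  simp

theorem exists_sqrt (e : F) : ∃ δ : AlgebraicClosure F, δ ^ 2 = algebraMap F _ e :=
  IsAlgClosed.exists_pow_nat_eq _ two_pos

theorem isCyclic_stabilizer [Finite F] (h2 : (2 : F) ≠ 0) (hE : 0 ∉ E) (h : Pole F E) :
    IsCyclic (stabilizer (SL₂ F) h) := by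
  obtain ⟨δ, hδ⟩ := exists_sqrt (-h.1.det)
  exact isCyclic_of_injective_ringHom (R := AlgebraicClosure F) _ (eigenvalueHom_injective δ h2 hE h hδ)

theorem ringChar_ne_two (h2 : (2 : F) ≠ 0) : ringChar F ≠ 2 := by
  intro h
  apply h2
  have := ringChar.Nat.cast_ringChar (R := F)
  rw [h] at this
  exact_mod_cast this

theorem odd_natCard [Finite F] (h2 : (2 : F) ≠ 0) : Nat.card F % 2 = 1 := by
  have := Fintype.ofFinite F
  rw [Nat.card_eq_fintype_card]
  exact FiniteField.odd_card_of_char_ne_two (ringChar_ne_two h2)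

theorem card_stabilizer_dvd_of_pow {G : Type*} [Group G] [Finite G] [IsCyclic G] {n : ℕ}
    (h : ∀ g : G, g ^ n = 1) : Nat.card G ∣ n := by
  obtain ⟨g, hg⟩ := IsCyclic.exists_ofOrder_eq_natCard (α := G)
  rw [← hg]
  exact orderOf_dvd_of_pow_eq_one (h g)

theorem card_stabilizer_dvd_of_frobenius [Finite F] (h2 : (2 : F) ≠ 0) (hE : 0 ∉ E) (h : Pole F E) :
    ((-h.1.det) ^ (Nat.card F / 2) = 1 → Nat.card (stabilizer (SL₂ F) h) ∣ Nat.card F - 1) ∧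
    ((-h.1.det) ^ (Nat.card F / 2) = -1 → Nat.card (stabilizer (SL₂ F) h) ∣ Nat.card F + 1) := by
  have := Fintype.ofFinite F
  obtain ⟨δ, hδ⟩ := exists_sqrt (-h.1.det)
  have hodd := odd_natCard h2
  have hpos : 0 < Nat.card F := Nat.card_pos
  have := isCyclic_stabilizer h2 hE h
  have hδq : δ ^ Nat.card F = algebraMap F _ ((-h.1.det) ^ (Nat.card F / 2)) * δ := by
    rw [map_pow, ← hδ, ← pow_mul, ← pow_succ]
    congr 1; omega
  have hfrob (g : SL₂ F) : eigenvalue δ h g ^ Nat.card F = algebraMap F _ (g.1.trace / 2) +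
      algebraMap F _ ((g.1 * h.1).trace / (2 * -h.1.det)) * δ ^ Nat.card F := by
    have := map_add (FiniteField.frobeniusAlgHom F (AlgebraicClosure F))
      (algebraMap F _ (g.1.trace / 2)) (algebraMap F _ ((g.1 * h.1).trace / (2 * -h.1.det)) * δ)
    rw [map_mul, AlgHom.commutes, AlgHom.commutes] at this
    rw [Nat.card_eq_fintype_card]
    exact this
  have hm (g : stabilizer (SL₂ F) h) := eigenvalue_mul_eq δ h2 hE hδ g.2
  constructor
  · intro h1
    apply card_stabilizer_dvd_of_pow
    intro g
    apply eigenvalueHom_injective δ h2 hE h hδ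
    rw [map_pow, map_one]
    change eigenvalue δ h g.1 ^ _ = 1
    have hf := hfrob g.1
    rw [hδq, h1, map_one, one_mul] at hf
    apply mul_left_cancel₀ (left_ne_zero_of_mul_eq_one (hm g))
    rw [← pow_succ', Nat.sub_add_cancel hpos, hf, mul_one]
    rfl
  · intro h1
    apply card_stabilizer_dvd_of_pow
    intro g
    apply eigenvalueHom_injective δ h2 hE h hδ
    rw [map_pow, map_one]
    change eigenvalue δ h g.1 ^ _ = 1
    have hf := hfrob g.1
    rw [hδq, h1, map_neg, map_one] at hf
    rw [pow_succ', hf]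
    refine Eq.trans ?_ (hm g)
    ring

theorem card_stabilizer_dvd [Finite F] (h2 : (2 : F) ≠ 0) (hE : 0 ∉ E) (h : Pole F E) :
    Nat.card (stabilizer (SL₂ F) h) ∣ Nat.card F - 1 ∨
      Nat.card (stabilizer (SL₂ F) h) ∣ Nat.card F + 1 := by
  have := Fintype.ofFinite F
  have he : -h.1.det ≠ 0 := fun e => hE (by simpa [e] using h.2.2)
  obtain ⟨a, b⟩ := card_stabilizer_dvd_of_frobenius h2 hE h
  rcases FiniteField.pow_dichotomy (ringChar_ne_two h2) he with h1 | h1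
  · left; apply a; rwa [Nat.card_eq_fintype_card]
  · right; apply b; rwa [Nat.card_eq_fintype_card]

theorem card_stabilizer_dvd_of_not_isSquare [Finite F] (h2 : (2 : F) ≠ 0) (hE : 0 ∉ E)
    (h : Pole F E) (hs : ¬ IsSquare (-h.1.det)) :
    Nat.card (stabilizer (SL₂ F) h) ∣ Nat.card F + 1 := by
  have := Fintype.ofFinite F
  have he : -h.1.det ≠ 0 := fun e => hE (by simpa [e] using h.2.2)
  obtain ⟨a, b⟩ := card_stabilizer_dvd_of_frobenius h2 hE h
  apply b
  rw [Nat.card_eq_fintype_card]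
  rcases FiniteField.pow_dichotomy (ringChar_ne_two h2) he with h1 | h1
  · exact absurd ((FiniteField.isSquare_iff (ringChar_ne_two h2) he).mpr h1) hs
  · exact h1

end Stabilizer

section Counting

theorem sum_inv_eq_cases {N n₁ n₂ n₃ m₁ m₂ m₃ : ℕ} (h₁ : m₁ * n₁ = N) (h₂ : m₂ * n₂ = N)
    (h₃ : m₃ * n₃ = N) (hn : 2 ≤ n₁) (h₁₂ : n₁ ≤ n₂) (h₂₃ : n₂ ≤ n₃)
    (hs : m₁ + m₂ + m₃ = N + 2) :
    n₁ = 2 ∧ (n₂ = 2 ∧ 2 * n₃ = N ∨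
      n₂ = 3 ∧ (n₃ = 3 ∧ N = 12 ∨ n₃ = 4 ∧ N = 24 ∨ n₃ = 5 ∧ N = 60)) := by
  have hn₁ : n₁ = 2 := by
    by_contra h
    have a₁ : m₁ * 3 ≤ m₁ * n₁ := Nat.mul_le_mul_left _ (by omega)
    have a₂ : m₂ * 3 ≤ m₂ * n₂ := Nat.mul_le_mul_left _ (by omega)
    have a₃ : m₃ * 3 ≤ m₃ * n₃ := Nat.mul_le_mul_left _ (by omega)
    omega
  subst hn₁
  refine ⟨rfl, ?_⟩
  have hn₂ : n₂ < 4 := by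
    by_contra h
    have a₂ : m₂ * 4 ≤ m₂ * n₂ := Nat.mul_le_mul_left _ (by omega)
    have a₃ : m₃ * 4 ≤ m₃ * n₃ := Nat.mul_le_mul_left _ (by omega)
    omega
  interval_cases n₂
  · left
    have : m₃ = 2 := by omega
    subst this
    exact ⟨rfl, h₃⟩
  · right
    have hn₃ : n₃ < 6 := by
      by_contra h
      have a₃ : m₃ * 6 ≤ m₃ * n₃ := Nat.mul_le_mul_left _ (by omega)
      omega
    interval_cases n₃ <;> omega

variable {G X : Type*} [Group G] [Finite X] [MulAction G X]

theorem exists_orbit_step {N : ℕ} {n : X → ℕ} (hG : Nat.card G = 2 * N)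
    (hn : ∀ x, Nat.card (stabilizer G x) = 2 * n x) (S : Finset X)
    (hS : ∀ (g : G), ∀ x ∈ S, g • x ∈ S) (hpos : 0 < ∑ x ∈ S, (n x - 1)) :
    ∃ x ∈ S, 2 ≤ n x ∧ ∃ S' : Finset X, (∀ (g : G), ∀ x ∈ S', g • x ∈ S') ∧
      ∃ m, m * n x = N ∧ ∑ x ∈ S, (n x - 1) = (N - m) + ∑ x ∈ S', (n x - 1) ∧
        ∀ y ∈ S, y ∈ S' ∨ n y = n x := by
  classical
  have := Fintype.ofFinite X
  obtain ⟨x, hx, hx0⟩ : ∃ x ∈ S, n x - 1 ≠ 0 := by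
    by_contra! h
    rw [Finset.sum_eq_zero h] at hpos
    exact absurd hpos (lt_irrefl 0)
  have hconst : ∀ y ∈ orbit G x, n y = n x := by
    intro y hy
    have := Nat.card_congr (stabilizerEquivStabilizerOfOrbitRel (G := G) (a := y) (b := x) hy).toEquiv
    rw [hn, hn] at this
    omega
  have hmn : Nat.card (orbit G x) * n x = N := by
    have h := Nat.card_congr (orbitProdStabilizerEquivGroup G x)
    rw [Nat.card_prod, hn, hG] at h
    apply Nat.eq_of_mul_eq_mul_left two_pos
    rw [← h]; ring
  let O : Finset X := (orbit G x).toFinset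
  have hO : O ⊆ S := by
    intro y hy
    rw [Set.mem_toFinset] at hy
    obtain ⟨g, rfl⟩ := hy
    exact hS g x hx
  refine ⟨x, hx, by omega, S \ O, ?_, Nat.card (orbit G x), hmn, ?_, ?_⟩
  · intro g y hy
    simp only [O, Finset.mem_sdiff, Set.mem_toFinset] at hy ⊢
    refine ⟨hS g y hy.1, fun h => hy.2 ?_⟩
    simpa using mem_orbit_of_mem_orbit g⁻¹ h
  · rw [← Finset.sum_sdiff hO, add_comm]
    congr 1
    rw [Finset.sum_congr rfl (g := fun _ => n x - 1)
      (fun y hy => by rw [hconst y (Set.mem_toFinset.mp hy)]), Finset.sum_const, smul_eq_mul,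
      Nat.mul_sub, mul_one]
    have : O.card = Nat.card (orbit G x) := by
      rw [Nat.card_eq_fintype_card, Set.toFinset_card]
    rw [this, hmn]
  · intro y hy
    by_cases h : y ∈ orbit G x
    · exact Or.inr (hconst y h)
    · left; simp [O, hy, h]

theorem orbit_types [Finite G] {N : ℕ} {n : X → ℕ} (hN : 2 ≤ N) (hG : Nat.card G = 2 * N)
    (hn : ∀ x, Nat.card (stabilizer G x) = 2 * n x) [Fintype X]
    (hsum : ∑ x, (n x - 1) = 2 * N - 2) :
    (∃ x, n x = N) ∨ (∃ x, 2 * n x = N) ∨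
    (N = 12 ∧ (∃ x, n x = 3) ∧ ∀ x, n x ∈ ({1, 2, 3} : Set ℕ)) ∨
    (N = 24 ∧ (∃ x, n x = 4) ∧ (∃ x, n x = 2) ∧ ∀ x, n x ∈ ({1, 2, 3, 4} : Set ℕ)) ∨
    (N = 60 ∧ (∃ x, n x = 5) ∧ (∃ x, n x = 2) ∧ ∀ x, n x ∈ ({1, 2, 3, 5} : Set ℕ)) := by
  obtain ⟨x₁, -, h₁, S₁, hS₁, m₁, e₁, s₁, t₁⟩ := exists_orbit_step hG hn Finset.univ
    (fun _ _ _ => Finset.mem_univ _) (by omega)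
  have b₁ : m₁ * 2 ≤ m₁ * n x₁ := Nat.mul_le_mul_left _ h₁
  have p₁ : 0 < m₁ := by by_contra h; have : m₁ = 0 := by omega
                         subst this; omega
  obtain ⟨x₂, -, h₂, S₂, hS₂, m₂, e₂, s₂, t₂⟩ := exists_orbit_step hG hn S₁ hS₁ (by omega)
  have b₂ : m₂ * 2 ≤ m₂ * n x₂ := Nat.mul_le_mul_left _ h₂
  have p₂ : 0 < m₂ := by by_contra h; have : m₂ = 0 := by omega
                         subst this; omega
  by_cases hm : m₁ = 1
  · left; subst hm; exact ⟨x₁, by omega⟩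
  obtain ⟨x₃, -, h₃, S₃, hS₃, m₃, e₃, s₃, t₃⟩ := exists_orbit_step hG hn S₂ hS₂ (by omega)
  have b₃ : m₃ * 2 ≤ m₃ * n x₃ := Nat.mul_le_mul_left _ h₃
  have z : ∑ x ∈ S₃, (n x - 1) = 0 := by
    by_contra h0
    obtain ⟨x₄, -, h₄, S₄, hS₄, m₄, e₄, s₄, t₄⟩ := exists_orbit_step hG hn S₃ hS₃ (by omega)
    have b₄ : m₄ * 2 ≤ m₄ * n x₄ := Nat.mul_le_mul_left _ h₄
    omega
  have hs : m₁ + m₂ + m₃ = N + 2 := by omega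
  have all : ∀ x, n x = 1 ∨ n x = n x₁ ∨ n x = n x₂ ∨ n x = n x₃ := by
    intro x
    rcases t₁ x (Finset.mem_univ _) with h | h
    · rcases t₂ x h with h | h
      · rcases t₃ x h with h | h
        · have := (Finset.sum_eq_zero_iff.mp z) x h
          have h0 : n x ≠ 0 := by
            intro h0; have := hn x; rw [h0] at this
            exact absurd this (by have := Nat.card_pos (α := stabilizer G x); omega)
          omega
        · tauto
      · tauto
    · tauto
  right
  have concl : ∀ y₁ y₂ y₃ : X, (n y₁ = 2 ∧ (n y₂ = 2 ∧ 2 * n y₃ = N ∨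
      n y₂ = 3 ∧ (n y₃ = 3 ∧ N = 12 ∨ n y₃ = 4 ∧ N = 24 ∨ n y₃ = 5 ∧ N = 60))) →
      (∀ x, n x = 1 ∨ n x = n y₁ ∨ n x = n y₂ ∨ n x = n y₃) →
    (∃ x, 2 * n x = N) ∨
    (N = 12 ∧ (∃ x, n x = 3) ∧ ∀ x, n x ∈ ({1, 2, 3} : Set ℕ)) ∨
    (N = 24 ∧ (∃ x, n x = 4) ∧ (∃ x, n x = 2) ∧ ∀ x, n x ∈ ({1, 2, 3, 4} : Set ℕ)) ∨
    (N = 60 ∧ (∃ x, n x = 5) ∧ (∃ x, n x = 2) ∧ ∀ x, n x ∈ ({1, 2, 3, 5} : Set ℕ)) := by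
    rintro y₁ y₂ y₃ ⟨k₁, ⟨k₂, k₃⟩ | ⟨k₂, ⟨k₃, k⟩ | ⟨k₃, k⟩ | ⟨k₃, k⟩⟩⟩ hall
    · exact Or.inl ⟨y₃, k₃⟩
    · refine Or.inr (Or.inl ⟨k, ⟨y₂, k₂⟩, fun x => ?_⟩)
      rw [k₁, k₂, k₃] at hall
      have := hall x
      simp only [Set.mem_insert_iff, Set.mem_singleton_iff]
      tauto
    · refine Or.inr (Or.inr (Or.inl ⟨k, ⟨y₃, k₃⟩, ⟨y₁, k₁⟩, fun x => ?_⟩))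
      rw [k₁, k₂, k₃] at hall
      simpa using hall x
    · refine Or.inr (Or.inr (Or.inr ⟨k, ⟨y₃, k₃⟩, ⟨y₁, k₁⟩, fun x => ?_⟩))
      rw [k₁, k₂, k₃] at hall
      simpa using hall x
  rcases le_total (n x₁) (n x₂) with h12 | h12 <;> rcases le_total (n x₂) (n x₃) with h23 | h23 <;>
    rcases le_total (n x₁) (n x₃) with h13 | h13
  · exact concl x₁ x₂ x₃ (sum_inv_eq_cases e₁ e₂ e₃ h₁ h12 h23 (by omega)) all
  · exact concl x₁ x₂ x₃ (sum_inv_eq_cases e₁ e₂ e₃ h₁ h12 h23 (by omega)) all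
  · exact concl x₁ x₃ x₂ (sum_inv_eq_cases e₁ e₃ e₂ h₁ h13 h23 (by omega))
      (fun x => by have := all x; tauto)
  · exact concl x₃ x₁ x₂ (sum_inv_eq_cases e₃ e₁ e₂ h₃ h13 h12 (by omega))
      (fun x => by have := all x; tauto)
  · exact concl x₂ x₁ x₃ (sum_inv_eq_cases e₂ e₁ e₃ h₂ h12 h13 (by omega))
      (fun x => by have := all x; tauto)
  · exact concl x₂ x₃ x₁ (sum_inv_eq_cases e₂ e₃ e₁ h₂ h23 h13 (by omega))
      (fun x => by have := all x; tauto)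
  · exact concl x₃ x₂ x₁ (sum_inv_eq_cases e₃ e₂ e₁ h₃ h23 h12 (by omega))
      (fun x => by have := all x; tauto)
  · exact concl x₃ x₂ x₁ (sum_inv_eq_cases e₃ e₂ e₁ h₃ h23 h12 (by omega))
      (fun x => by have := all x; tauto)

/-- Double counting of the pairs `(g, x)` with `g • x = x`. -/
theorem sum_card_stabilizer [Fintype G] [Fintype X] :
    ∑ x : X, Nat.card (stabilizer G x) = ∑ g : G, Nat.card {x : X // g • x = x} := by
  simp only [← Nat.card_sigma]
  apply Nat.card_congr
  exact
    { toFun := fun p => ⟨p.2.1, p.1, p.2.2⟩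
      invFun := fun p => ⟨p.2.1, p.1, p.2.2⟩
      left_inv := fun _ => rfl
      right_inv := fun _ => rfl }

end Counting

section Traces

variable {F : Type*} [Field F]

theorem smul_coe_eq_smul_one (h2 : (2 : F) ≠ 0) {g : SL₂ F} {m c : F} (hm : m ≠ 0)
    (h : m • g.1 = c • (1 : Matrix (Fin 2) (Fin 2) F)) : g = 1 ∨ g = -1 := by
  by_contra! hg
  apply tracelessPart_ne_zero h2 hg.1 hg.2
  have e : g.1 = (c / m) • (1 : Matrix (Fin 2) (Fin 2) F) := by
    have := congrArg (fun x => m⁻¹ • x) h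
    simpa [smul_smul, hm, div_eq_inv_mul] using this
  have e' := congrArg tracelessPart e
  rw [e']
  simp [tracelessPart, smul_smul, mul_comm]

theorem eq_or_trace_eq_zero_of_pow_four (h2 : (2 : F) ≠ 0) {g : SL₂ F} (hg : g ^ 4 = 1) :
    (g = 1 ∨ g = -1) ∨ g.1.trace = 0 := by
  have h : (g * g) * (g * g) = 1 := by rw [← pow_two, ← pow_two, ← pow_mul, hg]
  rcases eq_one_or_eq_neg_one_of_mul_self h2 h with h | h
  · exact Or.inl (eq_one_or_eq_neg_one_of_mul_self h2 h)
  · exact Or.inr ((mul_self_eq_neg_one_iff g).mp h)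

theorem coe_pow_three (g : SL₂ F) : (g ^ 3).1 = (g.1.trace ^ 2 - 1) • g.1 -
    g.1.trace • (1 : Matrix (Fin 2) (Fin 2) F) := by
  have h := coe_mul_self g
  rw [pow_succ, pow_two, Matrix.SpecialLinearGroup.coe_mul, Matrix.SpecialLinearGroup.coe_mul, h,
    Matrix.sub_mul, Matrix.smul_mul, h, Matrix.one_mul]
  module

theorem coe_pow_five (g : SL₂ F) :
    (g ^ 5).1 = ((g.1.trace ^ 2 - g.1.trace - 1) * (g.1.trace ^ 2 + g.1.trace - 1)) • g.1 -
      (g.1.trace ^ 3 - 2 * g.1.trace) • (1 : Matrix (Fin 2) (Fin 2) F) := by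
  have h := coe_mul_self g
  have e : g ^ 5 = g ^ 3 * g * g := by group
  rw [e, Matrix.SpecialLinearGroup.coe_mul, Matrix.SpecialLinearGroup.coe_mul, Matrix.mul_assoc, h,
    coe_pow_three]
  simp only [Matrix.sub_mul, Matrix.mul_sub, Matrix.smul_mul, Matrix.mul_smul, h, Matrix.one_mul,
    Matrix.mul_one]
  module

theorem coe_eq_of_eq {g k : SL₂ F} (h : g = k) : g.1 = k.1 := by rw [h]

theorem coe_neg_one : (-1 : SL₂ F).1 = -1 := by simp

theorem trace_sq_eq_one_of_pow_six (h2 : (2 : F) ≠ 0) {g : SL₂ F} (hg : g ^ 6 = 1) :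
    (g = 1 ∨ g = -1) ∨ g.1.trace ^ 2 = 1 := by
  by_cases ht : g.1.trace ^ 2 - 1 = 0
  · right; linear_combination ht
  left
  have h : g ^ 3 * g ^ 3 = 1 := by rw [← hg]; group
  have e := coe_pow_three g
  rcases eq_one_or_eq_neg_one_of_mul_self h2 h with h | h
  · refine smul_coe_eq_smul_one h2 (c := g.1.trace + 1) ht ?_
    have := coe_eq_of_eq h
    rw [e, Matrix.SpecialLinearGroup.coe_one, sub_eq_iff_eq_add] at this
    rw [this]; module
  · refine smul_coe_eq_smul_one h2 (c := g.1.trace - 1) ht ?_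
    have := coe_eq_of_eq h
    rw [e, coe_neg_one, sub_eq_iff_eq_add] at this
    rw [this]; module

theorem trace_of_pow_ten (h2 : (2 : F) ≠ 0) {g : SL₂ F} (hg : g ^ 10 = 1) :
    (g = 1 ∨ g = -1) ∨ g.1.trace ^ 2 = g.1.trace + 1 ∨ g.1.trace ^ 2 = -g.1.trace + 1 := by
  by_cases ht : (g.1.trace ^ 2 - g.1.trace - 1) * (g.1.trace ^ 2 + g.1.trace - 1) = 0
  · right
    rcases mul_eq_zero.mp ht with h | h
    · left; linear_combination h
    · right; linear_combination h
  left
  have h : g ^ 5 * g ^ 5 = 1 := by rw [← hg]; group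
  have e := coe_pow_five g
  rcases eq_one_or_eq_neg_one_of_mul_self h2 h with h | h
  · refine smul_coe_eq_smul_one h2 (c := (g.1.trace ^ 3 - 2 * g.1.trace) + 1) ht ?_
    have := coe_eq_of_eq h
    rw [e, Matrix.SpecialLinearGroup.coe_one, sub_eq_iff_eq_add] at this
    rw [this]; module
  · refine smul_coe_eq_smul_one h2 (c := (g.1.trace ^ 3 - 2 * g.1.trace) - 1) ht ?_
    have := coe_eq_of_eq h
    rw [e, coe_neg_one, sub_eq_iff_eq_add] at this
    rw [this]; module

theorem trace_of_pow_eight (h2 : (2 : F) ≠ 0) {g : SL₂ F} (hg : g ^ 8 = 1) :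
    (g = 1 ∨ g = -1) ∨ g.1.trace = 0 ∨ g.1.trace ^ 2 = 2 := by
  have h : (g * g) ^ 4 = 1 := by rw [← pow_two, ← pow_mul, hg]
  have ht : (g * g).1.trace = g.1.trace ^ 2 - 2 := by
    have := trace_mul_mul_left g 1
    simp only [mul_one] at this
    rw [this, trace_one]; ring
  rcases eq_or_trace_eq_zero_of_pow_four h2 h with (h | h) | h
  · exact Or.inl (eq_one_or_eq_neg_one_of_mul_self h2 h)
  · exact Or.inr (Or.inl ((mul_self_eq_neg_one_iff g).mp h))
  · right; right; linear_combination h - ht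

end Traces

section Nonsquare

variable {F : Type*} [Field F]

theorem card_eq_two_of_iff (h2 : (2 : F) ≠ 0) {P : F → Prop} {s : F} (hs : s ≠ 0)
    (hP : ∀ x, P x ↔ x = s ∨ x = -s) : Nat.card {x // P x} = 2 := by
  have hne : s ≠ -s := by
    intro h; apply hs; apply mul_left_cancel₀ h2; linear_combination h
  have : {x | P x} = {s, -s} := by ext x; simpa using hP x
  change Nat.card {x | P x} = 2
  rw [this, Nat.card_coe_set_eq, Set.ncard_pair hne]

theorem isSquare_mul_of_not [Finite F] (h2 : (2 : F) ≠ 0) {a b : F} (ha : ¬ IsSquare a)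
    (hb : ¬ IsSquare b) : IsSquare (a * b) := by
  have := Fintype.ofFinite F
  have ha0 : a ≠ 0 := by rintro rfl; exact ha (IsSquare.zero)
  have hb0 : b ≠ 0 := by rintro rfl; exact hb (IsSquare.zero)
  have hc := ringChar_ne_two h2
  rw [FiniteField.isSquare_iff hc ha0] at ha
  rw [FiniteField.isSquare_iff hc hb0] at hb
  rw [FiniteField.isSquare_iff hc (mul_ne_zero ha0 hb0), mul_pow,
    (FiniteField.pow_dichotomy hc ha0).resolve_left ha,
    (FiniteField.pow_dichotomy hc hb0).resolve_left hb]
  ring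

theorem exists_mul_sq_eq_iff {d e : F} (hd : d ≠ 0) (he : e ≠ 0)
    (h : IsSquare (d * e)) : ∃ s : F, s ≠ 0 ∧ ∀ μ : F, μ ^ 2 * d = e ↔ μ = s ∨ μ = -s := by
  obtain ⟨r, hr⟩ := h
  have hr0 : r ≠ 0 := by rintro rfl; simp [hd, he] at hr
  refine ⟨r / d, div_ne_zero hr0 hd, fun μ => ?_⟩
  rw [← sq_eq_sq_iff_eq_or_eq_neg]
  constructor
  · intro h
    field_simp
    linear_combination d * h + hr
  · intro h
    rw [h]; field_simp
    linear_combination -hr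

theorem not_isSquare_of_mul_sq {μ d e : F} (he : ¬ IsSquare e) (h : μ ^ 2 * d = e) : ¬ IsSquare d := by
  rintro ⟨r, rfl⟩
  exact he ⟨μ * r, by rw [← h]; ring⟩

theorem isSquare_of_mul_sq {μ d e : F} (he0 : e ≠ 0) (he : IsSquare e) (h : μ ^ 2 * d = e) :
    IsSquare d := by
  obtain ⟨r, rfl⟩ := he
  have hμ : μ ≠ 0 := by rintro rfl; apply he0; rw [← h]; ring
  exact ⟨r / μ, by field_simp; linear_combination h⟩

variable {ν : F}

theorem card_fixed_pair [Finite F] (h2 : (2 : F) ≠ 0) (hν : ¬ IsSquare ν) {g : SL₂ F} (h₁ : g ≠ 1)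
    (h₂ : g ≠ -1) (hd : g.1.trace ^ 2 - 4 ≠ 0) :
    Nat.card {h : Pole F {1, ν} // g • h = h} = 2 := by
  have hν0 : ν ≠ 0 := by rintro rfl; exact hν IsSquare.zero
  rw [Nat.card_congr (fixedEquiv h2 h₁ h₂)]
  by_cases hs : IsSquare (g.1.trace ^ 2 - 4)
  · obtain ⟨s, hs0, h⟩ := exists_mul_sq_eq_iff hd one_ne_zero (by rwa [mul_one])
    refine card_eq_two_of_iff h2 hs0 fun μ => ?_
    rw [← h μ, Set.mem_insert_iff, Set.mem_singleton_iff]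
    exact or_iff_left fun h' => not_isSquare_of_mul_sq hν h' hs
  · obtain ⟨s, hs0, h⟩ := exists_mul_sq_eq_iff hd hν0 (isSquare_mul_of_not h2 hs hν)
    refine card_eq_two_of_iff h2 hs0 fun μ => ?_
    rw [← h μ, Set.mem_insert_iff, Set.mem_singleton_iff]
    exact or_iff_right fun h' => hs (isSquare_of_mul_sq one_ne_zero IsSquare.one h')

theorem card_fixed_nonsquare [Finite F] (h2 : (2 : F) ≠ 0) (hν : ¬ IsSquare ν) {g : SL₂ F} (h₁ : g ≠ 1)
    (h₂ : g ≠ -1) (hs : ¬ IsSquare (g.1.trace ^ 2 - 4)) :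
    Nat.card {h : Pole F {ν} // g • h = h} = 2 := by
  have hν0 : ν ≠ 0 := by rintro rfl; exact hν IsSquare.zero
  have hd : g.1.trace ^ 2 - 4 ≠ 0 := by intro h; rw [h] at hs; exact hs IsSquare.zero
  rw [Nat.card_congr (fixedEquiv h2 h₁ h₂)]
  obtain ⟨s, hs0, h⟩ := exists_mul_sq_eq_iff hd hν0 (isSquare_mul_of_not h2 hs hν)
  exact card_eq_two_of_iff h2 hs0 fun μ => by rw [← h μ, Set.mem_singleton_iff]

theorem card_fixed_square (h2 : (2 : F) ≠ 0) (hν : ¬ IsSquare ν) {g : SL₂ F} (h₁ : g ≠ 1)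
    (h₂ : g ≠ -1) (hs : IsSquare (g.1.trace ^ 2 - 4)) :
    Nat.card {h : Pole F {ν} // g • h = h} = 0 := by
  rw [Nat.card_congr (fixedEquiv h2 h₁ h₂), Nat.card_eq_zero]
  left
  constructor
  rintro ⟨μ, hμ⟩
  exact not_isSquare_of_mul_sq hν (Set.mem_singleton_iff.mp hμ) hs

end Nonsquare

section Centralizers

variable {F : Type*} [Field F] {E : Set F}

theorem neg_one_smul_pole (h : Pole F E) : (-1 : SL₂ F) • h = h := by
  rw [Pole.smul_eq_self_iff, coe_neg_one]
  exact (Commute.one_left _).neg_left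

theorem commute_coe_iff {g k : SL₂ F} :
    Commute (g.1 : Matrix (Fin 2) (Fin 2) F) k.1 ↔ Commute g k := by
  constructor
  · intro h
    apply Subtype.ext
    change (g * k).1 = (k * g).1
    rw [Matrix.SpecialLinearGroup.coe_mul, Matrix.SpecialLinearGroup.coe_mul]
    exact h.eq
  · intro h
    have := coe_eq_of_eq h.eq
    rwa [Matrix.SpecialLinearGroup.coe_mul, Matrix.SpecialLinearGroup.coe_mul] at this

/-- The stabilizer of a pole is the centralizer of each of its non-scalar elements. -/
theorem smul_eq_iff_commute (h2 : (2 : F) ≠ 0) (hE : 0 ∉ E) {a : SL₂ F} (h₁ : a ≠ 1) (h₂ : a ≠ -1)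
    {h : Pole F E} (ha : a • h = h) (g : SL₂ F) : g • h = h ↔ Commute g a := by
  obtain ⟨μ, hμ⟩ := (fixed_iff h2 h₁ h₂ h).mp ha
  rw [Pole.smul_eq_self_iff, ← commute_coe_iff]
  constructor
  · intro hg
    rw [Pole.smul_eq_self_iff, ← commute_tracelessPart_iff h2] at ha
    rw [Commute.symm_iff, ← commute_tracelessPart_iff h2]
    obtain ⟨κ, hκ⟩ := exists_smul_of_commute h2 h.2.1 (trace_tracelessPart _)
      (Pole.ne_zero hE h) ha.symm
    rw [hκ]
    exact (hg.symm).smul_left κ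
  · intro hg
    rw [hμ]
    exact ((commute_tracelessPart_iff h2 _ _).mpr hg.symm).symm.smul_right μ

theorem eq_or_eq_inv_of_commute (h2 : (2 : F) ≠ 0) {a b : SL₂ F} (h₁ : a ≠ 1) (h₂ : a ≠ -1)
    (hd : a.1.trace ^ 2 - 4 ≠ 0) (ht : b.1.trace = a.1.trace) (hc : Commute a b) :
    b = a ∨ b = a⁻¹ := by
  have hc' : Commute (tracelessPart a.1) (tracelessPart b.1) := by
    rw [commute_tracelessPart_iff h2, Commute.symm_iff, commute_tracelessPart_iff h2,
      commute_coe_iff]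
    exact hc.symm
  obtain ⟨μ, hμ⟩ := exists_smul_of_commute h2 (trace_tracelessPart _) (trace_tracelessPart _)
    (tracelessPart_ne_zero h2 h₁ h₂) hc'
  have hμ2 : μ ^ 2 = 1 := by
    have e1 := neg_det_tracelessPart a
    have e2 := neg_det_tracelessPart b
    rw [hμ, det_smul, Fintype.card_fin, ht, ← e1] at e2
    rw [← e1] at hd
    apply mul_right_cancel₀ hd
    linear_combination e2
  have hb : (2 : F) • b.1 = μ • tracelessPart a.1 + a.1.trace • (1 : Matrix (Fin 2) (Fin 2) F) := by
    rw [← hμ, tracelessPart, ht]; simp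
  rcases sq_eq_sq_iff_eq_or_eq_neg.mp (hμ2.trans (one_pow 2).symm) with h | h
  · left
    apply Subtype.ext
    apply smul_right_injective _ h2
    change (2 : F) • b.1 = (2 : F) • a.1
    rw [hb, h, tracelessPart]; module
  · right
    apply Subtype.ext
    apply smul_right_injective _ h2
    change (2 : F) • b.1 = (2 : F) • (a⁻¹).1
    have hi : (a⁻¹).1 = a.1.trace • (1 : Matrix (Fin 2) (Fin 2) F) - a.1 := by
      rw [Matrix.SpecialLinearGroup.coe_inv, adjugate_fin_two]
      ext i j
      fin_cases i <;> fin_cases j <;> simp [trace_fin_two]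
    rw [hb, h, hi, tracelessPart]; module

variable (A : Subgroup (SL₂ F))

/-- `A` contains an element of order `n` whose centralizer in `A` has order `n`. -/
def HasSelfCentralizing (n : ℕ) : Prop :=
  ∃ a : A, orderOf a = n ∧ Nat.card (Subgroup.centralizer ({a} : Set A)) = n

variable {A}

theorem smul_def_pole (g : A) (h : Pole F E) : g • h = (g : SL₂ F) • h := rfl

theorem two_dvd_card_stabilizer [Finite F] (h2 : (2 : F) ≠ 0) (hneg : -1 ∈ A) (h : Pole F E) :
    2 ∣ Nat.card (stabilizer A h) := by
  let z : stabilizer A h := ⟨⟨-1, hneg⟩, neg_one_smul_pole h⟩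
  have hz : orderOf z = 2 := by
    apply orderOf_eq_prime
    · apply Subtype.ext; apply Subtype.ext
      change (-1 : SL₂ F) ^ 2 = 1
      simp
    · intro h
      exact one_ne_neg_one h2 (congrArg (fun x => x.1.1) h).symm
  have := orderOf_dvd_natCard z
  rwa [hz] at this

/-- The inclusion of a stabilizer in `A` into the stabilizer in `SL₂ F`. -/
def stabilizerInclusion (A : Subgroup (SL₂ F)) (h : Pole F E) :
    stabilizer A h →* stabilizer (SL₂ F) h where
  toFun g := ⟨g.1.1, g.2⟩
  map_one' := rfl
  map_mul' _ _ := rfl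

theorem stabilizerInclusion_injective (h : Pole F E) :
    Function.Injective (stabilizerInclusion A h) := by
  intro g k hgk
  apply Subtype.ext; apply Subtype.ext
  exact congrArg (fun x => x.1) hgk

theorem card_stabilizer_dvd_subgroup [Finite F] (h : Pole F E) :
    Nat.card (stabilizer A h) ∣ Nat.card (stabilizer (SL₂ F) h) :=
  Subgroup.card_dvd_of_injective _ (stabilizerInclusion_injective h)

theorem hasSelfCentralizing [Finite F] (h2 : (2 : F) ≠ 0) (hE : 0 ∉ E) {h : Pole F E} {n : ℕ}
    (hn : Nat.card (stabilizer A h) = n) (h3 : 2 < n) : HasSelfCentralizing A n := by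
  have := isCyclic_stabilizer h2 hE h
  have : IsCyclic (stabilizer A h) := isCyclic_of_injective _ (stabilizerInclusion_injective h)
  obtain ⟨a, ha⟩ := IsCyclic.exists_ofOrder_eq_natCard (α := stabilizer A h)
  have ho : orderOf a.1 = n := by rw [Subgroup.orderOf_coe, ha, hn]
  have ho' : orderOf a.1.1 = n := by rw [Subgroup.orderOf_coe, ho]
  have h₁ : a.1.1 ≠ 1 := by
    intro h; rw [h, orderOf_one] at ho'; omega
  have h₂ : a.1.1 ≠ -1 := by
    intro h
    have : orderOf a.1.1 ∣ 2 := orderOf_dvd_of_pow_eq_one (by rw [h]; simp)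
    have := Nat.le_of_dvd two_pos this
    omega
  refine ⟨a.1, ho, ?_⟩
  rw [← hn]
  congr 2
  ext g
  rw [Subgroup.mem_centralizer_singleton_iff, mem_stabilizer_iff, smul_def_pole,
    smul_eq_iff_commute h2 hE h₁ h₂ a.2, Subtype.ext_iff]
  exact Iff.rfl

end Centralizers

section NonModular

variable {F : Type*} [Field F] {A : Subgroup (SL₂ F)}

theorem trace_eq_two_of_orderOf {ℓ : ℕ} [Fact ℓ.Prime] [CharP F ℓ] {g : SL₂ F}
    (hg : g ^ ℓ = 1) : g.1.trace = 2 := by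
  have h1 : (g.1 - 1 : Matrix (Fin 2) (Fin 2) F) ^ ℓ = 0 := by
    rw [sub_pow_char_of_commute _ (Commute.one_right _), ← Matrix.SpecialLinearGroup.coe_pow, hg]
    simp
  have h2 := Matrix.isNilpotent_trace_of_isNilpotent (⟨ℓ, h1⟩ : IsNilpotent (g.1 - 1))
  have h3 := h2.eq_zero
  rw [trace_sub, Matrix.trace_one, Fintype.card_fin, sub_eq_zero] at h3
  exact_mod_cast h3

theorem not_dvd_card_of_nonmodular [Finite F] (hmod : ∀ g ∈ A, g.1.trace = 2 → g = 1) {ℓ : ℕ} (hℓ : ℓ.Prime)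
    (hF : ℓ ∣ Nat.card F) : ¬ ℓ ∣ Nat.card A := by
  intro hA
  have : Fact ℓ.Prime := ⟨hℓ⟩
  have : CharP F ℓ := by
    have := Fintype.ofFinite F
    obtain ⟨p, hp⟩ := CharP.exists F
    obtain ⟨n, hpp, hn⟩ := FiniteField.card F p
    rw [Nat.card_eq_fintype_card, hn] at hF
    rw [(Nat.prime_dvd_prime_iff_eq hℓ hpp).mp (hℓ.dvd_of_dvd_pow hF)]
    exact hp
  obtain ⟨g, hg⟩ := exists_prime_orderOf_dvd_card' ℓ hA
  have h1 : g ^ ℓ = 1 := by rw [← hg]; exact pow_orderOf_eq_one g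
  have h2 : (g : SL₂ F) ^ ℓ = 1 := by
    have := congrArg Subtype.val h1
    simpa using this
  have h3 := hmod g g.2 (trace_eq_two_of_orderOf h2)
  have h4 : g = 1 := Subtype.ext h3
  rw [h4, orderOf_one] at hg
  exact hℓ.one_lt.ne hg

theorem trace_sq_ne_four (hneg : -1 ∈ A) (hmod : ∀ g ∈ A, g.1.trace = 2 → g = 1) {g : SL₂ F}
    (hg : g ∈ A) (h₁ : g ≠ 1) (h₂ : g ≠ -1) : g.1.trace ^ 2 - 4 ≠ 0 := by
  intro h
  have : (g.1.trace - 2) * (g.1.trace + 2) = 0 := by linear_combination h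
  rcases mul_eq_zero.mp this with h | h
  · exact h₁ (hmod g hg (sub_eq_zero.mp h))
  · apply h₂
    have h3 := hmod (-g) (by simpa using A.mul_mem hneg hg) (by rw [trace_neg]; linear_combination -h)
    rw [← h3, neg_neg]

theorem sum_fixed_eq [Fintype A] (h2 : (2 : F) ≠ 0) (hneg : -1 ∈ A) (f : A → ℕ) {c k : ℕ}
    (hf₁ : f 1 = k) (hf₂ : f ⟨-1, hneg⟩ = k) (hf : ∀ g : A, g.1 ≠ 1 → g.1 ≠ -1 → f g = c) :
    ∑ g, f g = 2 * k + (Nat.card A - 2) * c := by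
  classical
  have hne : (⟨-1, hneg⟩ : A) ≠ 1 := fun h => one_ne_neg_one h2 (congrArg Subtype.val h).symm
  rw [← Finset.add_sum_erase _ _ (Finset.mem_univ (1 : A)), ← Finset.add_sum_erase _ _
    (Finset.mem_erase.mpr ⟨hne, Finset.mem_univ _⟩), hf₁, hf₂,
    Finset.sum_congr rfl (g := fun _ => c), Finset.sum_const, Finset.card_erase_of_mem,
    Finset.card_erase_of_mem (Finset.mem_univ _), Finset.card_univ, Nat.card_eq_fintype_card,
    smul_eq_mul, Nat.sub_sub]
  · ring
  · exact Finset.mem_erase.mpr ⟨hne, Finset.mem_univ _⟩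
  · intro g hg
    simp only [Finset.mem_erase, Finset.mem_univ, and_true] at hg
    exact hf g (fun h => hg.2 (Subtype.ext h)) (fun h => hg.1 (Subtype.ext h))

theorem card_fixed_of_forall {X : Type*} {P : X → Prop} (h : ∀ x, P x) :
    Nat.card {x // P x} = Nat.card X :=
  Nat.card_congr (Equiv.subtypeUnivEquiv h)

theorem nonmodular_cases [Finite F] (h2 : (2 : F) ≠ 0) (hneg : -1 ∈ A)
    (hmod : ∀ g ∈ A, g.1.trace = 2 → g = 1) (hdvd : 2 * (Nat.card F + 1) ∣ Nat.card A) :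
    (Nat.card A = 2 * (Nat.card F + 1) ∧ HasSelfCentralizing A (Nat.card F + 1)) ∨
    ((Nat.card F = 5 ∨ Nat.card F = 11) ∧ Nat.card A = 24 ∧ HasSelfCentralizing A 6 ∧
      ∀ g ∈ A, (g = 1 ∨ g = -1) ∨ g.1.trace = 0 ∨ g.1.trace ^ 2 = 1) ∨
    ((Nat.card F = 7 ∨ Nat.card F = 23) ∧ Nat.card A = 48 ∧ HasSelfCentralizing A 8 ∧
      HasSelfCentralizing A 4 ∧
      ∀ g ∈ A, (g = 1 ∨ g = -1) ∨ g.1.trace = 0 ∨ g.1.trace ^ 2 = 1 ∨ g.1.trace ^ 2 = 2) ∨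
    ((Nat.card F = 11 ∨ Nat.card F = 19 ∨ Nat.card F = 29 ∨ Nat.card F = 59) ∧
      Nat.card A = 120 ∧ HasSelfCentralizing A 10 ∧ HasSelfCentralizing A 4 ∧
      ∀ g ∈ A, (g = 1 ∨ g = -1) ∨ g.1.trace = 0 ∨ g.1.trace ^ 2 = 1 ∨
        g.1.trace ^ 2 = g.1.trace + 1 ∨ g.1.trace ^ 2 = -g.1.trace + 1) := by
  have := Fintype.ofFinite F
  obtain ⟨ν, hν⟩ := FiniteField.exists_nonsquare (ringChar_ne_two h2)
  have hE : (0 : F) ∉ ({1, ν} : Set F) := by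
    rintro (h | h)
    · exact zero_ne_one h
    · exact hν (by rw [← Set.mem_singleton_iff.mp h]; exact IsSquare.zero)
  have := Fintype.ofFinite (Pole F {1, ν})
  have := Fintype.ofFinite A
  have hodd := odd_natCard h2
  have hq1 : 1 < Nat.card F := Finite.one_lt_card
  have hApos : 0 < Nat.card A := Nat.card_pos
  have hnd := fun {ℓ : ℕ} => not_dvd_card_of_nonmodular hmod (ℓ := ℓ)
  set q := Nat.card F with hq
  obtain ⟨N, hN⟩ : ∃ N, Nat.card A = 2 * N := by
    obtain ⟨k, hk⟩ := hdvd; exact ⟨(q + 1) * k, by rw [hk]; ring⟩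
  have hqN : q + 1 ∣ N := by
    rw [hN] at hdvd; exact Nat.dvd_of_mul_dvd_mul_left two_pos hdvd
  have hNle := Nat.le_of_dvd (by omega) hqN
  choose n hn using fun h : Pole F {1, ν} => two_dvd_card_stabilizer (A := A) h2 hneg h
  have hnpos : ∀ h, 1 ≤ n h := by
    intro h
    have h1 := hn h
    have : 0 < Nat.card (stabilizer A h) := Nat.card_pos
    omega
  have hsum : ∑ h, (n h - 1) = 2 * N - 2 := by
    have h1 := sum_card_stabilizer (G := A) (X := Pole F {1, ν})
    rw [sum_fixed_eq h2 hneg (fun g : A => Nat.card {x : Pole F {1, ν} // g • x = x}) (c := 2)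
      (k := Nat.card (Pole F {1, ν}))
      (card_fixed_of_forall fun _ => one_smul _ _)
      (card_fixed_of_forall fun h => neg_one_smul_pole h)
      (fun g h₁ h₂ => card_fixed_pair h2 hν h₁ h₂ (trace_sq_ne_four hneg hmod g.2 h₁ h₂))] at h1
    have h3 : ∀ h, Nat.card (stabilizer A h) = 2 * (n h - 1) + 2 := by
      intro h; have := hn h; have := hnpos h; omega
    simp only [h3] at h1
    rw [Finset.sum_add_distrib, ← Finset.mul_sum, Finset.sum_const, Finset.card_univ,
      ← Nat.card_eq_fintype_card, smul_eq_mul] at h1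
    omega
  have hdvdq : ∀ h, 2 * n h ∣ q - 1 ∨ 2 * n h ∣ q + 1 := by
    intro h
    rw [← hn h]
    rcases card_stabilizer_dvd h2 hE h with h1 | h1
    · exact Or.inl ((card_stabilizer_dvd_subgroup h).trans h1)
    · exact Or.inr ((card_stabilizer_dvd_subgroup h).trans h1)
  have hfix : ∀ g ∈ A, g = 1 ∨ g = -1 ∨ ∃ h : Pole F {1, ν}, g ^ (2 * n h) = 1 := by
    intro g hg
    by_contra! hc
    obtain ⟨h₁, h₂, hc⟩ := hc
    have h3 := card_fixed_pair h2 hν h₁ h₂ (trace_sq_ne_four hneg hmod hg h₁ h₂)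
    have : Nonempty {h : Pole F {1, ν} // g • h = h} := by
      by_contra he
      rw [not_nonempty_iff] at he
      rw [Nat.card_of_isEmpty] at h3
      omega
    obtain ⟨h, hh⟩ := this
    apply hc h
    let k : stabilizer A h := ⟨⟨g, hg⟩, hh⟩
    have hk : k ^ (2 * n h) = 1 := by rw [← hn h]; exact pow_card_eq_one'
    exact congrArg (fun x => x.1.1) hk
  rcases orbit_types (by omega) hN hn hsum with ⟨h, hh⟩ | ⟨h, hh⟩ | ⟨rfl, ⟨h, hh⟩, hall⟩ |
    ⟨rfl, ⟨h, hh⟩, ⟨k, hk⟩, hall⟩ | ⟨rfl, ⟨h, hh⟩, ⟨k, hk⟩, hall⟩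
  · exfalso
    rcases hdvdq h with h1 | h1
    · have := Nat.le_of_dvd (by omega) h1; omega
    · have := Nat.le_of_dvd (by omega) h1; omega
  · left
    have hle : N ≤ q + 1 := by
      rcases hdvdq h with h1 | h1
      · have := Nat.le_of_dvd (by omega) h1; omega
      · have := Nat.le_of_dvd (by omega) h1; omega
    have hNq : N = q + 1 := by omega
    refine ⟨by omega, hasSelfCentralizing h2 hE (h := h) ?_ (by omega)⟩
    rw [hn h]; omega
  · right; left
    have hq' : q = 5 ∨ q = 11 := by
      have h3 : q ≠ 3 := fun h3 => hnd Nat.prime_three (by rw [h3]) (by rw [hN]; norm_num)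
      clear_value q
      have : q ≤ 11 := by omega
      interval_cases q <;> omega
    refine ⟨hq', hN, hasSelfCentralizing h2 hE (h := h) (by rw [hn h, hh]) (by omega), ?_⟩
    intro g hg
    rcases hfix g hg with h1 | h1 | ⟨h', h1⟩
    · tauto
    · tauto
    · have := hall h'
      simp only [Set.mem_insert_iff, Set.mem_singleton_iff] at this
      rcases this with h4 | h4 | h4 <;> rw [h4] at h1
      · exact Or.inl (eq_one_or_eq_neg_one_of_mul_self h2 (by rw [← h1, mul_one, pow_two]))
      · have := eq_or_trace_eq_zero_of_pow_four h2 h1; tauto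
      · have := trace_sq_eq_one_of_pow_six h2 h1; tauto
  · right; right; left
    have hq' : q = 7 ∨ q = 23 := by
      have h3 : q ≠ 3 := fun h3 => hnd Nat.prime_three (by rw [h3]) (by rw [hN]; norm_num)
      have h8 := hdvdq h
      rw [hh] at h8
      clear_value q
      have : q ≤ 23 := by omega
      interval_cases q <;> omega
    refine ⟨hq', hN, hasSelfCentralizing h2 hE (h := h) (by rw [hn h, hh]) (by omega),
      hasSelfCentralizing h2 hE (h := k) (by rw [hn k, hk]) (by omega), ?_⟩
    intro g hg
    rcases hfix g hg with h1 | h1 | ⟨h', h1⟩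
    · tauto
    · tauto
    · have := hall h'
      simp only [Set.mem_insert_iff, Set.mem_singleton_iff] at this
      rcases this with h4 | h4 | h4 | h4 <;> rw [h4] at h1
      · exact Or.inl (eq_one_or_eq_neg_one_of_mul_self h2 (by rw [← h1, mul_one, pow_two]))
      · have := eq_or_trace_eq_zero_of_pow_four h2 h1; tauto
      · have := trace_sq_eq_one_of_pow_six h2 h1; tauto
      · have := trace_of_pow_eight h2 h1; tauto
  · right; right; right
    have hq' : q = 11 ∨ q = 19 ∨ q = 29 ∨ q = 59 := by
      have h3 : ¬ 3 ∣ q := fun h3 => hnd Nat.prime_three h3 (by rw [hN]; norm_num)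
      have h5 : ¬ 5 ∣ q := fun h3 => hnd Nat.prime_five h3 (by rw [hN]; norm_num)
      clear_value q
      have : q ≤ 59 := by omega
      interval_cases q <;> omega
    refine ⟨hq', hN, hasSelfCentralizing h2 hE (h := h) (by rw [hn h, hh]) (by omega),
      hasSelfCentralizing h2 hE (h := k) (by rw [hn k, hk]) (by omega), ?_⟩
    intro g hg
    rcases hfix g hg with h1 | h1 | ⟨h', h1⟩
    · tauto
    · tauto
    · have := hall h'
      simp only [Set.mem_insert_iff, Set.mem_singleton_iff] at this
      rcases this with h4 | h4 | h4 | h4 <;> rw [h4] at h1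
      · exact Or.inl (eq_one_or_eq_neg_one_of_mul_self h2 (by rw [← h1, mul_one, pow_two]))
      · have := eq_or_trace_eq_zero_of_pow_four h2 h1; tauto
      · have := trace_sq_eq_one_of_pow_six h2 h1; tauto
      · have := trace_of_pow_ten h2 h1; tauto

end NonModular

section Dihedral

/-- The homomorphism from a dihedral group determined by the images of the rotation of angle
`2π/n` and of a reflection. -/
def dihedralHom {G : Type*} [Group G] {n : ℕ} (r s : G) (hr : r ^ n = 1) (hs : s * s = 1)
    (hsr : s * r * s = r⁻¹) : DihedralGroup n →* G :=
  let φ : ZMod n →+ Additive G := ZMod.lift n ⟨zmultiplesHom (Additive G) (Additive.ofMul r), by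
    rw [zmultiplesHom_apply, natCast_zsmul, ← ofMul_pow, hr, ofMul_one]⟩
  have hφ : ∀ i, s * (φ i).toMul * s = (φ (-i)).toMul := by
    intro i
    obtain ⟨k, rfl⟩ := ZMod.intCast_surjective i
    rw [← Int.cast_neg]
    simp only [φ, ZMod.lift_coe, zmultiplesHom_apply, toMul_zsmul, toMul_ofMul]
    have hs' : s⁻¹ = s := inv_eq_of_mul_eq_one_left hs
    have := conj_zpow (a := s) (b := r) (i := k)
    rw [hs', hsr, _root_.inv_zpow, ← _root_.zpow_neg] at this
    exact this.symm
  have hφ' : ∀ i, (φ i).toMul * s = s * (φ (-i)).toMul := by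
    intro i
    rw [← hφ i, ← mul_assoc, ← mul_assoc, hs, one_mul]
  { toFun := fun x => match x with
      | .r i => (φ i).toMul
      | .sr i => s * (φ i).toMul
    map_one' := by
      change (φ 0).toMul = 1
      simp
    map_mul' := by
      rintro (i | i) (j | j)
      · change (φ (i + j)).toMul = _
        simp
      · change s * (φ (j - i)).toMul = (φ i).toMul * (s * (φ j).toMul)
        rw [← mul_assoc, hφ', sub_eq_neg_add, map_add, toMul_add, mul_assoc]
      · change s * (φ (i + j)).toMul = s * (φ i).toMul * (φ j).toMul
        rw [map_add, toMul_add, mul_assoc]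
      · change (φ (j - i)).toMul = s * (φ i).toMul * (s * (φ j).toMul)
        rw [← mul_assoc, hφ, sub_eq_neg_add, map_add, toMul_add] }

theorem dihedralHom_r {G : Type*} [Group G] {n : ℕ} {r s : G} (hr : r ^ n = 1) (hs : s * s = 1)
    (hsr : s * r * s = r⁻¹) (k : ℤ) : dihedralHom r s hr hs hsr (.r k) = r ^ k := by
  change Additive.toMul (ZMod.lift n (_ : {f : ℤ →+ Additive G // f n = 0}) (k : ZMod n)) = _
  rw [ZMod.lift_coe]
  simp

theorem dihedralHom_sr {G : Type*} [Group G] {n : ℕ} {r s : G} (hr : r ^ n = 1) (hs : s * s = 1)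
    (hsr : s * r * s = r⁻¹) (k : ℤ) : dihedralHom r s hr hs hsr (.sr k) = s * r ^ k := by
  change s * Additive.toMul
    (ZMod.lift n (_ : {f : ℤ →+ Additive G // f n = 0}) (k : ZMod n)) = _
  rw [ZMod.lift_coe]
  simp

theorem nonempty_mulEquiv_dihedralGroup {G : Type*} [Group G] [Finite G] {r s : G}
    (hG : Nat.card G = 2 * orderOf r) (hs : s * s = 1) (hsr : s * r * s = r⁻¹)
    (hn : s ∉ Subgroup.zpowers r) : Nonempty (G ≃* DihedralGroup (orderOf r)) := by
  let f := dihedralHom r s (pow_orderOf_eq_one r) hs hsr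
  have hinj : Function.Injective f := by
    rw [injective_iff_map_eq_one]
    rintro (i | i) hi <;> obtain ⟨k, rfl⟩ := ZMod.intCast_surjective i
    · rw [dihedralHom_r] at hi
      have := orderOf_dvd_iff_zpow_eq_one.mpr hi
      rw [(ZMod.intCast_zmod_eq_zero_iff_dvd k _).mpr this]
      rfl
    · rw [dihedralHom_sr] at hi
      exact absurd ⟨-k, by rw [eq_inv_of_mul_eq_one_left hi]; exact zpow_neg _ _⟩ hn
  have : Finite (DihedralGroup (orderOf r)) := Finite.of_injective f hinj
  refine ⟨(MulEquiv.ofBijective f ?_).symm⟩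
  rw [Nat.bijective_iff_injective_and_card, DihedralGroup.nat_card, hG]
  exact ⟨hinj, rfl⟩

variable {F : Type*} [Field F]

theorem mem_center_iff_eq (h2 : (2 : F) ≠ 0) (g : SL₂ F) :
    g ∈ Subgroup.center (SL₂ F) ↔ g = 1 ∨ g = -1 := by
  constructor
  · intro hg
    obtain ⟨r, hr, h⟩ := Matrix.SpecialLinearGroup.mem_center_iff.mp hg
    refine smul_coe_eq_smul_one h2 (m := 1) (c := r) one_ne_zero ?_
    rw [one_smul]
    rw [← h, Matrix.scalar_apply, Matrix.smul_one_eq_diagonal]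
  · rintro (rfl | rfl)
    · exact one_mem _
    · rw [Subgroup.mem_center_iff]
      intro g; simp

variable {A : Subgroup (SL₂ F)}

/-- The image of `A` in the quotient of `SL₂ F` by its centre. -/
abbrev centralImage (A : Subgroup (SL₂ F)) : Subgroup (SL₂ F ⧸ Subgroup.center (SL₂ F)) :=
  A.map (QuotientGroup.mk' (Subgroup.center (SL₂ F)))

/-- The projection of `A` onto its image modulo the centre. -/
def toCentralImage (A : Subgroup (SL₂ F)) : A →* centralImage A :=
  (QuotientGroup.mk' (Subgroup.center (SL₂ F))).subgroupMap A

theorem toCentralImage_surjective : Function.Surjective (toCentralImage A) :=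
  MonoidHom.subgroupMap_surjective _ _

theorem toCentralImage_eq_one_iff (h2 : (2 : F) ≠ 0) (g : A) :
    toCentralImage A g = 1 ↔ g.1 = 1 ∨ g.1 = -1 := by
  rw [← mem_center_iff_eq h2, Subtype.ext_iff]
  exact QuotientGroup.eq_one_iff g.1

theorem neg_one_mem_of_even [Finite F] (h2 : (2 : F) ≠ 0) (h : 2 ∣ Nat.card (centralImage A)) :
    -1 ∈ A := by
  obtain ⟨x, hx⟩ := exists_prime_orderOf_dvd_card' 2 h
  obtain ⟨g, rfl⟩ := toCentralImage_surjective x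
  have h1 : toCentralImage A (g * g) = 1 := by
    have h2 := pow_orderOf_eq_one (toCentralImage A g)
    rw [hx] at h2
    rw [map_mul, ← pow_two, h2]
  have hg : ¬ toCentralImage A g = 1 := by
    intro h; rw [h, orderOf_one] at hx; omega
  rw [toCentralImage_eq_one_iff h2] at h1 hg
  rcases h1 with h1 | h1
  · exact absurd (eq_one_or_eq_neg_one_of_mul_self h2 h1) hg
  · rw [← h1]; exact (g * g).2

theorem card_eq_two_mul_card_centralImage [Finite F] (h2 : (2 : F) ≠ 0) (hneg : -1 ∈ A) :
    Nat.card A = 2 * Nat.card (centralImage A) := by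
  have hk : Nat.card (toCentralImage A).ker = 2 := by
    have : ((toCentralImage A).ker : Set A) = {1, ⟨-1, hneg⟩} := by
      ext g
      rw [SetLike.mem_coe, MonoidHom.mem_ker, toCentralImage_eq_one_iff h2,
        Set.mem_insert_iff, Set.mem_singleton_iff, Subtype.ext_iff, Subtype.ext_iff]
      exact Iff.rfl
    change Nat.card ((toCentralImage A).ker : Set A) = 2
    rw [this, Nat.card_coe_set_eq, Set.ncard_pair]
    exact fun h => one_ne_neg_one h2 (congrArg Subtype.val h)
  rw [Subgroup.card_eq_card_quotient_mul_card_subgroup (toCentralImage A).ker, hk,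
    Nat.card_congr (QuotientGroup.quotientKerEquivOfSurjective _
      toCentralImage_surjective).toEquiv, mul_comm]

theorem trace_eq_zero_of_mul_eq_inv_mul (h2 : (2 : F) ≠ 0) {a g : SL₂ F}
    (hd : a.1.trace ^ 2 - 4 ≠ 0) (h : g * a = a⁻¹ * g) : g.1.trace = 0 := by
  set h' := tracelessPart a.1 with hh'
  have hi : (a⁻¹).1 = a.1.trace • (1 : Matrix (Fin 2) (Fin 2) F) - a.1 := by
    rw [Matrix.SpecialLinearGroup.coe_inv, adjugate_fin_two]
    ext i j
    fin_cases i <;> fin_cases j <;> simp [trace_fin_two]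
  have e := coe_eq_of_eq h
  rw [Matrix.SpecialLinearGroup.coe_mul, Matrix.SpecialLinearGroup.coe_mul, hi] at e
  have e1 : g.1 * h' = -(h' * g.1) := by
    simp only [hh', tracelessPart, Matrix.mul_sub, Matrix.sub_mul, Matrix.mul_smul,
      Matrix.smul_mul, e, Matrix.one_mul, Matrix.mul_one]
    module
  have e2 : h' * h' = (-h'.det) • (1 : Matrix (Fin 2) (Fin 2) F) :=
    Pole.mul_self (E := Set.univ) ⟨h', trace_tracelessPart _, Set.mem_univ _⟩
  have e3 : (g.1 * (h' * h')).trace = -(g.1 * (h' * h')).trace := by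
    conv_lhs => rw [← Matrix.mul_assoc, e1, Matrix.neg_mul, Matrix.trace_neg, Matrix.mul_assoc,
      Matrix.trace_mul_comm, Matrix.mul_assoc]
  rw [e2, Matrix.mul_smul, Matrix.mul_one, trace_smul, smul_eq_mul, neg_det_tracelessPart] at e3
  apply mul_left_cancel₀ hd
  apply mul_left_cancel₀ h2
  linear_combination e3

theorem trace_conj (a g : SL₂ F) : (g * a * g⁻¹).1.trace = a.1.trace := by
  rw [Matrix.SpecialLinearGroup.coe_mul, Matrix.trace_mul_comm, ← Matrix.SpecialLinearGroup.coe_mul,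
    inv_mul_cancel_left]

theorem ne_one_and_ne_neg_one {a : SL₂ F} (h : 2 < orderOf a) : a ≠ 1 ∧ a ≠ -1 := by
  constructor
  · intro h1; rw [h1, orderOf_one] at h; omega
  · intro h1
    have : orderOf a ∣ 2 := orderOf_dvd_of_pow_eq_one (by rw [h1]; simp)
    have := Nat.le_of_dvd two_pos this
    omega

theorem nonempty_centralImage_mulEquiv_dihedralGroup [Finite F] (h2 : (2 : F) ≠ 0) (hneg : -1 ∈ A)
    (hmod : ∀ g ∈ A, g.1.trace = 2 → g = 1) {n : ℕ} (hn : 2 ≤ n) (hA : Nat.card A = 4 * n)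
    (hc : HasSelfCentralizing A (2 * n)) :
    Nonempty (centralImage A ≃* DihedralGroup n) := by
  obtain ⟨a, ha, hca⟩ := hc
  have ha' : orderOf a.1 = 2 * n := by rw [Subgroup.orderOf_coe, ha]
  obtain ⟨h₁, h₂⟩ := ne_one_and_ne_neg_one (a := a.1) (by omega)
  have hd := trace_sq_ne_four hneg hmod a.2 h₁ h₂
  have hz : Subgroup.zpowers a = Subgroup.centralizer {a} := by
    apply Subgroup.eq_of_le_of_card_ge
    · rw [Subgroup.zpowers_le, Subgroup.mem_centralizer_singleton_iff]
    · rw [Nat.card_zpowers, ha, hca]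
  have hnormal : (Subgroup.zpowers a).Normal := by
    apply Subgroup.normal_of_index_eq_two
    have := Subgroup.card_mul_index (Subgroup.zpowers a)
    rw [Nat.card_zpowers, ha, hA] at this
    have h3 : 2 * n * (Subgroup.zpowers a).index = 2 * n * 2 := by rw [this]; ring
    exact Nat.eq_of_mul_eq_mul_left (by omega) h3
  obtain ⟨g, hg⟩ : ∃ g, g ∉ Subgroup.zpowers a := by
    by_contra! h
    have h3 : Subgroup.zpowers a = ⊤ := by ext; simp [h]
    have h4 := Nat.card_zpowers a
    rw [h3, Subgroup.card_top, hA, ha] at h4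
    omega
  have hinv : ∀ g : A, g ∉ Subgroup.zpowers a → g * a * g⁻¹ = a⁻¹ := by
    intro g hg
    have h3 : g * a * g⁻¹ ∈ Subgroup.zpowers a := hnormal.conj_mem a (Subgroup.mem_zpowers a) g
    rw [hz, Subgroup.mem_centralizer_singleton_iff] at h3
    have h4 : Commute a.1 (g * a * g⁻¹).1 := congrArg Subtype.val h3.symm
    rcases eq_or_eq_inv_of_commute h2 h₁ h₂ hd (trace_conj a.1 g.1) h4 with h5 | h5
    · exfalso
      apply hg
      rw [hz, Subgroup.mem_centralizer_singleton_iff]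
      exact (mul_inv_eq_iff_eq_mul.mp (Subtype.ext h5))
    · exact Subtype.ext h5
  have hgg : g * g = ⟨-1, hneg⟩ := by
    apply Subtype.ext
    apply (mul_self_eq_neg_one_iff g.1).mpr
    apply trace_eq_zero_of_mul_eq_inv_mul h2 hd
    exact congrArg Subtype.val (mul_inv_eq_iff_eq_mul.mp (hinv g hg))
  have hπn : toCentralImage A ⟨-1, hneg⟩ = 1 := (toCentralImage_eq_one_iff h2 _).mpr (Or.inr rfl)
  have hs : toCentralImage A g * toCentralImage A g = 1 := by
    rw [← map_mul, hgg, hπn]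
  have ho : orderOf (toCentralImage A a) = n := by
    apply Nat.dvd_antisymm
    · apply orderOf_dvd_of_pow_eq_one
      rw [← map_pow, toCentralImage_eq_one_iff h2]
      apply eq_one_or_eq_neg_one_of_mul_self h2
      have : a ^ n * a ^ n = 1 := by rw [← pow_add, ← two_mul, ← ha, pow_orderOf_eq_one]
      exact congrArg Subtype.val this
    · have h3 := pow_orderOf_eq_one (toCentralImage A a)
      rw [← map_pow, toCentralImage_eq_one_iff h2] at h3
      have h4 : (a ^ orderOf (toCentralImage A a)) ^ 2 = 1 := by
        apply Subtype.ext
        change (a ^ orderOf (toCentralImage A a)).1 ^ 2 = 1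
        rcases h3 with h3 | h3 <;> rw [h3] <;> simp
      rw [← pow_mul] at h4
      have h5 := orderOf_dvd_of_pow_eq_one h4
      rw [ha, mul_comm _ 2] at h5
      exact Nat.dvd_of_mul_dvd_mul_left two_pos h5
  have hsr : toCentralImage A g * toCentralImage A a * toCentralImage A g =
      (toCentralImage A a)⁻¹ := by
    have h3 := congrArg (toCentralImage A) (hinv g hg)
    rw [map_mul, map_mul, map_inv, map_inv, inv_eq_of_mul_eq_one_left hs] at h3
    exact h3
  have hnot : toCentralImage A g ∉ Subgroup.zpowers (toCentralImage A a) := by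
    rintro ⟨k, hk⟩
    have hk : toCentralImage A a ^ k = toCentralImage A g := hk
    rw [← map_zpow] at hk
    have h3 : toCentralImage A ((a ^ k)⁻¹ * g) = 1 := by
      rw [map_mul, map_inv, hk, inv_mul_cancel]
    rw [toCentralImage_eq_one_iff h2] at h3
    apply hg
    have h4 : (a ^ k)⁻¹ * g ∈ Subgroup.zpowers a := by
      rw [hz, Subgroup.mem_centralizer_singleton_iff]
      apply Subtype.ext
      change ((a ^ k)⁻¹ * g).1 * a.1 = a.1 * ((a ^ k)⁻¹ * g).1
      rcases h3 with h3 | h3 <;> rw [h3] <;> simp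
    have := mul_mem (zpow_mem (Subgroup.mem_zpowers a) k) h4
    rwa [mul_inv_cancel_left] at this
  have hcard := card_eq_two_mul_card_centralImage h2 hneg
  have := nonempty_mulEquiv_dihedralGroup (by rw [ho]; omega) hs hsr hnot
  rwa [ho] at this

end Dihedral

section Line

open scoped LinearAlgebra.Projectivization

/-- The projective line over `F`. -/
abbrev Line (F : Type*) [Field F] := ℙ F (Fin 2 → F)

variable {F : Type*} [Field F]

theorem smul_line_eq_iff (g : SL₂ F) (x : Line F) :
    g • x = x ↔ ∃ c : F, g.1 *ᵥ x.rep = c • x.rep := by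
  conv_lhs => rw [← x.mk_rep, Projectivization.smul_mk, Projectivization.mk_eq_mk_iff']
  constructor
  · rintro ⟨c, hc⟩; exact ⟨c, hc.symm⟩
  · rintro ⟨c, hc⟩; exact ⟨c, hc.symm⟩

theorem sq_of_mulVec_eq_smul {g : SL₂ F} {v : Fin 2 → F} {c : F} (hv : v ≠ 0)
    (h : g.1 *ᵥ v = c • v) : c ^ 2 - g.1.trace * c + 1 = 0 := by
  have h1 : (g.1 * g.1) *ᵥ v = (c * c) • v := by
    rw [← Matrix.mulVec_mulVec, h, Matrix.mulVec_smul, h, smul_smul]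
  rw [coe_mul_self, Matrix.sub_mulVec, Matrix.smul_mulVec, h, Matrix.one_mulVec, smul_smul] at h1
  have h2 : (c ^ 2 - g.1.trace * c + 1) • v = 0 := by
    rw [add_smul, sub_smul, pow_two, ← h1]; module
  exact (smul_eq_zero.mp h2).resolve_right hv

theorem exists_mulVec_eq_smul {g : SL₂ F} {c : F} (h : c ^ 2 - g.1.trace * c + 1 = 0) :
    ∃ v : Fin 2 → F, v ≠ 0 ∧ g.1 *ᵥ v = c • v := by
  have hd := g.2
  rw [det_fin_two] at hd
  have : (g.1 - c • (1 : Matrix (Fin 2) (Fin 2) F)).det = 0 := by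
    rw [trace_fin_two] at h
    rw [det_fin_two]
    simp
    linear_combination h + hd
  obtain ⟨v, hv, h1⟩ := Matrix.exists_mulVec_eq_zero_iff.mpr this
  refine ⟨v, hv, ?_⟩
  rwa [Matrix.sub_mulVec, Matrix.smul_mulVec, Matrix.one_mulVec, sub_eq_zero] at h1

theorem exists_smul_eq_of_mulVec_eq_smul (h2 : (2 : F) ≠ 0) {g : SL₂ F} (h₁ : g ≠ 1) (h₂ : g ≠ -1)
    {v w : Fin 2 → F} (hw : w ≠ 0) {c : F} (hv' : g.1 *ᵥ v = c • v)
    (hw' : g.1 *ᵥ w = c • w) : ∃ k : F, k • w = v := by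
  have a0 := congrFun hv' 0
  have a1 := congrFun hv' 1
  have b0 := congrFun hw' 0
  have b1 := congrFun hw' 1
  simp only [Matrix.mulVec, dotProduct, Fin.sum_univ_two, Pi.smul_apply, smul_eq_mul] at a0 a1 b0 b1
  have hdet : v 0 * w 1 - v 1 * w 0 = 0 := by
    by_contra hne
    have e : (1 : F) • g.1 = c • (1 : Matrix (Fin 2) (Fin 2) F) := by
      rw [one_smul]
      have e00 : g.1 0 0 = c := mul_left_cancel₀ hne (by linear_combination w 1 * a0 - v 1 * b0)
      have e01 : g.1 0 1 = 0 := mul_left_cancel₀ hne (by linear_combination v 0 * b0 - w 0 * a0)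
      have e10 : g.1 1 0 = 0 := mul_left_cancel₀ hne (by linear_combination w 1 * a1 - v 1 * b1)
      have e11 : g.1 1 1 = c := mul_left_cancel₀ hne (by linear_combination v 0 * b1 - w 0 * a1)
      ext i j
      fin_cases i <;> fin_cases j <;> simp [e00, e01, e10, e11]
    rcases smul_coe_eq_smul_one h2 one_ne_zero e with h | h
    · exact h₁ h
    · exact h₂ h
  by_cases h0 : w 0 = 0
  · have h1 : w 1 ≠ 0 := by
      intro h1; apply hw; ext i; fin_cases i <;> simp [h0, h1]
    refine ⟨v 1 / w 1, ?_⟩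
    ext i; fin_cases i
    · simp [h0] at hdet ⊢
      exact (hdet.resolve_right h1).symm
    · simp [h1]
  · refine ⟨v 0 / w 0, ?_⟩
    ext i; fin_cases i
    · simp [h0]
    · simp; field_simp; linear_combination hdet

theorem card_fixed_line (h2 : (2 : F) ≠ 0) {g : SL₂ F} (h₁ : g ≠ 1) (h₂ : g ≠ -1) :
    Nat.card {x : Line F // g • x = x} =
      Nat.card {m : F // m ^ 2 = g.1.trace ^ 2 - 4} := by
  choose c hc using fun x : {x : Line F // g • x = x} => (smul_line_eq_iff g x.1).mp x.2
  have hm : ∀ x, (2 * c x - g.1.trace) ^ 2 = g.1.trace ^ 2 - 4 := by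
    intro x
    linear_combination 4 * sq_of_mulVec_eq_smul x.1.rep_nonzero (hc x)
  apply Nat.card_congr (Equiv.ofBijective (fun x => ⟨2 * c x - g.1.trace, hm x⟩) ⟨?_, ?_⟩)
  · intro x y hxy
    have h3 : 2 * c x - g.1.trace = 2 * c y - g.1.trace := congrArg Subtype.val hxy
    have h4 : c x = c y := mul_left_cancel₀ h2 (by linear_combination h3)
    obtain ⟨k, hk⟩ := exists_smul_eq_of_mulVec_eq_smul h2 h₁ h₂ y.1.rep_nonzero
      (h4 ▸ hc x) (hc y)
    apply Subtype.ext
    rw [← x.1.mk_rep, ← y.1.mk_rep, Projectivization.mk_eq_mk_iff']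
    exact ⟨k, hk⟩
  · rintro ⟨m, hm'⟩
    have h3 : ((m + g.1.trace) / 2) ^ 2 - g.1.trace * ((m + g.1.trace) / 2) + 1 = 0 := by
      field_simp; linear_combination hm'
    obtain ⟨v, hv, h4⟩ := exists_mulVec_eq_smul h3
    have hx : g • (Projectivization.mk F v hv) = Projectivization.mk F v hv := by
      rw [Projectivization.smul_mk, Projectivization.mk_eq_mk_iff']
      exact ⟨_, h4.symm⟩
    refine ⟨⟨_, hx⟩, Subtype.ext ?_⟩
    obtain ⟨k, hk⟩ := Projectivization.exists_smul_eq_mk_rep F v hv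
    have h5 := hc ⟨_, hx⟩
    change g.1 *ᵥ (Projectivization.mk F v hv).rep = _ • (Projectivization.mk F v hv).rep at h5
    rw [← hk, Units.smul_def, Matrix.mulVec_smul, h4, smul_smul, smul_smul] at h5
    have h6 := smul_left_injective F hv h5
    have h7 : (m + g.1.trace) / 2 = c ⟨_, hx⟩ :=
      mul_left_cancel₀ k.ne_zero (by linear_combination h6)
    change 2 * c ⟨_, hx⟩ - g.1.trace = m
    rw [← h7]; field_simp; ring

/-- The eigenvalue of an element of the stabilizer of a line on that line. -/
noncomputable def lineChar (x : Line F) : stabilizer (SL₂ F) x →* F :=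
  have hi := Function.ne_iff.mp x.rep_nonzero
  have key : ∀ g : stabilizer (SL₂ F) x, ∀ c : F, g.1.1 *ᵥ x.rep = c • x.rep →
      (g.1.1 *ᵥ x.rep) hi.choose / x.rep hi.choose = c := by
    intro g c hc
    rw [hc, Pi.smul_apply, smul_eq_mul, mul_div_cancel_right₀ _ hi.choose_spec]
  { toFun := fun g => (g.1.1 *ᵥ x.rep) hi.choose / x.rep hi.choose
    map_one' := key 1 1 (by simp)
    map_mul' := by
      intro g k
      obtain ⟨c, hc⟩ := (smul_line_eq_iff g.1 x).mp g.2
      obtain ⟨d, hd⟩ := (smul_line_eq_iff k.1 x).mp k.2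
      rw [key g c hc, key k d hd]
      apply key
      change (g.1 * k.1).1 *ᵥ x.rep = _
      rw [Matrix.SpecialLinearGroup.coe_mul, ← Matrix.mulVec_mulVec, hd, Matrix.mulVec_smul, hc,
        smul_smul, mul_comm] }

theorem mulVec_rep (x : Line F) (g : stabilizer (SL₂ F) x) :
    g.1.1 *ᵥ x.rep = lineChar x g • x.rep := by
  obtain ⟨c, hc⟩ := (smul_line_eq_iff g.1 x).mp g.2
  have hi := Function.ne_iff.mp x.rep_nonzero
  have : lineChar x g = c := by
    change (g.1.1 *ᵥ x.rep) hi.choose / x.rep hi.choose = c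
    rw [hc, Pi.smul_apply, smul_eq_mul, mul_div_cancel_right₀ _ hi.choose_spec]
  rw [this, hc]

theorem lineChar_sq (x : Line F) (g : stabilizer (SL₂ F) x) :
    lineChar x g ^ 2 - g.1.1.trace * lineChar x g + 1 = 0 :=
  sq_of_mulVec_eq_smul x.rep_nonzero (mulVec_rep x g)

theorem lineChar_eq_one_iff (x : Line F) (g : stabilizer (SL₂ F) x) :
    lineChar x g = 1 ↔ g.1.1.trace = 2 := by
  have := lineChar_sq x g
  constructor
  · intro h; rw [h] at this; linear_combination -this
  · intro h; rw [h] at this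
    have h1 : (lineChar x g - 1) ^ 2 = 0 := by linear_combination this
    linear_combination pow_eq_zero_iff (two_ne_zero) |>.mp h1

/-- The transvection with centre spanned by `v` and parameter `c`. -/
def transvectionMatrix (v : Fin 2 → F) (c : F) : Matrix (Fin 2) (Fin 2) F :=
  !![1 - c * (v 0 * v 1), c * v 0 ^ 2; -(c * v 1 ^ 2), 1 + c * (v 0 * v 1)]

/-- The transvections with a given centre. -/
def transvectionHom (v : Fin 2 → F) : Multiplicative F →* SL₂ F where
  toFun c := ⟨transvectionMatrix v c.toAdd, by rw [transvectionMatrix, det_fin_two_of]; ring⟩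
  map_one' := by
    apply Subtype.ext
    change transvectionMatrix v 0 = 1
    ext i j; fin_cases i <;> fin_cases j <;> simp [transvectionMatrix]
  map_mul' c d := by
    apply Subtype.ext
    change transvectionMatrix v (c.toAdd + d.toAdd) =
      transvectionMatrix v c.toAdd * transvectionMatrix v d.toAdd
    ext i j
    fin_cases i <;> fin_cases j <;> simp [transvectionMatrix, Matrix.mul_apply] <;> ring

theorem mem_range_transvectionHom {v : Fin 2 → F} (hv : v ≠ 0) {g : SL₂ F}
    (h : g.1 *ᵥ v = v) : g ∈ (transvectionHom v).range := by
  suffices ∃ c : F, transvectionMatrix v c = g.1 by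
    obtain ⟨c, hc⟩ := this
    exact ⟨Multiplicative.ofAdd c, Subtype.ext hc⟩
  have ht := sq_of_mulVec_eq_smul hv (c := 1) (by rw [h, one_smul])
  rw [trace_fin_two] at ht
  have a0 := congrFun h 0
  have a1 := congrFun h 1
  simp only [Matrix.mulVec, dotProduct, Fin.sum_univ_two] at a0 a1
  by_cases h0 : v 0 = 0
  · have h1 : v 1 ≠ 0 := by
      intro h1; apply hv; ext i; fin_cases i <;> simp [h0, h1]
    refine ⟨-g.1 1 0 / v 1 ^ 2, ?_⟩
    simp [h0, h1] at a0 a1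
    ext i j
    fin_cases i <;> fin_cases j <;> simp [transvectionMatrix, h0, h1, a0, a1]
    linear_combination ht + a1
  · refine ⟨g.1 0 1 / v 0 ^ 2, ?_⟩
    ext i j
    fin_cases i <;> fin_cases j <;> simp [transvectionMatrix] <;> field_simp
    · linear_combination -a0
    · linear_combination (-v 1) * a0 - v 0 * a1 - v 0 * v 1 * ht
    · linear_combination ht * v 0 + a0

end Line

section LineCharacters

variable {F : Type*} [Field F] {A : Subgroup (SL₂ F)}

variable (A) in
/-- The eigenvalue character of the stabilizer in `A` of a line. -/
noncomputable def lineCharOn (x : Line F) : stabilizer A x →* Fˣ :=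
  ((lineChar x).comp
    ({ toFun := fun g => ⟨g.1.1, g.2⟩, map_one' := rfl, map_mul' := fun _ _ => rfl } :
      stabilizer A x →* stabilizer (SL₂ F) x)).toHomUnits

theorem coe_lineCharOn (x : Line F) (g : stabilizer A x) :
    (lineCharOn A x g : F) = lineChar x ⟨g.1.1, g.2⟩ := rfl

theorem lineCharOn_sq (x : Line F) (g : stabilizer A x) :
    (lineCharOn A x g : F) ^ 2 - g.1.1.1.trace * lineCharOn A x g + 1 = 0 :=
  lineChar_sq x ⟨g.1.1, g.2⟩

theorem lineCharOn_eq_one_iff (x : Line F) (g : stabilizer A x) :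
    lineCharOn A x g = 1 ↔ g.1.1.1.trace = 2 := by
  rw [← lineChar_eq_one_iff x ⟨g.1.1, g.2⟩, ← coe_lineCharOn, Units.val_eq_one]

theorem card_ker_dvd [Finite F] (x : Line F) :
    Nat.card (lineCharOn A x).ker ∣ Nat.card F := by
  let φ : (lineCharOn A x).ker →* (transvectionHom x.rep).range :=
    { toFun := fun g => ⟨g.1.1.1, mem_range_transvectionHom x.rep_nonzero (by
        have h1 : lineChar x ⟨g.1.1.1, g.1.2⟩ = 1 := by
          rw [← coe_lineCharOn, MonoidHom.mem_ker.mp g.2, Units.val_one]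
        have := mulVec_rep x ⟨g.1.1.1, g.1.2⟩
        rwa [h1, one_smul] at this)⟩
      map_one' := rfl
      map_mul' := fun _ _ => rfl }
  have hφ : Function.Injective φ := by
    intro g k h
    apply Subtype.ext; apply Subtype.ext; apply Subtype.ext
    exact congrArg (fun x => x.1) h
  have h1 := Subgroup.card_dvd_of_injective φ hφ
  have h3 := Subgroup.card_range_dvd (transvectionHom x.rep)
  exact h1.trans h3

theorem card_range_dvd' [Finite F] (x : Line F) :
    Nat.card (lineCharOn A x).range ∣ Nat.card F - 1 := by
  rw [← Nat.card_units]
  exact Subgroup.card_subgroup_dvd_card _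

theorem card_stabilizer_line (x : Line F) :
    Nat.card (stabilizer A x) = Nat.card (lineCharOn A x).ker * Nat.card (lineCharOn A x).range := by
  rw [Subgroup.card_eq_card_quotient_mul_card_subgroup (lineCharOn A x).ker, mul_comm,
    Nat.card_congr (QuotientGroup.quotientKerEquivRange (lineCharOn A x)).toEquiv]

theorem card_line [Finite F] : Nat.card (Line F) = Nat.card F + 1 :=
  Projectivization.card_of_finrank_two F (Fin 2 → F) (by simp)

instance [Finite F] : Finite (Line F) := by
  apply Nat.finite_of_card_ne_zero
  rw [card_line]; omega

theorem card_orbit_mul_card_stabilizer [Finite F] (x : Line F) :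
    Nat.card (orbit A x) * Nat.card (stabilizer A x) = Nat.card A := by
  rw [Nat.card_congr (orbitEquivQuotientStabilizer A x),
    ← Subgroup.card_eq_card_quotient_mul_card_subgroup]

theorem neg_one_smul_line (x : Line F) : (-1 : SL₂ F) • x = x := by
  rw [smul_line_eq_iff]
  exact ⟨-1, by rw [coe_neg_one, Matrix.neg_mulVec, Matrix.one_mulVec, neg_one_smul]⟩

theorem two_dvd_card_range [Finite F] (h2 : (2 : F) ≠ 0) (hneg : -1 ∈ A) (x : Line F) :
    2 ∣ Nat.card (lineCharOn A x).range := by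
  let z : stabilizer A x := ⟨⟨-1, hneg⟩, neg_one_smul_line x⟩
  have hz : orderOf (⟨lineCharOn A x z, z, rfl⟩ : (lineCharOn A x).range) = 2 := by
    apply orderOf_eq_prime
    · apply Subtype.ext
      change lineCharOn A x z ^ 2 = 1
      rw [← map_pow]
      have : z ^ 2 = 1 := by
        apply Subtype.ext; apply Subtype.ext
        change (-1 : SL₂ F) ^ 2 = 1
        simp
      rw [this, map_one]
    · intro h
      have h : lineCharOn A x z = 1 := congrArg Subtype.val h
      rw [lineCharOn_eq_one_iff] at h
      have h3 : (-1 : SL₂ F).1.trace = 2 := h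
      rw [trace_neg, trace_one] at h3
      have h4 : (2 : F) * 2 = 0 := by linear_combination -h3
      simp [h2] at h4
  have := orderOf_dvd_natCard (⟨lineCharOn A x z, z, rfl⟩ : (lineCharOn A x).range)
  rwa [hz] at this

theorem coprime_card_ker [Finite F] (x : Line F) {m : ℕ} (h : (Nat.card F).Coprime m) :
    (Nat.card (lineCharOn A x).ker).Coprime m :=
  Nat.Coprime.coprime_dvd_left (card_ker_dvd x) h

theorem half_dvd_card_orbit [Finite F] (hdvd : 2 * (Nat.card F + 1) ∣ Nat.card A)
    (x : Line F) {k : ℕ} (hk : Nat.card F = 2 * k + 1) : k + 1 ∣ Nat.card (orbit A x) := by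
  have h1 := card_orbit_mul_card_stabilizer (A := A) x
  rw [card_stabilizer_line] at h1
  have hc : (2 * (Nat.card F + 1)).Coprime (Nat.card (lineCharOn A x).ker) := by
    apply Nat.Coprime.symm
    apply coprime_card_ker
    rw [Nat.coprime_mul_iff_right]
    refine ⟨?_, by simp⟩
    rw [hk, Nat.coprime_comm, Nat.prime_two.coprime_iff_not_dvd]
    omega
  have h3 : 2 * (Nat.card F + 1) ∣
      Nat.card (lineCharOn A x).ker * (Nat.card (orbit A x) * Nat.card (lineCharOn A x).range) := by
    rw [← h1] at hdvd
    convert hdvd using 1; ring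
  have h4 := hc.dvd_of_dvd_mul_left h3
  have h5 : 2 * (Nat.card F + 1) ∣ Nat.card (orbit A x) * (Nat.card F - 1) :=
    h4.trans (Nat.mul_dvd_mul_left _ (card_range_dvd' x))
  have h6 : (4 * (k + 1)) ∣ 2 * (Nat.card (orbit A x) * k) := by
    convert h5 using 1
    · rw [hk]; ring
    · rw [hk, Nat.add_sub_cancel]; ring
  have h7 : (k + 1) ∣ Nat.card (orbit A x) * k := by
    have : 2 * (k + 1) ∣ Nat.card (orbit A x) * k :=
      Nat.dvd_of_mul_dvd_mul_left two_pos (by convert h6 using 1; ring)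
    exact (Nat.dvd_mul_left _ _).trans this
  exact Nat.Coprime.dvd_of_dvd_mul_right (by simp) h7

theorem card_fixed_line_eq_one (h2 : (2 : F) ≠ 0) {g : SL₂ F} (h₁ : g ≠ 1) (h₂ : g ≠ -1)
    (hd : g.1.trace ^ 2 - 4 = 0) : Nat.card {x : Line F // g • x = x} = 1 := by
  rw [card_fixed_line h2 h₁ h₂, hd, Nat.card_eq_one_iff_unique]
  exact ⟨⟨fun a b => Subtype.ext (by
    rw [pow_eq_zero_iff two_ne_zero |>.mp a.2, pow_eq_zero_iff two_ne_zero |>.mp b.2])⟩,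
    ⟨⟨0, by simp⟩⟩⟩

theorem pow_char_eq_one {p : ℕ} [Fact p.Prime] [CharP F p] {g : SL₂ F} (h : g.1.trace = 2) :
    g ^ p = 1 := by
  have h1 : (g.1 - 1 : Matrix (Fin 2) (Fin 2) F) ^ 2 = 0 := by
    rw [pow_two, Matrix.sub_mul, Matrix.mul_sub, coe_mul_self, h]
    simp only [Matrix.mul_one, Matrix.one_mul]
    module
  have h3 : (g.1 - 1 : Matrix (Fin 2) (Fin 2) F) ^ p = 0 :=
    pow_eq_zero_of_le (Fact.out : p.Prime).two_le h1
  rw [sub_pow_char_of_commute _ (Commute.one_right _), ← Matrix.SpecialLinearGroup.coe_pow,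
    one_pow, sub_eq_zero] at h3
  exact Subtype.ext h3

theorem trace_two_ne_neg_one (h2 : (2 : F) ≠ 0) {g : SL₂ F} (h : g.1.trace = 2) : g ≠ -1 := by
  rintro rfl
  rw [trace_neg, trace_one] at h
  have h4 : (2 : F) * 2 = 0 := by linear_combination -h
  simp [h2] at h4

theorem mem_orbit_line [Finite F] (h2 : (2 : F) ≠ 0) (hdvd : 2 * (Nat.card F + 1) ∣ Nat.card A)
    {u : SL₂ F} (hu : u ∈ A) (hu1 : u ≠ 1) (hut : u.1.trace = 2) {x : Line F} (hx : u • x = x)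
    (y : Line F) : x ∈ orbit A y := by
  have := Fintype.ofFinite F
  obtain ⟨p, hp⟩ := CharP.exists F
  obtain ⟨n, hpp, hn⟩ := FiniteField.card F p
  have : Fact p.Prime := ⟨hpp⟩
  have hpq : p ∣ Nat.card F := by
    rw [Nat.card_eq_fintype_card, hn]; exact dvd_pow_self p n.ne_zero
  have hodd := odd_natCard h2
  obtain ⟨k, hk⟩ : ∃ k, Nat.card F = 2 * k + 1 := ⟨Nat.card F / 2, by omega⟩
  have hnot : ¬ p ∣ Nat.card (orbit A y) := by
    intro hd
    obtain ⟨j, hj⟩ := half_dvd_card_orbit hdvd y hk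
    have : Nonempty (orbit A y) := ⟨⟨y, mem_orbit_self y⟩⟩
    have hpos : 0 < Nat.card (orbit A y) := Nat.card_pos
    have hle : Nat.card (orbit A y) ≤ 2 * (k + 1) := by
      have : Nat.card (orbit A y) ≤ Nat.card (Line F) := Nat.card_le_card_of_injective
        (Subtype.val) Subtype.val_injective
      rw [card_line] at this; omega
    have hj2 : j ≤ 2 := by
      rw [hj, mul_comm] at hle; exact Nat.le_of_mul_le_mul_right hle (by omega)
    have : Nat.card (orbit A y) ∣ Nat.card F + 1 := by
      rw [hj, hk]
      have h3 : j ∣ 2 := by interval_cases j <;> simp_all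
      obtain ⟨i, hi⟩ := h3
      exact ⟨i, by rw [mul_assoc, ← hi]; ring⟩
    have h5 := (Nat.dvd_add_right hpq).mp (hd.trans this)
    exact hpp.one_lt.ne' (Nat.dvd_one.mp h5)
  let u' : A := ⟨u, hu⟩
  have hP : IsPGroup p (Subgroup.zpowers u') := by
    rw [IsPGroup.iff_card]
    have h3 : orderOf u' = p := orderOf_eq_prime (Subtype.ext (pow_char_eq_one hut))
      (fun h => hu1 (congrArg Subtype.val h))
    exact ⟨1, by rw [Nat.card_zpowers, h3, pow_one]⟩
  obtain ⟨z, hz⟩ := hP.nonempty_fixed_point_of_prime_not_dvd_card (orbit A y) hnot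
  have hz' : u • z.1 = z.1 := congrArg Subtype.val (hz ⟨u', Subgroup.mem_zpowers u'⟩)
  have h1 := card_fixed_line_eq_one h2 hu1 (trace_two_ne_neg_one h2 hut) (by rw [hut]; ring)
  have hsub := (Nat.card_eq_one_iff_unique.mp h1).1
  have : (⟨x, hx⟩ : {x : Line F // u • x = x}) = ⟨z.1, hz'⟩ := hsub.elim _ _
  have h4 : x = z.1 := congrArg Subtype.val this
  rw [h4]; exact z.2

end LineCharacters

section ModularCount

variable {F : Type*} [Field F] {A : Subgroup (SL₂ F)}

theorem sum_card_ker [Finite F] [Fintype A] [Fintype (Line F)] (h2 : (2 : F) ≠ 0) :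
    ∑ x : Line F, Nat.card (lineCharOn A x).ker =
      Nat.card {g : A // g.1.1.trace = 2} + Nat.card F := by
  classical
  have h1 : ∑ x : Line F, Nat.card (lineCharOn A x).ker =
      ∑ g : {g : A // g.1.1.trace = 2}, Nat.card {x : Line F // g.1 • x = x} := by
    simp only [← Nat.card_sigma]
    apply Nat.card_congr
    exact
      { toFun := fun p => ⟨⟨p.2.1.1, (lineCharOn_eq_one_iff p.1 p.2.1).mp p.2.2⟩, p.1, p.2.1.2⟩
        invFun := fun p => ⟨p.2.1, ⟨p.1.1, p.2.2⟩, (lineCharOn_eq_one_iff p.2.1 ⟨p.1.1, p.2.2⟩).mpr p.1.2⟩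
        left_inv := fun _ => rfl
        right_inv := fun _ => rfl }
  rw [h1]
  have h3 : ∀ g : {g : A // g.1.1.trace = 2}, Nat.card {x : Line F // g.1 • x = x} =
      1 + if g = ⟨1, trace_one⟩ then Nat.card F else 0 := by
    rintro ⟨g, hg⟩
    split_ifs with h
    · have h : g = 1 := congrArg Subtype.val h
      subst h
      rw [card_fixed_of_forall fun _ => one_smul _ _, card_line, add_comm]
    · have hg1 : g.1 ≠ 1 := fun h' => h (Subtype.ext (Subtype.ext h'))
      exact card_fixed_line_eq_one h2 hg1 (trace_two_ne_neg_one h2 hg) (by rw [hg]; ring)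
  simp only [h3]
  rw [Finset.sum_add_distrib, Finset.sum_ite_eq' Finset.univ, Finset.sum_const, Finset.card_univ,
    ← Nat.card_eq_fintype_card]
  simp

theorem card_disc_eq_zero [Finite F] (h2 : (2 : F) ≠ 0) (hneg : -1 ∈ A) :
    Nat.card {g : A // g.1.1.trace ^ 2 - 4 = 0} = 2 * Nat.card {g : A // g.1.1.trace = 2} := by
  have h1 : {g : A | g.1.1.trace ^ 2 - 4 = 0} = {g : A | g.1.1.trace = 2} ∪ {g : A | g.1.1.trace = -2} := by
    ext g
    simp only [Set.mem_ofPred_eq, Set.mem_union]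
    constructor
    · intro h
      have h3 : (g.1.1.trace - 2) * (g.1.1.trace + 2) = 0 := by linear_combination h
      rcases mul_eq_zero.mp h3 with h | h
      · left; linear_combination h
      · right; linear_combination h
    · rintro (h | h) <;> rw [h] <;> ring
  have hdisj : Disjoint {g : A | g.1.1.trace = 2} {g : A | g.1.1.trace = -2} := by
    rw [Set.disjoint_left]
    intro g h h'
    have h : g.1.1.trace = 2 := h
    have h' : g.1.1.trace = -2 := h'
    rw [h] at h'
    have h4 : (2 : F) * 2 = 0 := by linear_combination h'
    simp [h2] at h4
  have h3 : Nat.card {g : A // g.1.1.trace = 2} = Nat.card {g : A // g.1.1.trace = -2} := by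
    apply Nat.card_congr
    refine Equiv.subtypeEquiv (Equiv.mulLeft ⟨-1, hneg⟩) fun g => ?_
    change _ ↔ (-1 * g.1 : SL₂ F).1.trace = -2
    rw [neg_one_mul, trace_neg, neg_inj]
  change Nat.card ({g : A | g.1.1.trace ^ 2 - 4 = 0} : Set A) = _
  rw [h1, Nat.card_coe_set_eq, Set.ncard_union_eq hdisj]
  have h4 : ({g : A | g.1.1.trace = 2} : Set A).ncard = Nat.card {g : A // g.1.1.trace = 2} := rfl
  have h5 : ({g : A | g.1.1.trace = -2} : Set A).ncard = Nat.card {g : A // g.1.1.trace = -2} := rfl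
  omega

theorem card_fixed_line_square (h2 : (2 : F) ≠ 0) {g : SL₂ F} (h₁ : g ≠ 1) (h₂ : g ≠ -1)
    (hd : g.1.trace ^ 2 - 4 ≠ 0) (hs : IsSquare (g.1.trace ^ 2 - 4)) :
    Nat.card {x : Line F // g • x = x} = 2 := by
  rw [card_fixed_line h2 h₁ h₂]
  obtain ⟨s, hs0, hs⟩ := exists_mul_sq_eq_iff one_ne_zero hd (by rwa [one_mul])
  apply card_eq_two_of_iff h2 hs0
  intro x
  rw [← hs, mul_one]

theorem card_fixed_line_nonsquare (h2 : (2 : F) ≠ 0) {g : SL₂ F} (h₁ : g ≠ 1) (h₂ : g ≠ -1)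
    (hs : ¬ IsSquare (g.1.trace ^ 2 - 4)) :
    Nat.card {x : Line F // g • x = x} = 0 := by
  rw [card_fixed_line h2 h₁ h₂, Nat.card_eq_zero]
  left
  constructor
  rintro ⟨m, hm⟩
  exact hs ⟨m, by rw [← hm, pow_two]⟩

theorem sum_fixed_line_add_pole [Finite F] [Fintype A] (h2 : (2 : F) ≠ 0) (hneg : -1 ∈ A) {ν : F}
    (hν : ¬ IsSquare ν) :
    ∑ g : A, Nat.card {x : Line F // g • x = x} +
      ∑ g : A, Nat.card {x : Pole F {ν} // g • x = x} +
      Nat.card {g : A // g.1.1.trace ^ 2 - 4 = 0} =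
      2 * Nat.card A + 2 * (Nat.card F + Nat.card (Pole F {ν})) := by
  classical
  have h1 : Nat.card {g : A // g.1.1.trace ^ 2 - 4 = 0} =
      ∑ g : A, if g.1.1.trace ^ 2 - 4 = 0 then 1 else 0 := by
    rw [Finset.sum_boole, Nat.card_eq_fintype_card, Fintype.card_subtype, Nat.cast_id]
  have h3 : Nat.card A = ∑ g : A, 1 := by simp
  rw [h1, ← Finset.sum_add_distrib, ← Finset.sum_add_distrib,
    sum_fixed_eq h2 hneg (c := 2) (k := Nat.card F + Nat.card (Pole F {ν}) + 2)]
  · have : 2 ≤ Nat.card A := by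
      have h4 : Nontrivial A := ⟨⟨1, ⟨-1, hneg⟩, fun h => one_ne_neg_one h2 (congrArg Subtype.val h)⟩⟩
      exact Finite.one_lt_card
    omega
  · rw [card_fixed_of_forall fun _ => one_smul _ _, card_fixed_of_forall fun _ => one_smul _ _,
      card_line, if_pos]
    · ring
    · rw [show (1 : A).1 = 1 from rfl, trace_one]; ring
  · have e1 : Nat.card {x : Line F // (⟨-1, hneg⟩ : A) • x = x} = Nat.card (Line F) :=
      card_fixed_of_forall fun x => neg_one_smul_line x
    have e3 : Nat.card {x : Pole F {ν} // (⟨-1, hneg⟩ : A) • x = x} = Nat.card (Pole F {ν}) :=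
      card_fixed_of_forall fun x => neg_one_smul_pole x
    rw [e1, e3, card_line, if_pos]
    · ring
    · change (-1 : SL₂ F).1.trace ^ 2 - 4 = 0
      rw [trace_neg, trace_one]; ring
  · intro g hg₁ hg₂
    have e1 : Nat.card {x : Line F // g • x = x} = Nat.card {x : Line F // g.1 • x = x} := rfl
    have e3 : Nat.card {x : Pole F {ν} // g • x = x} = Nat.card {x : Pole F {ν} // g.1 • x = x} := rfl
    rw [e1, e3]
    by_cases hd : g.1.1.trace ^ 2 - 4 = 0
    · rw [if_pos hd, card_fixed_line_eq_one h2 hg₁ hg₂ hd,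
        card_fixed_square h2 hν hg₁ hg₂ (by rw [hd]; exact IsSquare.zero)]
    · rw [if_neg hd]
      by_cases hs : IsSquare (g.1.1.trace ^ 2 - 4)
      · rw [card_fixed_line_square h2 hg₁ hg₂ hd hs, card_fixed_square h2 hν hg₁ hg₂ hs]
      · rw [card_fixed_line_nonsquare h2 hg₁ hg₂ hs, card_fixed_nonsquare h2 hν hg₁ hg₂ hs]

theorem modular_arithmetic {q s f c n : ℕ} (hq : q = s * f) (hodd : q % 2 = 1) (hs : 2 ≤ s)
    (h : (q + 1) * s * c + n * (2 * q) = n * ((q + 1) * s)) (hn : 2 * n ∣ q + 1)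
    (hc : 2 * c ∣ q - 1) (hc0 : 1 ≤ c) :
    (f = 1 ∧ 2 * c = q - 1) ∨ (q = 9 ∧ s = 3 ∧ c = 2 ∧ n = 5) := by
  obtain ⟨j, hj⟩ := hn
  have hn0 : 0 < n := by
    by_contra h0
    have : n = 0 := by omega
    subst this; omega
  have hf0 : 0 < f := by
    by_contra h0
    have : f = 0 := by omega
    subst this; omega
  have h1 : (q + 1) * c + 2 * n * f = n * (q + 1) := by
    apply Nat.eq_of_mul_eq_mul_left (show 0 < s by omega)
    have : n * (2 * q) = s * (2 * n * f) := by rw [hq]; ring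
    rw [this] at h
    linarith [h]
  have h3 : j * c + f = n * j := by
    rw [hj] at h1
    apply Nat.eq_of_mul_eq_mul_left (show 0 < 2 * n by omega)
    linarith [h1]
  have hjf : j ∣ f := (Nat.dvd_add_right (Dvd.intro c rfl)).mp (h3 ▸ Dvd.intro_left n rfl)
  have hj1 : j = 1 := by
    have h4 : j ∣ q := hq ▸ hjf.mul_left s
    have h5 : j ∣ q + 1 := hj ▸ Dvd.intro_left _ rfl
    exact Nat.dvd_one.mp ((Nat.dvd_add_right h4).mp h5)
  subst hj1
  have h4 : c ∣ n - 1 := by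
    have : q - 1 = 2 * (n - 1) := by omega
    rw [this] at hc
    exact Nat.dvd_of_mul_dvd_mul_left two_pos hc
  by_cases hf1 : f = 1
  · left; exact ⟨hf1, by omega⟩
  right
  have h5 : c ∣ f - 1 := by
    have : n - 1 = c + (f - 1) := by omega
    rw [this] at h4
    exact (Nat.dvd_add_right dvd_rfl).mp h4
  have h6 := Nat.le_of_dvd (by omega) h5
  have hs4 : s < 4 := by
    by_contra h7
    have : 4 * f ≤ s * f := Nat.mul_le_mul_right f (by omega)
    omega
  have hs3 : s = 3 := by
    have : s ≠ 2 := by rintro rfl; omega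
    omega
  subst hs3
  have h8 : f + 1 = 2 * c := by omega
  have h9 : c ∣ 2 := by
    have : 2 * c = 2 + (f - 1) := by omega
    have h10 : c ∣ 2 + (f - 1) := this ▸ Dvd.intro_left 2 rfl
    exact (Nat.dvd_add_left h5).mp h10
  have := Nat.le_of_dvd two_pos h9
  interval_cases c <;> omega

theorem card_top_le [Finite F] :
    Nat.card (SL₂ F) ≤ (Nat.card F + 1) * (Nat.card F * (Nat.card F - 1)) := by
  have hq : 1 < Nat.card F := Finite.one_lt_card
  obtain ⟨x⟩ : Nonempty (Line F) := by
    apply (Nat.card_pos_iff.mp _).1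
    rw [card_line]; omega
  have h1 := card_orbit_mul_card_stabilizer (A := (⊤ : Subgroup (SL₂ F))) x
  rw [Subgroup.card_top] at h1
  rw [← h1, card_stabilizer_line]
  apply Nat.mul_le_mul
  · rw [← card_line]
    exact Nat.card_le_card_of_injective (Subtype.val) Subtype.val_injective
  · apply Nat.mul_le_mul
    · exact Nat.le_of_dvd (by omega) (card_ker_dvd x)
    · exact Nat.le_of_dvd (by omega) (card_range_dvd' x)

end ModularCount

section Modular

variable {F : Type*} [Field F] {A : Subgroup (SL₂ F)}

theorem coprime_range_of_dvd_card [Finite F] (x : Line F) {s : ℕ} (hs : s ∣ Nat.card F) :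
    s.Coprime (Nat.card (lineCharOn A x).range) := by
  have hq : 1 < Nat.card F := Finite.one_lt_card
  have h1 : (Nat.card F).Coprime (Nat.card F - 1) := by
    rw [Nat.coprime_self_sub_right (by omega)]
    exact Nat.coprime_one_right _
  exact (h1.coprime_dvd_left hs).coprime_dvd_right (card_range_dvd' x)

theorem modular_core [Finite F] (h2 : (2 : F) ≠ 0) (hneg : -1 ∈ A)
    (hdvd : 2 * (Nat.card F + 1) ∣ Nat.card A)
    {u : SL₂ F} (hu : u ∈ A) (hu1 : u ≠ 1) (hut : u.1.trace = 2) {ν : F} (hν : ¬ IsSquare ν) :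
    A = ⊤ ∨ (Nat.card F = 9 ∧ Nat.card A = 120 ∧
      (∀ x : Line F, Nat.card (lineCharOn A x).range = 4) ∧
      (∀ h : Pole F {ν}, Nat.card (stabilizer A h) = 2 ∨ Nat.card (stabilizer A h) = 10) ∧
      ∃ h : Pole F {ν}, Nat.card (stabilizer A h) = 10) := by
  have hE : (0 : F) ∉ ({ν} : Set F) := by
    intro h
    exact hν (by rw [← Set.mem_singleton_iff.mp h]; exact IsSquare.zero)
  have := Fintype.ofFinite (Pole F {ν})
  have := Fintype.ofFinite (Line F)
  have := Fintype.ofFinite A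
  have hodd := odd_natCard h2
  have hq1 : 1 < Nat.card F := Finite.one_lt_card
  obtain ⟨⟨x₀, hx₀⟩⟩ : Nonempty {x : Line F // u • x = x} := by
    apply (Nat.card_pos_iff.mp _).1
    rw [card_fixed_line_eq_one h2 hu1 (trace_two_ne_neg_one h2 hut) (by rw [hut]; ring)]
    exact one_pos
  have horb : ∀ y : Line F, Nat.card (orbit A y) = Nat.card F + 1 := by
    intro y
    have h1 : orbit A y = Set.univ := by
      rw [Set.eq_univ_iff_forall]
      intro z
      have hy := orbit_eq_iff.mpr (mem_orbit_line h2 hdvd hu hu1 hut hx₀ y)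
      have hz := orbit_eq_iff.mpr (mem_orbit_line h2 hdvd hu hu1 hut hx₀ z)
      rw [← hy, hz]
      exact mem_orbit_self z
    rw [h1, Nat.card_univ, card_line]
  have hcardA : ∀ y : Line F, (Nat.card F + 1) *
      (Nat.card (lineCharOn A y).ker * Nat.card (lineCharOn A y).range) = Nat.card A := by
    intro y
    rw [← card_stabilizer_line, ← horb y, card_orbit_mul_card_stabilizer]
  obtain ⟨s, hs⟩ : ∃ s, s = Nat.card (lineCharOn A x₀).ker := ⟨_, rfl⟩
  have hker : ∀ y : Line F, Nat.card (lineCharOn A y).ker = s := by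
    intro y
    have h1 := Nat.eq_of_mul_eq_mul_left (Nat.succ_pos _) ((hcardA y).trans (hcardA x₀).symm)
    rw [hs]
    apply Nat.dvd_antisymm
    · exact (coprime_range_of_dvd_card x₀ (card_ker_dvd y)).dvd_of_dvd_mul_right
        (h1 ▸ Dvd.intro _ rfl)
    · exact (coprime_range_of_dvd_card y (card_ker_dvd x₀)).dvd_of_dvd_mul_right
        (h1.symm ▸ Dvd.intro _ rfl)
  have hs2 : 2 ≤ s := by
    rw [hs]
    have : Nontrivial (lineCharOn A x₀).ker := by
      refine ⟨1, ⟨⟨⟨u, hu⟩, hx₀⟩, (lineCharOn_eq_one_iff _ _).mpr hut⟩, fun h => hu1 ?_⟩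
      exact (congrArg (fun k => k.1.1.1) h).symm
    exact Finite.one_lt_card
  obtain ⟨c, hc⟩ := two_dvd_card_range h2 hneg x₀
  have hrange : ∀ y : Line F, Nat.card (lineCharOn A y).range = 2 * c := by
    intro y
    have h1 := Nat.eq_of_mul_eq_mul_left (Nat.succ_pos _) ((hcardA y).trans (hcardA x₀).symm)
    rw [hker, hker, hc] at h1
    exact Nat.eq_of_mul_eq_mul_left (by omega) h1
  have hc0 : 1 ≤ c := by
    have : 0 < Nat.card (lineCharOn A x₀).range := Nat.card_pos
    omega
  obtain ⟨M, hM⟩ : ∃ M, M = (Nat.card F + 1) * s := ⟨_, rfl⟩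
  have hM2 : 2 * Nat.card F + 2 ≤ M := by
    rw [hM]; nlinarith
  obtain ⟨N, hN⟩ : ∃ N, N = M * c := ⟨_, rfl⟩
  have hNM : M ≤ N := by rw [hN]; exact Nat.le_mul_of_pos_right _ hc0
  have hAN : Nat.card A = 2 * N := by
    rw [← hcardA x₀, hker, hrange, hN, hM]; ring
  choose n hn using fun h : Pole F {ν} => two_dvd_card_stabilizer (A := A) h2 hneg h
  have hnpos : ∀ h, 1 ≤ n h := by
    intro h
    have : 0 < Nat.card (stabilizer A h) := Nat.card_pos
    have := hn h
    omega
  have hsum : ∑ h, (n h - 1) + M = N + 2 * Nat.card F := by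
    have e1 := sum_fixed_line_add_pole (A := A) h2 hneg hν
    rw [← sum_card_stabilizer, ← sum_card_stabilizer, card_disc_eq_zero h2 hneg] at e1
    have e3 := sum_card_ker (A := A) h2
    simp only [card_stabilizer_line, hker, hrange, hn] at e1 e3
    rw [Finset.sum_const, Finset.card_univ, ← Nat.card_eq_fintype_card, card_line, smul_eq_mul] at e1 e3
    have e4 : ∑ h, 2 * n h = 2 * ∑ h, (n h - 1) + 2 * Nat.card (Pole F {ν}) := by
      rw [Nat.card_eq_fintype_card, ← Finset.card_univ, Finset.card_eq_sum_ones, ← Finset.mul_sum,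
        ← mul_add, ← Finset.sum_add_distrib]
      congr 1
      exact Finset.sum_congr rfl fun h _ => by have := hnpos h; omega
    have e5 : (Nat.card F + 1) * (s * (2 * c)) = 2 * N := by rw [hN, hM]; ring
    rw [e4, e5, hAN] at e1
    omega
  obtain ⟨h, -, hn2, S, hS, m, hm, hsum1, hall⟩ := exists_orbit_step hAN hn Finset.univ
    (fun _ _ _ => Finset.mem_univ _) (by omega)
  have hm2 : 2 * m ≤ N := by rw [← hm]; nlinarith
  have hzero : ∑ h ∈ S, (n h - 1) = 0 := by
    by_contra h0
    obtain ⟨h', -, hn2', S', -, m', hm', hsum2, -⟩ := exists_orbit_step hAN hn S hS (by omega)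
    have : 2 * m' ≤ N := by rw [← hm']; nlinarith
    omega
  have hmM : m + 2 * Nat.card F = M := by omega
  have hkey : (Nat.card F + 1) * s * c + n h * (2 * Nat.card F) = n h * ((Nat.card F + 1) * s) := by
    rw [← hM, ← hN, ← hm, ← hmM]; ring
  have hndvd : 2 * n h ∣ Nat.card F + 1 := by
    rw [← hn h]
    refine (card_stabilizer_dvd_subgroup h).trans (card_stabilizer_dvd_of_not_isSquare h2 hE h ?_)
    have := h.2.2
    rw [Set.mem_singleton_iff] at this
    rwa [this]
  have hcdvd : 2 * c ∣ Nat.card F - 1 := by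
    rw [← hrange x₀]; exact card_range_dvd' x₀
  obtain ⟨f, hf⟩ : s ∣ Nat.card F := hker x₀ ▸ card_ker_dvd x₀
  rcases modular_arithmetic hf hodd hs2 hkey hndvd hcdvd hc0 with ⟨hf1, h2c⟩ | ⟨hq, hs3, hc2, hn5⟩
  · left
    apply Subgroup.eq_top_of_le_card
    refine card_top_le.trans ?_
    rw [← hcardA x₀, hker, hrange, h2c]
    rw [hf1, mul_one] at hf
    rw [← hf]
  · right
    refine ⟨hq, ?_, ?_, ?_, h, ?_⟩
    · rw [hAN, hN, hM, hq, hs3, hc2]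
    · intro x; rw [hrange, hc2]
    · intro y
      rcases hall y (Finset.mem_univ _) with hy | hy
      · left
        have := Finset.sum_eq_zero_iff.mp hzero y hy
        have := hnpos y
        rw [hn]; omega
      · right
        rw [hn, hy, hn5]
    · rw [hn, hn5]

theorem card_centralizer_le_card_stabilizer [Finite F] (h2 : (2 : F) ≠ 0) {E : Set F} (hE : 0 ∉ E)
    {t : A} (h₁ : t.1 ≠ 1) (h₂ : t.1 ≠ -1) {h : Pole F E} (ht : t.1 • h = h) :
    Nat.card (Subgroup.centralizer ({t} : Set A)) = Nat.card (stabilizer A h) := by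
  apply Nat.card_congr (Equiv.subtypeEquivRight fun g => ?_)
  rw [Subgroup.mem_centralizer_singleton_iff, mem_stabilizer_iff, smul_def_pole,
    smul_eq_iff_commute h2 hE h₁ h₂ ht]
  constructor
  · intro h
    exact (congrArg Subtype.val h)
  · intro h
    exact Subtype.ext h

/-- The pole of a nonscalar semisimple element. -/
def poleOf (g : SL₂ F) : Pole F {g.1.trace ^ 2 - 4} :=
  ⟨tracelessPart g.1, trace_tracelessPart _, neg_det_tracelessPart g⟩

theorem smul_poleOf (h2 : (2 : F) ≠ 0) (g : SL₂ F) : g • poleOf g = poleOf g := by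
  rw [Pole.smul_eq_self_iff]
  exact ((commute_tracelessPart_iff h2 g.1 g.1).mpr (Commute.refl _)).symm

theorem card_centralizer_le [Finite F] (h2 : (2 : F) ≠ 0) {t : A} (hd : t.1.1.trace ^ 2 - 4 ≠ 0) :
    Nat.card (Subgroup.centralizer ({t} : Set A)) ≤ Nat.card F + 1 := by
  have hE : (0 : F) ∉ ({t.1.1.trace ^ 2 - 4} : Set F) := fun h => hd (Set.mem_singleton_iff.mp h).symm
  have hq1 : 1 < Nat.card F := Finite.one_lt_card
  have h₁ : t.1 ≠ 1 := by
    intro h; apply hd; rw [h, trace_one]; ring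
  have h₂ : t.1 ≠ -1 := by
    intro h; apply hd; rw [h, trace_neg, trace_one]; ring
  rw [card_centralizer_le_card_stabilizer h2 hE h₁ h₂ (smul_poleOf h2 t.1)]
  refine (Nat.le_of_dvd ?_ (card_stabilizer_dvd_subgroup _)).trans ?_
  · exact Nat.card_pos
  · rcases card_stabilizer_dvd h2 hE (poleOf t.1) with h | h
    · exact (Nat.le_of_dvd (by omega) h).trans (by omega)
    · exact Nat.le_of_dvd (by omega) h

theorem trace_eq_zero_of_lineCharOn_sq (x : Line F) (g : stabilizer A x)
    (h : (lineCharOn A x g : F) ^ 2 = -1) : g.1.1.1.trace = 0 := by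
  have h1 := lineCharOn_sq x g
  rw [h] at h1
  have h3 : g.1.1.1.trace * (lineCharOn A x g : F) = 0 := by linear_combination -h1
  exact (mul_eq_zero.mp h3).resolve_right (Units.ne_zero _)

theorem modular_cases [Finite F] (h2 : (2 : F) ≠ 0) (hneg : -1 ∈ A)
    (hdvd : 2 * (Nat.card F + 1) ∣ Nat.card A)
    {u : SL₂ F} (hu : u ∈ A) (hu1 : u ≠ 1) (hut : u.1.trace = 2) :
    A = ⊤ ∨ (Nat.card F = 9 ∧ Nat.card A = 120 ∧ HasSelfCentralizing A 10 ∧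
      (∃ t : A, t.1.1.trace = 0 ∧ Nat.card (Subgroup.centralizer ({t} : Set A)) ≤ 10) ∧
      ∀ g ∈ A, (g = 1 ∨ g = -1) ∨ g.1.trace = 0 ∨ g.1.trace ^ 2 = 1 ∨
        g.1.trace ^ 2 = g.1.trace + 1 ∨ g.1.trace ^ 2 = -g.1.trace + 1) := by
  have := Fintype.ofFinite F
  obtain ⟨ν, hν⟩ := FiniteField.exists_nonsquare (ringChar_ne_two h2)
  have hE : (0 : F) ∉ ({ν} : Set F) := by
    intro h
    exact hν (by rw [← Set.mem_singleton_iff.mp h]; exact IsSquare.zero)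
  rcases modular_core h2 hneg hdvd hu hu1 hut hν with h | ⟨hq, hA, hr, hst, h, hh⟩
  · exact Or.inl h
  right
  have h3 : (3 : F) = 0 := by
    have h9 : ((Nat.card F : ℕ) : F) = 0 := by
      rw [Nat.card_eq_fintype_card]; exact FiniteField.cast_card_eq_zero F
    rw [hq] at h9
    have : (3 : F) * 3 = 0 := by linear_combination h9
    simpa using this
  have hcyc : ∀ x : Line F, IsCyclic (lineCharOn A x).range := fun x => inferInstance
  refine ⟨hq, hA, hasSelfCentralizing h2 hE hh (by norm_num), ?_, ?_⟩
  · obtain ⟨x⟩ : Nonempty (Line F) := by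
      apply (Nat.card_pos_iff.mp _).1
      rw [card_line]; omega
    obtain ⟨⟨_, g, rfl⟩, hg⟩ := IsCyclic.exists_ofOrder_eq_natCard (α := (lineCharOn A x).range)
    have hg' : orderOf (lineCharOn A x g) = 4 := by
      rw [← hr x, ← hg, ← Subgroup.orderOf_coe]
    have h1 : (lineCharOn A x g : F) ^ 2 = -1 := by
      have h4 : (lineCharOn A x g) ^ 4 = 1 := by rw [← hg', pow_orderOf_eq_one]
      have h4' : (lineCharOn A x g : F) ^ 4 = 1 := by rw [← Units.val_pow_eq_pow_val, h4, Units.val_one]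
      have h5 : ((lineCharOn A x g : F) ^ 2 - 1) * ((lineCharOn A x g : F) ^ 2 + 1) = 0 := by
        linear_combination h4'
      rcases mul_eq_zero.mp h5 with h6 | h6
      · exfalso
        have h7 : (lineCharOn A x g) ^ 2 = 1 := by
          apply Units.ext
          rw [Units.val_pow_eq_pow_val, Units.val_one]
          linear_combination h6
        have := orderOf_dvd_of_pow_eq_one h7
        rw [hg'] at this
        omega
      · linear_combination h6
    have ht := trace_eq_zero_of_lineCharOn_sq x g h1
    refine ⟨g.1, ht, ?_⟩
    have := card_centralizer_le (A := A) h2 (t := g.1) (by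
      rw [ht]; intro h0
      have : (2 : F) * 2 = 0 := by linear_combination -h0
      simp [h2] at this)
    omega
  · intro g hg
    by_cases hg1 : g = 1 ∨ g = -1
    · exact Or.inl hg1
    push Not at hg1
    right
    by_cases hd : g.1.trace ^ 2 - 4 = 0
    · right; left
      linear_combination hd + h3
    by_cases hs : IsSquare (g.1.trace ^ 2 - 4)
    · left
      obtain ⟨⟨x, hx⟩⟩ : Nonempty {x : Line F // g • x = x} := by
        apply (Nat.card_pos_iff.mp _).1
        rw [card_fixed_line_square h2 hg1.1 hg1.2 hd hs]
        norm_num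
      let k : stabilizer A x := ⟨⟨g, hg⟩, hx⟩
      have h4 : (lineCharOn A x k) ^ 4 = 1 := by
        have : (⟨_, k, rfl⟩ : (lineCharOn A x).range) ^ Nat.card (lineCharOn A x).range = 1 :=
          pow_card_eq_one'
        rw [hr] at this
        exact congrArg Subtype.val this
      have h4' : (lineCharOn A x k : F) ^ 4 = 1 := by rw [← Units.val_pow_eq_pow_val, h4, Units.val_one]
      apply trace_eq_zero_of_lineCharOn_sq x k
      have h5 : ((lineCharOn A x k : F) ^ 2 - 1) * ((lineCharOn A x k : F) ^ 2 + 1) = 0 := by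
        linear_combination h4'
      rcases mul_eq_zero.mp h5 with h6 | h6
      · exfalso
        apply hd
        have h7 : (lineCharOn A x k : F) ^ 2 - g.1.trace * lineCharOn A x k + 1 = 0 := lineCharOn_sq x k
        have h8 : g.1.trace * lineCharOn A x k = 2 := by linear_combination h6 - h7
        linear_combination (g.1.trace * lineCharOn A x k + 2) * h8 - g.1.trace ^ 2 * h6
      · linear_combination h6
    · obtain ⟨⟨y, hy⟩⟩ : Nonempty {y : Pole F {ν} // g • y = y} := by
        apply (Nat.card_pos_iff.mp _).1
        rw [card_fixed_nonsquare h2 hν hg1.1 hg1.2 hs]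
        norm_num
      let k : stabilizer A y := ⟨⟨g, hg⟩, hy⟩
      have hk : k ^ 10 = 1 := by
        have h5 : k ^ Nat.card (stabilizer A y) = 1 := pow_card_eq_one'
        rcases hst y with h | h
        · rw [h] at h5
          rw [show (10 : ℕ) = 2 * 5 from rfl, pow_mul, h5, one_pow]
        · rwa [h] at h5
      have hgk : g ^ 10 = 1 := congrArg (fun k => k.1.1) hk
      rcases trace_of_pow_ten h2 hgk with h | h | h
      · exact absurd h (by push Not; exact hg1)
      · exact Or.inr (Or.inr (Or.inl h))
      · exact Or.inr (Or.inr (Or.inr h))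

end Modular

section Tables

/-- Coefficients of a combination of `1`, `a`, `b` and `a * b`. -/
abbrev Coord (Z : Type*) := Z × Z × Z × Z

variable {Z : Type*} [CommRing Z]

/-- Left multiplication by `a`, when `a` has trace `t`. -/
def mulCoordLeft (t : Z) (c : Coord Z) : Coord Z :=
  (-c.2.1, c.1 + t * c.2.1, -c.2.2.2, c.2.2.1 + t * c.2.2.2)

/-- Left multiplication by `b`, when `a`, `b` and `a * b` have traces `t`, `1` and `0`. -/
def mulCoordRight (t : Z) (c : Coord Z) : Coord Z :=
  (-(t * c.2.1) - c.2.2.1 - t * c.2.2.2, c.2.1 + c.2.2.2, c.1 + t * c.2.1 + c.2.2.1, -c.2.1)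

/-- Add an element to a list and to a queue unless the list contains it already. -/
def visit {α : Type*} [DecidableEq α] (y : α) (p : List α × List α) : List α × List α :=
  if y ∈ p.1 then p else (y :: p.1, p.2 ++ [y])

/-- Breadth-first search along the maps `f` and `g`, with at most `n` elements expanded. -/
def explore {α : Type*} [DecidableEq α] (f g : α → α) : ℕ → List α × List α → List α
  | 0, p => p.1
  | _ + 1, (l, []) => l
  | n + 1, (l, x :: q) => explore f g n (visit (g x) (visit (f x) (l, q)))

/-- The elements reachable from `x` along `f` and `g`. -/
def reach {α : Type*} [DecidableEq α] (f g : α → α) (n : ℕ) (x : α) : List α :=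
  explore f g n ([x], [x])

theorem mem_explore {α : Type*} [DecidableEq α] (f g : α → α) (n : ℕ) (p : List α × List α) {x : α}
    (hx : x ∈ p.1) : x ∈ explore f g n p := by
  induction n generalizing p with
  | zero => exact hx
  | succ n ih =>
    obtain ⟨l, q⟩ := p
    have hv : ∀ (y : α) (p : List α × List α), x ∈ p.1 → x ∈ (visit y p).1 := by
      intro y p hp
      unfold visit
      split_ifs
      · exact hp
      · exact List.mem_cons_of_mem _ hp
    cases q with
    | nil => exact hx
    | cons y q => exact ih _ (hv _ _ (hv _ _ hx))

theorem mem_reach {α : Type*} [DecidableEq α] (f g : α → α) (n : ℕ) (x : α) :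
    x ∈ reach f g n x :=
  mem_explore f g n _ (List.mem_singleton_self x)

/-- Membership of the list of reachable elements is stable under both maps, and the list is short. -/
def Closes {α : Type*} [DecidableEq α] (f g : α → α) (n : ℕ) (x : α) : Prop :=
  (reach f g n x).length ≤ n ∧ ∀ c ∈ reach f g n x, f c ∈ reach f g n x ∧ g c ∈ reach f g n x

instance {α : Type*} [DecidableEq α] (f g : α → α) (n : ℕ) (x : α) : Decidable (Closes f g n x) :=
  inferInstanceAs (Decidable (_ ∧ _))

theorem closes_tetrahedral :
    Closes (mulCoordLeft (1 : ℤ)) (mulCoordRight 1) 24 (1, 0, 0, 0) := by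
  decide +kernel

theorem closes_icosahedral :
    Closes (mulCoordLeft (⟨0, 1⟩ : QuadraticAlgebra ℤ 1 1)) (mulCoordRight ⟨0, 1⟩) 120 (1, 0, 0, 0) := by
  decide +kernel

/-- A permutation of order `4` of four letters. -/
def fourCycle : Equiv.Perm (Fin 4) := finRotate 4

/-- A permutation of order `3` of four letters whose product with `fourCycle` has order `2`. -/
def threeCycle : Equiv.Perm (Fin 4) := Equiv.swap 0 1 * (finRotate 4)⁻¹

theorem closes_octahedral :
    Closes (fun c : Coord (QuadraticAlgebra ℤ 2 0) × Equiv.Perm (Fin 4) =>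
        (mulCoordLeft ⟨0, 1⟩ c.1, fourCycle * c.2))
      (fun c => (mulCoordRight ⟨0, 1⟩ c.1, threeCycle * c.2)) 48 ((1, 0, 0, 0), 1) := by
  decide +kernel

end Tables

section Evaluation

variable {Z R : Type*} [CommRing Z] [CommRing R] (f : Z →+* R) (m n : Matrix (Fin 2) (Fin 2) R)

/-- The combination of `1`, `m`, `n` and `m * n` with given coefficients. -/
def evalCoord (c : Coord Z) : Matrix (Fin 2) (Fin 2) R :=
  f c.1 • 1 + f c.2.1 • m + f c.2.2.1 • n + f c.2.2.2 • (m * n)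

theorem evalCoord_one : evalCoord f m n (1, 0, 0, 0) = 1 := by
  simp [evalCoord]

theorem mul_swap : n * m = -(m * n) + m.trace • n + n.trace • m +
    ((m * n).trace - m.trace * n.trace) • (1 : Matrix (Fin 2) (Fin 2) R) := by
  ext i j
  fin_cases i <;> fin_cases j <;>
    simp [Matrix.mul_apply, Fin.sum_univ_two, Matrix.trace_fin_two] <;> ring

variable {f m n}

theorem mul_evalCoord_left {t : Z} (hm : m * m = f t • m - 1) (c : Coord Z) :
    m * evalCoord f m n c = evalCoord f m n (mulCoordLeft t c) := by
  have h3 : m * (m * n) = f t • (m * n) - n := by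
    rw [← Matrix.mul_assoc, hm, Matrix.sub_mul, Matrix.smul_mul, Matrix.one_mul]
  simp only [evalCoord, mulCoordLeft, Matrix.mul_add, Matrix.mul_smul, Matrix.mul_one,
    hm, h3, map_neg, map_add, map_mul]
  module

theorem mul_evalCoord_right {t : Z} (hn : n * n = n - 1)
    (hnm : n * m = -(m * n) + f t • n + m - f t • (1 : Matrix (Fin 2) (Fin 2) R)) (c : Coord Z) :
    n * evalCoord f m n c = evalCoord f m n (mulCoordRight t c) := by
  have h3 : n * (m * n) = m - f t • (1 : Matrix (Fin 2) (Fin 2) R) := by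
    rw [← Matrix.mul_assoc, hnm]
    simp only [Matrix.add_mul, Matrix.sub_mul, Matrix.neg_mul, Matrix.mul_assoc, hn, Matrix.smul_mul,
      Matrix.one_mul, Matrix.mul_sub, Matrix.mul_one]
    module
  simp only [evalCoord, mulCoordRight, Matrix.mul_add, Matrix.mul_smul, Matrix.mul_one,
    hn, h3, hnm, map_neg, map_add, map_sub, map_mul]
  module

variable {a b : SL₂ R}

theorem coe_mul_evalCoord_left {t : Z} (ha : a.1.trace = f t) (c : Coord Z) :
    a.1 * evalCoord f a.1 b.1 c = evalCoord f a.1 b.1 (mulCoordLeft t c) :=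
  mul_evalCoord_left (ha ▸ coe_mul_self a) c

theorem coe_mul_evalCoord_right {t : Z} (ha : a.1.trace = f t) (hb : b.1.trace = 1)
    (hab : (a.1 * b.1).trace = 0) (c : Coord Z) :
    b.1 * evalCoord f a.1 b.1 c = evalCoord f a.1 b.1 (mulCoordRight t c) := by
  refine mul_evalCoord_right ?_ ?_ c
  · have h := coe_mul_self b
    rwa [hb, one_smul] at h
  · have h := mul_swap a.1 b.1
    rw [ha, hb, hab] at h
    rw [h]
    module

/-- A finite set containing `1` and stable under left multiplication by `g` and `h` bounds the
subgroup these generate. -/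
theorem card_closure_le {H α ι : Type*} [Group H] {e : H → α} (he : Function.Injective e)
    [DecidableEq ι] (ev : ι → α) (F G : ι → ι) {n : ℕ} {x : ι} (hx : ev x = e 1)
    (hc : Closes F G n x) {g h : H} (hF : ∀ (k : H) (c : ι), e k = ev c → e (g * k) = ev (F c))
    (hG : ∀ (k : H) (c : ι), e k = ev c → e (h * k) = ev (G c)) :
    Finite (Subgroup.closure {g, h}) ∧ Nat.card (Subgroup.closure {g, h}) ≤ n := by
  let L := reach F G n x
  let T : Set H := {k | ∃ c ∈ L, e k = ev c}
  let φ : T → {c // c ∈ L} := fun k => ⟨k.2.choose, k.2.choose_spec.1⟩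
  have hφ : Function.Injective φ := by
    intro k l hkl
    apply Subtype.ext
    apply he
    have h1 : k.2.choose = l.2.choose := congrArg Subtype.val hkl
    rw [k.2.choose_spec.2, l.2.choose_spec.2, h1]
  have hfin : Finite T := Finite.of_injective φ hφ
  have hcard : Nat.card T ≤ n := by
    refine (Nat.card_le_card_of_injective φ hφ).trans (le_trans ?_ hc.1)
    rw [Nat.card_congr (Equiv.subtypeEquivRight (q := fun c => c ∈ L.toFinset) (fun c => by simp)),
      Nat.card_eq_fintype_card, Fintype.card_coe]
    exact L.toFinset_card_le
  have hinv : ∀ s : H, (∀ k ∈ T, s * k ∈ T) → ∀ k ∈ T, s⁻¹ * k ∈ T := by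
    intro s hs k hk
    obtain ⟨⟨l, hl⟩, hlk⟩ := Finite.surjective_of_injective (f := fun k : T => (⟨s * k, hs k k.2⟩ : T))
      (fun k l hkl => Subtype.ext (mul_left_cancel (congrArg Subtype.val hkl))) ⟨k, hk⟩
    have : s * l = k := congrArg Subtype.val hlk
    rw [← this, inv_mul_cancel_left]
    exact hl
  have hgT : ∀ k ∈ T, g * k ∈ T := fun k ⟨c, hcL, hk⟩ => ⟨F c, (hc.2 c hcL).1, hF k c hk⟩
  have hhT : ∀ k ∈ T, h * k ∈ T := fun k ⟨c, hcL, hk⟩ => ⟨G c, (hc.2 c hcL).2, hG k c hk⟩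
  have hsub : ((Subgroup.closure {g, h} : Subgroup H) : Set H) ⊆ T := by
    intro k hk
    induction hk using Subgroup.closure_induction_left with
    | one => exact ⟨x, mem_reach F G n x, hx.symm⟩
    | mul_left s hs y _ ih =>
      rcases hs with rfl | rfl
      · exact hgT _ ih
      · exact hhT _ ih
    | inv_mul_cancel s hs y _ ih =>
      rcases hs with rfl | rfl
      · exact hinv _ hgT _ ih
      · exact hinv _ hhT _ ih
  exact ⟨Finite.of_injective _ (Set.inclusion_injective hsub),
    (Nat.card_le_card_of_injective _ (Set.inclusion_injective hsub)).trans hcard⟩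

end Evaluation

section Generation

variable {r : ℕ}

/-- The negative of an elementary unipotent matrix. -/
def negUnipotent (r : ℕ) : SL₂ (ZMod r) := ⟨!![-1, -1; 0, -1], by simp [det_fin_two]⟩

/-- A matrix of trace `1` in `SL₂ (ZMod r)`. -/
def traceOne (r : ℕ) : SL₂ (ZMod r) := ⟨!![0, 1; -1, 1], by simp [det_fin_two]⟩

/-- Upper triangular unipotent matrices. -/
def upper (c : ZMod r) : SL₂ (ZMod r) := ⟨!![1, c; 0, 1], by simp [det_fin_two]⟩

/-- Lower triangular unipotent matrices. -/
def lower (c : ZMod r) : SL₂ (ZMod r) := ⟨!![1, 0; c, 1], by simp [det_fin_two]⟩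

/-- The Weyl element. -/
def weyl (r : ℕ) : SL₂ (ZMod r) := ⟨!![0, 1; -1, 0], by simp [det_fin_two]⟩

theorem coe_negUnipotent : (negUnipotent r).1 = !![-1, -1; 0, -1] := rfl

theorem coe_traceOne : (traceOne r).1 = !![0, 1; -1, 1] := rfl

theorem coe_upper (c : ZMod r) : (upper c).1 = !![1, c; 0, 1] := rfl

theorem coe_lower (c : ZMod r) : (lower c).1 = !![1, 0; c, 1] := rfl

theorem coe_weyl : (weyl r).1 = !![0, 1; -1, 0] := rfl

theorem cube_eq_neg_one {F : Type*} [Field F] {g : SL₂ F} (hg : g.1.trace = 1) : g ^ 3 = -1 := by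
  apply Subtype.ext
  rw [coe_pow_three, hg, coe_neg_one]
  simp

theorem traceOne_pow_three (r : ℕ) : traceOne r ^ 3 = -1 := by
  rw [pow_succ, pow_two]
  refine Matrix.SpecialLinearGroup.ext _ _ fun i j => ?_
  simp only [Matrix.SpecialLinearGroup.coe_mul, coe_traceOne, Matrix.SpecialLinearGroup.coe_neg,
    Matrix.SpecialLinearGroup.coe_one]
  fin_cases i <;> fin_cases j <;> simp [Matrix.mul_apply, Fin.sum_univ_two]

theorem upper_mul (c d : ZMod r) : upper c * upper d = upper (c + d) := by
  refine Matrix.SpecialLinearGroup.ext _ _ fun i j => ?_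
  simp only [Matrix.SpecialLinearGroup.coe_mul, coe_upper]
  fin_cases i <;> fin_cases j <;> simp [Matrix.mul_apply, Fin.sum_univ_two, add_comm]

theorem upper_zero : upper (0 : ZMod r) = 1 := by
  refine Matrix.SpecialLinearGroup.ext _ _ fun i j => ?_
  simp only [Matrix.SpecialLinearGroup.coe_one, coe_upper]
  fin_cases i <;> fin_cases j <;> simp

theorem neg_negUnipotent : -negUnipotent r = upper 1 := by
  refine Matrix.SpecialLinearGroup.ext _ _ fun i j => ?_
  simp only [Matrix.SpecialLinearGroup.coe_neg, coe_upper, coe_negUnipotent]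
  fin_cases i <;> fin_cases j <;> simp

theorem traceOne_mul_upper : traceOne r * upper 1 = weyl r := by
  refine Matrix.SpecialLinearGroup.ext _ _ fun i j => ?_
  simp only [Matrix.SpecialLinearGroup.coe_mul, coe_upper, coe_traceOne, coe_weyl]
  fin_cases i <;> fin_cases j <;> simp [Matrix.mul_apply, Fin.sum_univ_two]

theorem weyl_mul_upper_mul_weyl_inv (c : ZMod r) : weyl r * upper (-c) * (weyl r)⁻¹ = lower c := by
  refine Matrix.SpecialLinearGroup.ext _ _ fun i j => ?_
  simp only [Matrix.SpecialLinearGroup.coe_mul, Matrix.SpecialLinearGroup.coe_inv, coe_upper, coe_lower, coe_weyl,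
    adjugate_fin_two]
  fin_cases i <;> fin_cases j <;> simp [Matrix.mul_apply, Fin.sum_univ_two]

theorem eq_upper_mul_lower_mul_upper [Fact r.Prime] (g : SL₂ (ZMod r)) (hg : g.1 1 0 ≠ 0) :
    g = upper ((g.1 0 0 - 1) / g.1 1 0) * lower (g.1 1 0) * upper ((g.1 1 1 - 1) / g.1 1 0) := by
  have hd := g.2
  rw [det_fin_two] at hd
  refine Matrix.SpecialLinearGroup.ext _ _ fun i j => ?_
  simp only [Matrix.SpecialLinearGroup.coe_mul, coe_upper, coe_lower]
  fin_cases i <;> fin_cases j <;> simp [Matrix.mul_apply, Fin.sum_univ_two]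
  · field_simp; ring
  · field_simp
    linear_combination -hd
  · field_simp; ring

theorem weyl_mul_one_zero (g : SL₂ (ZMod r)) : (weyl r * g).1 1 0 = -g.1 0 0 := by
  simp [Matrix.SpecialLinearGroup.coe_mul, coe_weyl, Matrix.mul_apply, Fin.sum_univ_two]

theorem closure_negUnipotent_traceOne [Fact r.Prime] :
    Subgroup.closure {negUnipotent r, traceOne r} = ⊤ := by
  set S := Subgroup.closure {negUnipotent r, traceOne r} with hS
  have hx : negUnipotent r ∈ S := Subgroup.subset_closure (by simp)
  have hy : traceOne r ∈ S := Subgroup.subset_closure (by simp)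
  have hneg : -1 ∈ S := by rw [← traceOne_pow_three]; exact S.pow_mem hy 3
  have hu1 : upper 1 ∈ S := by
    rw [← neg_negUnipotent, ← neg_one_mul]; exact S.mul_mem hneg hx
  have hw : weyl r ∈ S := by
    rw [← traceOne_mul_upper]; exact S.mul_mem hy hu1
  have hnat : ∀ k : ℕ, upper (k : ZMod r) ∈ S := by
    intro k
    induction k with
    | zero => rw [Nat.cast_zero, upper_zero]; exact S.one_mem
    | succ k ih => rw [Nat.cast_succ, ← upper_mul]; exact S.mul_mem ih hu1
  have hu : ∀ c : ZMod r, upper c ∈ S := by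
    intro c
    have := hnat c.val
    rwa [ZMod.natCast_zmod_val] at this
  have hl : ∀ c : ZMod r, lower c ∈ S := by
    intro c
    rw [← weyl_mul_upper_mul_weyl_inv]
    exact S.mul_mem (S.mul_mem hw (hu _)) (S.inv_mem hw)
  have hmem : ∀ g : SL₂ (ZMod r), g.1 1 0 ≠ 0 → g ∈ S := by
    intro g hg
    rw [eq_upper_mul_lower_mul_upper g hg]
    exact S.mul_mem (S.mul_mem (hu _) (hl _)) (hu _)
  rw [eq_top_iff]
  intro g _
  by_cases hg : g.1 1 0 = 0
  · have h1 : weyl r * g ∈ S := by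
      apply hmem
      rw [weyl_mul_one_zero, neg_ne_zero]
      intro h0
      have hd := g.2
      rw [det_fin_two, h0, hg] at hd
      simp at hd
    exact (S.mul_mem_cancel_left hw).mp h1
  · exact hmem g hg

theorem card_specialLinearGroup_three : Nat.card (SL₂ (ZMod 3)) = 24 := by
  rw [Nat.card_eq_fintype_card]
  decide +kernel

theorem card_specialLinearGroup_five : Nat.card (SL₂ (ZMod 5)) = 120 := by
  rw [Nat.card_eq_fintype_card]
  decide +kernel

end Generation

section Graph

/-- The subgroup of `A × K` generated by two pairs. -/
abbrev graph {A K : Type*} [Group A] [Group K] (a b : A) (x y : K) : Subgroup (A × K) :=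
  Subgroup.closure {(a, x), (b, y)}

/-- The first projection. -/
def graphFst {A K : Type*} [Group A] [Group K] (a b : A) (x y : K) : graph a b x y →* A :=
  (MonoidHom.fst A K).comp (Subgroup.subtype _)

/-- The second projection. -/
def graphSnd {A K : Type*} [Group A] [Group K] (a b : A) (x y : K) : graph a b x y →* K :=
  (MonoidHom.snd A K).comp (Subgroup.subtype _)

variable {A K : Type*} [Group A] [Group K] (a b : A) (x y : K)

theorem left_mem_graph : (a, x) ∈ graph a b x y := Subgroup.subset_closure (by simp)

theorem right_mem_graph : (b, y) ∈ graph a b x y := Subgroup.subset_closure (by simp)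

theorem graphSnd_surjective (h : Subgroup.closure {x, y} = ⊤) :
    Function.Surjective (graphSnd a b x y) := by
  rw [← MonoidHom.range_eq_top, eq_top_iff, ← h, Subgroup.closure_le]
  rintro _ (rfl | rfl)
  · exact ⟨⟨_, left_mem_graph a b _ y⟩, rfl⟩
  · exact ⟨⟨_, right_mem_graph a b x _⟩, rfl⟩

theorem mem_range_graphFst : a ∈ (graphFst a b x y).range ∧ b ∈ (graphFst a b x y).range :=
  ⟨⟨⟨_, left_mem_graph a b x y⟩, rfl⟩, ⟨⟨_, right_mem_graph a b x y⟩, rfl⟩⟩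

theorem card_ker_mul_card_range {H L : Type*} [Group H] [Group L] (f : H →* L) :
    Nat.card f.range * Nat.card f.ker = Nat.card H := by
  rw [Subgroup.card_eq_card_quotient_mul_card_subgroup f.ker,
    Nat.card_congr (QuotientGroup.quotientKerEquivRange f).toEquiv]

/-- The kernel of the first projection has order at most `2` when the group is small. -/
theorem card_ker_graphFst_dvd [Finite (graph a b x y)] {n : ℕ} (hn : Nat.card (graph a b x y) = n)
    (hdiv : ∀ B : Subgroup A, a ∈ B → b ∈ B → n ∣ 2 * Nat.card B) :
    Nat.card (graphFst a b x y).ker ∣ 2 := by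
  have h1 := card_ker_mul_card_range (graphFst a b x y)
  have h3 := hdiv _ (mem_range_graphFst a b x y).1 (mem_range_graphFst a b x y).2
  have h4 : 0 < Nat.card (graphFst a b x y).range :=
    Nat.pos_of_ne_zero fun h0 => by
      rw [h0, zero_mul] at h1
      exact absurd h1.symm Nat.card_pos.ne'
  rw [← hn, ← h1, mul_comm 2] at h3
  exact Nat.dvd_of_mul_dvd_mul_left h4 h3

end Graph

section Recognition

theorem trace_negUnipotent (r : ℕ) : (negUnipotent r).1.trace = -2 := by
  rw [coe_negUnipotent, trace_fin_two]
  simp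
  ring

theorem trace_traceOne (r : ℕ) : (traceOne r).1.trace = 1 := by
  rw [coe_traceOne, trace_fin_two]
  simp

theorem trace_negUnipotent_mul_traceOne (r : ℕ) : ((negUnipotent r).1 * (traceOne r).1).trace = 0 := by
  rw [coe_traceOne, coe_negUnipotent, trace_fin_two]
  simp [Matrix.mul_apply, Fin.sum_univ_two]

variable {F : Type*} [Field F] {A : Subgroup (SL₂ F)}

theorem card_graph_le {a b : A} {R : Type*} [CommRing R] {x y : SL₂ R} {Z : Type*} [CommRing Z]
    [DecidableEq Z] {t : Z} {n : ℕ} {f : Z →+* F} {f' : Z →+* R}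
    (hc : Closes (mulCoordLeft t) (mulCoordRight t) n (1, 0, 0, 0))
    (ha : a.1.1.trace = f t) (hb : b.1.1.trace = 1) (hab : (a.1.1 * b.1.1).trace = 0)
    (hx : x.1.trace = f' t) (hy : y.1.trace = 1) (hxy : (x.1 * y.1).trace = 0) :
    Finite (graph a b x y) ∧ Nat.card (graph a b x y) ≤ n := by
  refine card_closure_le (H := A × SL₂ R) (e := fun k => (k.1.1.1, k.2.1)) ?_
    (fun c => (evalCoord f a.1.1 b.1.1 c, evalCoord f' x.1 y.1 c)) _ _ ?_ hc ?_ ?_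
  · intro k l hkl
    exact Prod.ext (Subtype.ext (Subtype.ext (Prod.ext_iff.mp hkl).1))
      (Subtype.ext (Prod.ext_iff.mp hkl).2)
  · exact Prod.ext (evalCoord_one f a.1.1 b.1.1) (evalCoord_one f' x.1 y.1)
  · intro k c hk
    refine Prod.ext ?_ ?_
    · change a.1.1 * k.1.1.1 = _
      rw [show k.1.1.1 = _ from congrArg Prod.fst hk, coe_mul_evalCoord_left ha]
    · change x.1 * k.2.1 = _
      rw [show k.2.1 = _ from congrArg Prod.snd hk, coe_mul_evalCoord_left hx]
  · intro k c hk
    refine Prod.ext ?_ ?_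
    · change b.1.1 * k.1.1.1 = _
      rw [show k.1.1.1 = _ from congrArg Prod.fst hk, coe_mul_evalCoord_right ha hb hab]
    · change y.1 * k.2.1 = _
      rw [show k.2.1 = _ from congrArg Prod.snd hk, coe_mul_evalCoord_right hx hy hxy]

theorem mul_self_eq_one_of_mem {G : Type*} [Group G] {N : Subgroup G} (hN : Nat.card N ∣ 2) {k : G}
    (hk : k ∈ N) : k * k = 1 := by
  have h1 : (⟨k, hk⟩ : N) ^ 2 = 1 := orderOf_dvd_iff_pow_eq_one.mp ((orderOf_dvd_natCard _).trans hN)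
  rw [← pow_two]
  exact congrArg Subtype.val h1

theorem nonempty_mulEquiv_of_trace [Finite F] (h2 : (2 : F) ≠ 0) {r : ℕ} [Fact r.Prime]
    (hr : (2 : ZMod r) ≠ 0) {a b : A} {Z : Type*} [CommRing Z]
    [DecidableEq Z] {t : Z} {n : ℕ} {f : Z →+* F} {f' : Z →+* ZMod r}
    (hn : Nat.card (SL₂ (ZMod r)) = n)
    (hc : Closes (mulCoordLeft t) (mulCoordRight t) n (1, 0, 0, 0))
    (ha : a.1.1.trace = f t) (hb : b.1.1.trace = 1) (hab : (a.1.1 * b.1.1).trace = 0)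
    (ht : f' t = -2) (hdiv : ∀ B : Subgroup A, a ∈ B → b ∈ B → n ∣ 2 * Nat.card B)
    (hA : Nat.card A = n) : Nonempty (A ≃* SL₂ (ZMod r)) := by
  obtain ⟨hfin, hle⟩ := card_graph_le (x := negUnipotent r) (y := traceOne r) hc ha hb hab
    (by rw [trace_negUnipotent, ht]) (trace_traceOne r) (trace_negUnipotent_mul_traceOne r)
  have hsurj := graphSnd_surjective a b _ _ (closure_negUnipotent_traceOne (r := r))
  have hbij : Function.Bijective (graphSnd a b (negUnipotent r) (traceOne r)) :=
    hsurj.bijective_of_nat_card_le (by rwa [hn])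
  have hcard : Nat.card (graph a b (negUnipotent r) (traceOne r)) = n := by
    rw [← hn]; exact Nat.card_congr (Equiv.ofBijective _ hbij)
  have hker := card_ker_graphFst_dvd a b _ _ hcard hdiv
  have hinj : Function.Injective (graphFst a b (negUnipotent r) (traceOne r)) := by
    rw [injective_iff_map_eq_one]
    intro k hk
    have hk2 := mul_self_eq_one_of_mem hker hk
    have hs : graphSnd a b (negUnipotent r) (traceOne r) k * graphSnd a b _ _ k = 1 := by
      rw [← map_mul, hk2, map_one]
    rcases eq_one_or_eq_neg_one_of_mul_self hr hs with h | h
    · exact hbij.1 (h.trans (map_one _).symm)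
    · exfalso
      let y : graph a b (negUnipotent r) (traceOne r) := ⟨_, right_mem_graph a b _ _⟩
      have h3 : k = y ^ 3 := hbij.1 (h.trans (traceOne_pow_three r).symm)
      have h4 : b ^ 3 = 1 := by rw [← hk, h3]; rfl
      have h5 : b.1 ^ 3 = 1 := congrArg Subtype.val h4
      rw [cube_eq_neg_one hb] at h5
      exact one_ne_neg_one h2 h5.symm
  have hbij' := hinj.bijective_of_nat_card_le (by rw [hA, hcard])
  exact ⟨(MulEquiv.ofBijective _ hbij').symm.trans (MulEquiv.ofBijective _ hbij)⟩

variable {a b : A}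

theorem sq_ne_one_of_trace (h2 : (2 : F) ≠ 0) (hb : b.1.1.trace ≠ 0)
    (hab : (a.1.1 * b.1.1).trace = 0) : a ^ 2 ≠ 1 := by
  intro h
  have h1 : a.1 * a.1 = 1 := by rw [← pow_two]; exact congrArg Subtype.val h
  rcases eq_one_or_eq_neg_one_of_mul_self h2 h1 with h | h
  · rw [h, Matrix.SpecialLinearGroup.coe_one, one_mul] at hab
    exact hb hab
  · rw [h, coe_neg_one, neg_one_mul, Matrix.trace_neg, neg_eq_zero] at hab
    exact hb hab

theorem sq_ne_one_of_trace' (h2 : (2 : F) ≠ 0) (ha : a.1.1.trace ≠ 0)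
    (hab : (a.1.1 * b.1.1).trace = 0) : b ^ 2 ≠ 1 :=
  sq_ne_one_of_trace h2 ha (by rwa [Matrix.trace_mul_comm])

theorem orderOf_of_trace_eq_zero (h2 : (2 : F) ≠ 0) {g : A} (hg : g.1.1.trace = 0) :
    orderOf g = 4 := by
  have h1 : g.1 * g.1 = -1 := (mul_self_eq_neg_one_iff _).mpr hg
  rw [← Subgroup.orderOf_coe]
  refine orderOf_eq_prime_pow (p := 2) (n := 1) ?_ ?_
  · rw [pow_one, pow_two, h1]
    exact (one_ne_neg_one h2).symm
  · rw [show 2 ^ (1 + 1) = 2 * 2 from rfl, pow_mul, pow_two g.1, h1]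
    simp

theorem orderOf_dvd_card_of_mem {G : Type*} [Group G] {B : Subgroup G} {g : G} (hg : g ∈ B) :
    orderOf g ∣ Nat.card B := by
  rw [← Subgroup.orderOf_mk g hg]
  exact orderOf_dvd_natCard _

theorem twelve_dvd_card (h2 : (2 : F) ≠ 0) (ha : a.1.1.trace ≠ 0) (hb : b.1.1.trace = 1)
    (hab : (a.1.1 * b.1.1).trace = 0) {B : Subgroup A} (haB : a ∈ B) (hbB : b ∈ B) :
    12 ∣ Nat.card B := by
  have h4 : 4 ∣ Nat.card B := by
    rw [← orderOf_of_trace_eq_zero h2 (g := a * b) hab]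
    exact orderOf_dvd_card_of_mem (B.mul_mem haB hbB)
  have hb1 : b.1 ^ 3 = -1 := cube_eq_neg_one hb
  have h3 : orderOf (b ^ 2) = 3 := by
    refine orderOf_eq_prime ?_ (sq_ne_one_of_trace' h2 ha hab)
    apply Subtype.ext
    change (b.1 ^ 2) ^ 3 = 1
    rw [pow_right_comm, hb1]
    simp
  have h3' : 3 ∣ Nat.card B := by
    rw [← h3]
    exact orderOf_dvd_card_of_mem (B.pow_mem hbB 2)
  omega

theorem sixty_dvd_card (h2 : (2 : F) ≠ 0) (ha : a.1.1.trace ^ 2 = a.1.1.trace + 1)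
    (hb : b.1.1.trace = 1)
    (hab : (a.1.1 * b.1.1).trace = 0) {B : Subgroup A} (haB : a ∈ B) (hbB : b ∈ B) :
    60 ∣ Nat.card B := by
  have ha0 : a.1.1.trace ≠ 0 := by
    intro h
    rw [h] at ha
    simp at ha
  have h12 := twelve_dvd_card h2 ha0 hb hab haB hbB
  have ha5 : a.1 ^ 5 = -1 := by
    apply Subtype.ext
    rw [coe_pow_five, coe_neg_one]
    have e1 : a.1.1.trace ^ 3 = 2 * a.1.1.trace + 1 := by linear_combination (a.1.1.trace + 1) * ha
    rw [ha, e1]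
    module
  have h5 : orderOf (a ^ 2) = 5 := by
    have : Fact (Nat.Prime 5) := ⟨by norm_num⟩
    refine orderOf_eq_prime ?_ (sq_ne_one_of_trace h2 (by rw [hb]; exact one_ne_zero) hab)
    apply Subtype.ext
    change (a.1 ^ 2) ^ 5 = 1
    rw [pow_right_comm, ha5]
    simp
  have h5' : 5 ∣ Nat.card B := by
    rw [← h5]
    exact orderOf_dvd_card_of_mem (B.pow_mem haB 2)
  omega

theorem twentyFour_dvd_card (h2 : (2 : F) ≠ 0) (ha : a.1.1.trace ^ 2 = 2)
    (hb : b.1.1.trace = 1)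
    (hab : (a.1.1 * b.1.1).trace = 0) {B : Subgroup A} (haB : a ∈ B) (hbB : b ∈ B) :
    24 ∣ Nat.card B := by
  have ha0 : a.1.1.trace ≠ 0 := by
    intro h
    rw [h] at ha
    apply h2
    rw [← ha]; simp
  have h12 := twelve_dvd_card h2 ha0 hb hab haB hbB
  have ht : (a ^ 2).1.1.trace = 0 := by
    change (a.1 ^ 2).1.trace = 0
    rw [pow_two, Matrix.SpecialLinearGroup.coe_mul, coe_mul_self, trace_sub, trace_smul, smul_eq_mul,
      ← pow_two, ha, Matrix.trace_one]
    simp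
  have h4 := orderOf_of_trace_eq_zero h2 ht
  have h8 : orderOf a = 8 := by
    refine orderOf_eq_prime_pow (p := 2) (n := 2) ?_ ?_
    · rw [show 2 ^ 2 = 2 * 2 from rfl, pow_mul]
      intro h
      have := orderOf_dvd_of_pow_eq_one h
      rw [h4] at this
      omega
    · rw [show 2 ^ (2 + 1) = 2 * 4 from rfl, pow_mul, ← h4, pow_orderOf_eq_one]
  have h8' : 8 ∣ Nat.card B := by
    rw [← h8]
    exact orderOf_dvd_card_of_mem haB
  omega

end Recognition

section Exceptional

variable {F : Type*} [Field F]

theorem exists_ringHom_of_mul_self {R : Type*} [CommRing R] {c d : ℤ} {u : R}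
    (hu : u * u = c + d * u) : ∃ f : QuadraticAlgebra ℤ c d →+* R, f ⟨0, 1⟩ = u := by
  refine ⟨(QuadraticAlgebra.lift (R := ℤ) (a := c) (b := d) ⟨u, ?_⟩ : _ →ₐ[ℤ] R), ?_⟩
  · rw [hu]; simp
  · simp [QuadraticAlgebra.lift]

variable {A : Subgroup (SL₂ F)} {a b : A}

theorem nonempty_mulEquiv_three [Finite F] (h2 : (2 : F) ≠ 0) (ha : a.1.1.trace = 1)
    (hb : b.1.1.trace = 1) (hab : (a.1.1 * b.1.1).trace = 0) (hA : Nat.card A = 24) :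
    Nonempty (A ≃* SL₂ (ZMod 3)) := by
  refine nonempty_mulEquiv_of_trace (f := Int.castRingHom F) (f' := Int.castRingHom (ZMod 3)) h2
    (by decide) card_specialLinearGroup_three closes_tetrahedral (by rw [ha, map_one]) hb hab
    (by decide) (fun B haB hbB => ?_) hA
  have := twelve_dvd_card h2 (by rw [ha]; exact one_ne_zero) hb hab haB hbB
  omega

instance : Fact (Nat.Prime 5) := ⟨by norm_num⟩

theorem nonempty_mulEquiv_five [Finite F] (h2 : (2 : F) ≠ 0)
    (ha : a.1.1.trace ^ 2 = a.1.1.trace + 1)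
    (hb : b.1.1.trace = 1) (hab : (a.1.1 * b.1.1).trace = 0) (hA : Nat.card A = 120) :
    Nonempty (A ≃* SL₂ (ZMod 5)) := by
  obtain ⟨f, hf⟩ := exists_ringHom_of_mul_self (c := 1) (d := 1) (u := a.1.1.trace)
    (by rw [← pow_two, ha]; push_cast; ring)
  obtain ⟨f', hf'⟩ := exists_ringHom_of_mul_self (c := 1) (d := 1) (u := (-2 : ZMod 5)) (by decide)
  refine nonempty_mulEquiv_of_trace h2
    (by decide) card_specialLinearGroup_five closes_icosahedral hf.symm hb hab
    hf' (fun B haB hbB => ?_) hA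
  have := sixty_dvd_card h2 ha hb hab haB hbB
  omega

theorem closure_fourCycle_threeCycle : Subgroup.closure {fourCycle, threeCycle} = ⊤ := by
  rw [eq_top_iff, ← Equiv.Perm.closure_cycle_adjacent_swap (σ := fourCycle)
    isCycle_finRotate support_finRotate 0, Subgroup.closure_le]
  have h4 : fourCycle ∈ Subgroup.closure {fourCycle, threeCycle} :=
    Subgroup.subset_closure (by simp)
  have h3 : threeCycle ∈ Subgroup.closure {fourCycle, threeCycle} :=
    Subgroup.subset_closure (by simp)
  rintro _ (rfl | rfl)
  · exact h4
  · have := mul_mem h3 h4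
    rwa [show threeCycle * fourCycle = Equiv.swap 0 (fourCycle 0) by decide] at this

theorem threeCycle_pow_three : threeCycle ^ 3 = 1 := by decide

theorem perm_eq_one_of_comm (σ : Equiv.Perm (Fin 4)) (h : ∀ τ, τ * σ = σ * τ) : σ = 1 := by
  revert σ
  decide

theorem card_graph_octahedral_le {f : QuadraticAlgebra ℤ 2 0 →+* F}
    (ha : a.1.1.trace = f ⟨0, 1⟩) (hb : b.1.1.trace = 1) (hab : (a.1.1 * b.1.1).trace = 0) :
    Finite (graph a b fourCycle threeCycle) ∧ Nat.card (graph a b fourCycle threeCycle) ≤ 48 := by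
  refine card_closure_le (H := A × Equiv.Perm (Fin 4)) (e := fun k => (k.1.1.1, k.2)) ?_
    (fun c => (evalCoord f a.1.1 b.1.1 c.1, c.2)) _ _ ?_ closes_octahedral ?_ ?_
  · intro k l hkl
    exact Prod.ext (Subtype.ext (Subtype.ext (Prod.ext_iff.mp hkl).1)) (Prod.ext_iff.mp hkl).2
  · exact Prod.ext (evalCoord_one f a.1.1 b.1.1) rfl
  · intro k c hk
    refine Prod.ext ?_ ?_
    · change a.1.1 * k.1.1.1 = _
      rw [show k.1.1.1 = _ from congrArg Prod.fst hk, coe_mul_evalCoord_left ha]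
    · change fourCycle * k.2 = _
      rw [show k.2 = c.2 from congrArg Prod.snd hk]
  · intro k c hk
    refine Prod.ext ?_ ?_
    · change b.1.1 * k.1.1.1 = _
      rw [show k.1.1.1 = _ from congrArg Prod.fst hk, coe_mul_evalCoord_right ha hb hab]
    · change threeCycle * k.2 = _
      rw [show k.2 = c.2 from congrArg Prod.snd hk]

theorem existsUnique_orderOf_eq_two (h2 : (2 : F) ≠ 0) (hneg : -1 ∈ A) :
    ∃! x : A, orderOf x = 2 := by
  refine ⟨⟨-1, hneg⟩, ?_, ?_⟩
  · refine orderOf_eq_prime ?_ ?_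
    · apply Subtype.ext
      change (-1 : SL₂ F) ^ 2 = 1
      simp
    · intro h
      exact one_ne_neg_one h2 (congrArg Subtype.val h).symm
  · intro x hx
    have h1 : x * x = 1 := by
      have := pow_orderOf_eq_one x
      rwa [hx, pow_two] at this
    rcases eq_one_or_eq_neg_one_of_mul_self h2 (g := x.1) (congrArg Subtype.val h1) with h | h
    · have h' : x = 1 := Subtype.ext h
      rw [h', orderOf_one] at hx
      omega
    · exact Subtype.ext h

theorem mem_center_of_card_dvd_two {G : Type*} [Group G] {N : Subgroup G} [N.Normal]
    (hN : Nat.card N ∣ 2) {k : G} (hk : k ∈ N) : k ∈ Subgroup.center G := by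
  have hfin : Finite N := Nat.finite_of_card_ne_zero (ne_zero_of_dvd_ne_zero two_ne_zero hN)
  rw [Subgroup.mem_center_iff]
  intro g
  have h3 : g * k * g⁻¹ ∈ N := Subgroup.Normal.conj_mem ‹_› k hk g
  by_contra hne
  have e0 : k ≠ 1 := by rintro rfl; simp at hne
  have e1 : g * k * g⁻¹ ≠ 1 := by rwa [Ne, conj_eq_one_iff]
  have e2 : g * k * g⁻¹ ≠ k := fun h => hne (mul_inv_eq_iff_eq_mul.mp h)
  have hinj : Function.Injective (![⟨1, N.one_mem⟩, ⟨k, hk⟩, ⟨_, h3⟩] : Fin 3 → N) := by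
    intro i j hij
    have h4 := congrArg Subtype.val hij
    fin_cases i <;> fin_cases j <;> simp at h4 ⊢
    all_goals first
      | exact e0 h4
      | exact e0 h4.symm
      | exact e1 h4
      | exact e1 h4.symm
      | exact e2 h4
      | exact e2 h4.symm
  have := Nat.card_le_card_of_injective _ hinj
  rw [Nat.card_eq_fintype_card, Fintype.card_fin] at this
  exact absurd (this.trans (Nat.le_of_dvd two_pos hN)) (by norm_num)

theorem nonempty_quotient_center_mulEquiv [Finite F] (h2 : (2 : F) ≠ 0)
    (ha : a.1.1.trace ^ 2 = 2)
    (hb : b.1.1.trace = 1) (hab : (a.1.1 * b.1.1).trace = 0) (hA : Nat.card A = 48) :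
    Nonempty (A ⧸ Subgroup.center A ≃* Equiv.Perm (Fin 4)) := by
  obtain ⟨f, hf⟩ := exists_ringHom_of_mul_self (c := 2) (d := 0) (u := a.1.1.trace)
    (by rw [← pow_two, ha]; push_cast; ring)
  obtain ⟨hfin, hle⟩ := card_graph_octahedral_le hf.symm hb hab
  have hS : Nat.card (Equiv.Perm (Fin 4)) = 24 := by
    rw [Nat.card_eq_fintype_card]; rfl
  have hsurj := graphSnd_surjective a b _ _ closure_fourCycle_threeCycle
  set p₁ := graphFst a b fourCycle threeCycle with hp₁
  set p₂ := graphSnd a b fourCycle threeCycle with hp₂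
  have hb3 : b.1 ^ 3 = -1 := cube_eq_neg_one hb
  let y : graph a b fourCycle threeCycle := ⟨_, right_mem_graph a b _ _⟩
  have hy : y ^ 3 ∈ p₂.ker := threeCycle_pow_three
  have hker : 1 < Nat.card p₂.ker := by
    rw [Finite.one_lt_card_iff_nontrivial]
    refine ⟨⟨⟨y ^ 3, hy⟩, 1, fun h => ?_⟩⟩
    have h1 : y ^ 3 = 1 := congrArg Subtype.val h
    have h3 : b.1 ^ 3 = 1 := congrArg (fun k => k.1.1.1) h1
    exact one_ne_neg_one h2 (h3.symm.trans hb3)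
  have hcard : Nat.card (graph a b fourCycle threeCycle) = 48 := by
    have h := card_ker_mul_card_range p₂
    rw [MonoidHom.range_eq_top.mpr hsurj, Subgroup.card_top, hS] at h
    omega
  have hk1 := card_ker_graphFst_dvd a b _ _ hcard fun B haB hbB => by
    have := twentyFour_dvd_card h2 ha hb hab haB hbB
    omega
  have hcomm : ∀ k ∈ p₁.ker, ∀ g, g * k = k * g := by
    intro k hk g
    exact Subgroup.mem_center_iff.mp (mem_center_of_card_dvd_two hk1 hk) g
  have hinj : Function.Injective p₁ := by
    rw [injective_iff_map_eq_one]
    intro k hk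
    have h1 : p₂ k = 1 := by
      refine perm_eq_one_of_comm _ fun τ => ?_
      obtain ⟨g, rfl⟩ := hsurj τ
      rw [← map_mul, ← map_mul, hcomm k hk]
    exact Subtype.ext (Prod.ext hk h1)
  let e : graph a b fourCycle threeCycle ≃* A :=
    MulEquiv.ofBijective p₁ (hinj.bijective_of_nat_card_le (by rw [hA, hcard]))
  let φ : A →* Equiv.Perm (Fin 4) := p₂.comp e.symm.toMonoidHom
  have hφ : Function.Surjective φ := hsurj.comp e.symm.surjective
  have hφ2 : Nat.card φ.ker ∣ 2 := by
    have h := card_ker_mul_card_range φ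
    rw [MonoidHom.range_eq_top.mpr hφ, Subgroup.card_top, hS, hA] at h
    rw [show Nat.card φ.ker = 2 by omega]
  have hz : Subgroup.center A = φ.ker := by
    apply le_antisymm
    · intro k hk
      refine perm_eq_one_of_comm _ fun τ => ?_
      obtain ⟨g, rfl⟩ := hφ τ
      rw [← map_mul, ← map_mul, Subgroup.mem_center_iff.mp hk]
    · intro k hk
      exact mem_center_of_card_dvd_two hφ2 hk
  exact ⟨(QuotientGroup.quotientMulEquivOfEq hz).trans
    (QuotientGroup.quotientKerEquivOfSurjective φ hφ)⟩

end Exceptional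

section Generators

theorem exists_conj_notMem {G : Type*} [Group G] [Finite G] (t : G) {P : Set G} {k : ℕ}
    (hP : Nat.card P ≤ k)
    (h : k * Nat.card (Subgroup.centralizer ({t} : Set G)) < Nat.card G) :
    ∃ g : G, g * t * g⁻¹ ∉ P := by
  by_contra! hall
  let f : G ⧸ Subgroup.centralizer ({t} : Set G) → P := fun c => ⟨_, hall c.out⟩
  have hf : Function.Injective f := by
    intro c d hcd
    have h1 : c.out * t * c.out⁻¹ = d.out * t * d.out⁻¹ := congrArg Subtype.val hcd
    rw [← c.out_eq', ← d.out_eq', QuotientGroup.eq, Subgroup.mem_centralizer_singleton_iff]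
    have h2 : c.out * t = d.out * t * d.out⁻¹ * c.out := by
      rw [← h1, inv_mul_cancel_right]
    rw [← mul_right_inj c.out, ← mul_left_inj (d.out⁻¹ * c.out)]
    simp only [mul_assoc] at h2 ⊢
    simp [h2]
  have h1 := Subgroup.card_eq_card_quotient_mul_card_subgroup (Subgroup.centralizer ({t} : Set G))
  have h2 := Nat.mul_le_mul_right (Nat.card (Subgroup.centralizer ({t} : Set G)))
    ((Nat.card_le_card_of_injective f hf).trans hP)
  omega

theorem card_centralizer_le_of_commute {G : Type*} [Group G] [Finite G] {t s : G} (g : G)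
    (h : Subgroup.centralizer {s} ≤ Subgroup.centralizer {g * t * g⁻¹}) :
    Nat.card (Subgroup.centralizer ({s} : Set G)) ≤ Nat.card (Subgroup.centralizer ({t} : Set G)) := by
  refine Nat.card_le_card_of_injective (fun k => ⟨g⁻¹ * k * g, ?_⟩) fun k l hkl => ?_
  · have h1 := Subgroup.mem_centralizer_singleton_iff.mp (h k.2)
    rw [Subgroup.mem_centralizer_singleton_iff]
    calc g⁻¹ * k * g * t = g⁻¹ * (k * (g * t * g⁻¹)) * g := by group
      _ = t * (g⁻¹ * k * g) := by rw [h1]; group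
  · have h1 : g⁻¹ * k * g = g⁻¹ * l * g := congrArg Subtype.val hkl
    exact Subtype.ext (mul_left_cancel (mul_right_cancel h1))

variable {F : Type*} [Field F]

theorem mul_eq_inv_mul_of_trace {a s : SL₂ F} (hs : s.1.trace = 0) (has : (a * s).1.trace = 0) :
    s * a = a⁻¹ * s := by
  rw [← mul_self_eq_neg_one_iff] at hs has
  have h1 : a * (s * a) * s = a * (a⁻¹ * s) * s := by
    rw [mul_inv_cancel_left, hs, ← has]
    simp only [mul_assoc]
  exact mul_left_cancel (mul_right_cancel h1)

variable {A : Subgroup (SL₂ F)}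

theorem exists_conj_trace_ne_zero [Finite F] {a t : A} (ht : t.1.1.trace = 0)
    (h : Nat.card (Subgroup.centralizer ({a} : Set A)) *
      Nat.card (Subgroup.centralizer ({t} : Set A)) < Nat.card A) :
    ∃ g : A, (a * (g * t * g⁻¹)).1.1.trace ≠ 0 := by
  have hP : Nat.card {s : A | s.1.1.trace = 0 ∧ (a.1 * s.1).1.trace = 0} ≤
      Nat.card (Subgroup.centralizer ({a} : Set A)) := by
    rcases isEmpty_or_nonempty {s : A | s.1.1.trace = 0 ∧ (a.1 * s.1).1.trace = 0} with he | ⟨⟨s₀, hs₀⟩⟩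
    · rw [Nat.card_of_isEmpty]; exact Nat.zero_le _
    have key : ∀ s : {s : A | s.1.1.trace = 0 ∧ (a.1 * s.1).1.trace = 0}, s.1 * a = a⁻¹ * s.1 :=
      fun s => Subtype.ext (mul_eq_inv_mul_of_trace s.2.1 s.2.2)
    refine Nat.card_le_card_of_injective (fun s => ⟨s₀⁻¹ * s.1, ?_⟩) fun s s' hss => ?_
    · have h0 : s₀ * a = a⁻¹ * s₀ := key ⟨s₀, hs₀⟩
      have h1 : s₀⁻¹ * a⁻¹ = a * s₀⁻¹ := by
        rw [inv_mul_eq_iff_eq_mul, ← mul_assoc, h0, mul_inv_cancel_right]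
      rw [Subgroup.mem_centralizer_singleton_iff, mul_assoc, key s, ← mul_assoc, h1, mul_assoc]
    · exact Subtype.ext (mul_left_cancel (congrArg Subtype.val hss))
  obtain ⟨g, hg⟩ := exists_conj_notMem t hP h
  refine ⟨g, fun h0 => hg ⟨?_, h0⟩⟩
  rw [← ht]
  exact trace_conj t.1 g.1

theorem neg_mem_of_mem (hneg : -1 ∈ A) {g : SL₂ F} (hg : g ∈ A) : -g ∈ A := by
  rw [← neg_one_mul]; exact A.mul_mem hneg hg

theorem exists_mem_trace_eq_one (hneg : -1 ∈ A) {g h : SL₂ F} (hg : g ∈ A) (ht : g.1.trace ^ 2 = 1)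
    (hh : (h * g).1.trace = 0) : ∃ b ∈ A, b.1.trace = 1 ∧ (h * b).1.trace = 0 := by
  rcases sq_eq_sq_iff_eq_or_eq_neg.mp (ht.trans (one_pow 2).symm) with h1 | h1
  · exact ⟨g, hg, h1, hh⟩
  · exact ⟨-g, neg_mem_of_mem hneg hg, by rw [trace_neg, h1, neg_neg],
      by rw [mul_neg, trace_neg, hh, neg_zero]⟩

theorem icosahedral_generators (h2 : (2 : F) ≠ 0) (hneg : -1 ∈ A) {a s : SL₂ F} (ha : a ∈ A) (hs : s ∈ A)
    (hat : a.1.trace ^ 2 = a.1.trace + 1) (hst : s.1.trace = 0) (has : (a * s).1.trace ≠ 0)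
    (hall : ∀ g ∈ A, (g = 1 ∨ g = -1) ∨ g.1.trace = 0 ∨ g.1.trace ^ 2 = 1 ∨
        g.1.trace ^ 2 = g.1.trace + 1 ∨ g.1.trace ^ 2 = -g.1.trace + 1) :
    ∃ a b : A, a.1.1.trace ^ 2 = a.1.1.trace + 1 ∧ b.1.1.trace = 1 ∧
      (a.1.1 * b.1.1).trace = 0 := by
  have hs1 : s * s = -1 := (mul_self_eq_neg_one_iff s).mpr hst
  set φ := a.1.trace with hφ
  set y := (a * s).1.trace with hy
  have hφ0 : φ ≠ 0 := by intro h; rw [h] at hat; simp at hat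
  have hφ1 : φ ≠ 1 := by intro h; rw [h] at hat; simp at hat
  have hns : ∀ x : SL₂ F, x.1.trace ≠ 0 → ¬ (x * s = 1 ∨ x * s = -1) := by
    rintro x hx (h | h)
    · apply hx
      rw [eq_inv_of_mul_eq_one_left h, trace_inv, hst]
    · apply hx
      rw [show x = s by rw [← mul_left_inj s, h, hs1], hst]
  have hz : (a * (a * s)).1.trace = φ * y := by
    rw [trace_mul_mul_left, hst, sub_zero]
  have haa : (a * a).1.trace = φ - 1 := by
    have := trace_mul_mul_left a 1
    rw [mul_one, trace_one, ← hφ] at this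
    rw [this]
    linear_combination hat
  by_cases hy1 : y ^ 2 = 1
  · obtain ⟨b, hb, hb1, hb2⟩ := exists_mem_trace_eq_one hneg (h := a⁻¹) (A.mul_mem ha hs) hy1
      (by rw [inv_mul_cancel_left, hst])
    refine ⟨⟨a⁻¹, A.inv_mem ha⟩, ⟨b, hb⟩, ?_, hb1, hb2⟩
    change (a⁻¹).1.trace ^ 2 = (a⁻¹).1.trace + 1
    rw [trace_inv, ← hφ, hat]
  by_cases hz1 : (φ * y) ^ 2 = 1
  · obtain ⟨b, hb, hb1, hb2⟩ := exists_mem_trace_eq_one hneg (h := -(a * a)⁻¹)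
      (A.mul_mem ha (A.mul_mem ha hs)) (by rw [hz, hz1])
      (by rw [neg_mul, ← mul_assoc a a s, inv_mul_cancel_left, trace_neg, hst, neg_zero])
    refine ⟨⟨_, neg_mem_of_mem hneg (A.inv_mem (A.mul_mem ha ha))⟩, ⟨b, hb⟩, ?_, hb1, hb2⟩
    change (-(a * a)⁻¹).1.trace ^ 2 = (-(a * a)⁻¹).1.trace + 1
    rw [trace_neg, trace_inv, haa]
    linear_combination hat
  exfalso
  have e1 := (hall _ (A.mul_mem ha hs)).resolve_left (hns a hφ0)
  have e2 := (hall _ (A.mul_mem ha (A.mul_mem ha hs))).resolve_left (by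
    rw [← mul_assoc]
    exact hns _ (by rw [haa]; exact sub_ne_zero.mpr hφ1))
  rw [hz] at e2
  rw [← hy] at e1
  have e3 := (e1.resolve_left has).resolve_left hy1
  have e4 := (e2.resolve_left (mul_ne_zero hφ0 has)).resolve_left hz1
  have f1 : y ^ 2 = φ ^ 2 := by
    have : (y ^ 2 - φ ^ 2) * (y ^ 2 - (1 - φ) ^ 2) = 0 := by
      rcases e3 with h | h
      · linear_combination (y + φ) * (y + 1 - φ) * (h - hat)
      · linear_combination (y - φ) * (y - 1 + φ) * (h - hat)
    rcases mul_eq_zero.mp this with h | h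
    · exact sub_eq_zero.mp h
    · exfalso
      apply hz1
      linear_combination φ ^ 2 * h + (φ^2 - φ + 1) * hat
  have f2 : (φ * y) ^ 2 = 3 * φ + 2 := by
    linear_combination φ ^ 2 * f1 + (φ ^ 2 + φ + 2) * hat
  have f3 : ((φ * y) ^ 2 - 1) ^ 2 = (φ * y) ^ 2 := by
    rcases e4 with h | h
    · linear_combination ((φ * y) ^ 2 - 1 + φ * y) * h
    · linear_combination ((φ * y) ^ 2 - 1 - φ * y) * h
  apply pow_ne_zero 2 (mul_ne_zero hφ0 has)
  rw [f2] at f3 ⊢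
  have f4 : (2 * 2) * (3 * φ + 2) = 0 := by linear_combination f3 - 9 * hat
  exact (mul_eq_zero.mp f4).resolve_left (mul_ne_zero h2 h2)

theorem nonempty_mulEquiv_of_icosahedral [Finite F] (h2 : (2 : F) ≠ 0) (hneg : -1 ∈ A)
    (hA : Nat.card A = 120) (hc : HasSelfCentralizing A 10)
    (ht : ∃ t : A, t.1.1.trace = 0 ∧ Nat.card (Subgroup.centralizer ({t} : Set A)) ≤ 10)
    (hall : ∀ g ∈ A, (g = 1 ∨ g = -1) ∨ g.1.trace = 0 ∨ g.1.trace ^ 2 = 1 ∨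
        g.1.trace ^ 2 = g.1.trace + 1 ∨ g.1.trace ^ 2 = -g.1.trace + 1) :
    Nonempty (A ≃* SL₂ (ZMod 5)) := by
  obtain ⟨a, hao, hac⟩ := hc
  obtain ⟨t, ht, htc⟩ := ht
  have hao' : orderOf a.1 = 10 := by rw [Subgroup.orderOf_coe, hao]
  have h10 : a.1 ^ 10 = 1 := hao' ▸ pow_orderOf_eq_one a.1
  obtain ⟨h₁, h₂⟩ := ne_one_and_ne_neg_one (a := a.1) (by omega)
  obtain ⟨g, hg⟩ := exists_conj_trace_ne_zero (a := a) ht (by rw [hac, hA]; omega)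
  have hs : (g * t * g⁻¹).1.1.trace = 0 := (trace_conj t.1 g.1).trans ht
  suffices ∃ a b : A, a.1.1.trace ^ 2 = a.1.1.trace + 1 ∧ b.1.1.trace = 1 ∧
      (a.1.1 * b.1.1).trace = 0 by
    obtain ⟨a, b, ha, hb, hab⟩ := this
    exact nonempty_mulEquiv_five h2 ha hb hab hA
  rcases (trace_of_pow_ten h2 h10).resolve_left (by tauto) with h | h
  · exact icosahedral_generators h2 hneg a.2 (g * t * g⁻¹).2 h hs hg hall
  · refine icosahedral_generators h2 hneg (neg_mem_of_mem hneg a.2) (g * t * g⁻¹).2 ?_ hs ?_ hall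
    · rw [trace_neg, neg_sq, h]
    · rw [neg_mul, trace_neg, neg_ne_zero]
      exact hg

theorem exists_trace_eq_zero_of_hasSelfCentralizing (h2 : (2 : F) ≠ 0)
    (hc : HasSelfCentralizing A 4) :
    ∃ t : A, t.1.1.trace = 0 ∧ Nat.card (Subgroup.centralizer ({t} : Set A)) = 4 := by
  obtain ⟨t, hto, htc⟩ := hc
  have hto' : orderOf t.1 = 4 := by rw [Subgroup.orderOf_coe, hto]
  have h4 : t.1 ^ 4 = 1 := hto' ▸ pow_orderOf_eq_one t.1
  obtain ⟨h₁, h₂⟩ := ne_one_and_ne_neg_one (a := t.1) (by omega)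
  exact ⟨t, (eq_or_trace_eq_zero_of_pow_four h2 h4).resolve_left (by tauto), htc⟩

theorem nonempty_quotient_center_mulEquiv_of_octahedral [Finite F] (h2 : (2 : F) ≠ 0)
    (h3 : (3 : F) ≠ 0) (hneg : -1 ∈ A)
    (hA : Nat.card A = 48) (hc : HasSelfCentralizing A 8) (hc4 : HasSelfCentralizing A 4)
    (hall : ∀ g ∈ A, (g = 1 ∨ g = -1) ∨ g.1.trace = 0 ∨ g.1.trace ^ 2 = 1 ∨ g.1.trace ^ 2 = 2) :
    Nonempty (A ⧸ Subgroup.center A ≃* Equiv.Perm (Fin 4)) := by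
  obtain ⟨a, hao, hac⟩ := hc
  obtain ⟨t, ht, htc⟩ := exists_trace_eq_zero_of_hasSelfCentralizing h2 hc4
  have hao' : orderOf a.1 = 8 := by rw [Subgroup.orderOf_coe, hao]
  have h8 : a.1 ^ 8 = 1 := hao' ▸ pow_orderOf_eq_one a.1
  obtain ⟨h₁, h₂⟩ := ne_one_and_ne_neg_one (a := a.1) (by omega)
  have hat : a.1.1.trace ^ 2 = 2 := by
    refine ((trace_of_pow_eight h2 h8).resolve_left (by tauto)).resolve_left fun h => ?_
    have := orderOf_of_trace_eq_zero h2 h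
    omega
  have ha0 : a.1.1.trace ≠ 0 := by
    intro h
    rw [h] at hat
    apply h2
    rw [← hat]; simp
  obtain ⟨g, hg⟩ := exists_conj_trace_ne_zero (a := a) ht (by rw [hac, hA, htc]; omega)
  obtain ⟨s, hs⟩ : ∃ s : A, s = g * t * g⁻¹ := ⟨_, rfl⟩
  have hst : s.1.1.trace = 0 := by rw [hs]; exact (trace_conj t.1 g.1).trans ht
  rw [← hs] at hg
  have hcomm : ¬ ∀ k, k * a = a * k → k * s = s * k := by
    intro h
    have := card_centralizer_le_of_commute (t := t) (s := a) g (fun k hk => by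
      rw [Subgroup.mem_centralizer_singleton_iff] at hk ⊢
      rw [← hs]
      exact h k hk)
    omega
  have hne : ∀ k ∈ A, k = 1 ∨ k = -1 → ∀ n : ℕ, a.1 ^ n * s.1 = k → False := by
    intro k hk hk1 n hn
    apply hcomm
    intro l hl
    have hks : s = a⁻¹ ^ n * ⟨k, hk⟩ := by
      apply Subtype.ext
      change s.1 = a.1⁻¹ ^ n * k
      rw [← hn, inv_pow, inv_mul_cancel_left]
    have hkc : Commute l ⟨k, hk⟩ := by
      rcases hk1 with rfl | rfl
      · exact Commute.one_right l
      · exact Subtype.ext (by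
          change l.1 * (-1) = (-1) * l.1
          simp)
    rw [hks]
    exact ((Commute.inv_right (show Commute l a from hl)).pow_right n).mul_right hkc
  set ρ := a.1.1.trace with hρ
  have e1 := (hall _ (a * s).2).resolve_left (fun h => hne _ (a * s).2 h 1 (by rw [pow_one]; rfl))
  rcases e1.resolve_left hg with hy | hy
  · obtain ⟨b, hb, hb1, hb2⟩ := exists_mem_trace_eq_one hneg (h := a.1⁻¹) (a * s).2 hy
      (by change (a.1⁻¹ * (a.1 * s.1)).1.trace = 0
          rw [inv_mul_cancel_left, hst])
    refine nonempty_quotient_center_mulEquiv (a := a⁻¹) (b := ⟨b, hb⟩) h2 ?_ hb1 hb2 hA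
    change (a.1⁻¹).1.trace ^ 2 = 2
    rw [trace_inv, ← hρ, hat]
  · exfalso
    have e2 := (hall _ (a * (a * s)).2).resolve_left
      (fun h => hne _ (a * (a * s)).2 h 2 (by rw [pow_two, mul_assoc]; rfl))
    have hz : (a * (a * s)).1.1.trace = ρ * (a * s).1.1.trace := by
      have := trace_mul_mul_left a.1 s.1
      rw [hst, sub_zero] at this
      exact this
    have hz2 : (ρ * (a * s).1.1.trace) ^ 2 = 2 * 2 := by rw [mul_pow, hat, hy]
    rw [hz, hz2] at e2
    rcases e2 with h | h | h
    · exact mul_ne_zero ha0 hg h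
    · exact h3 (by linear_combination h)
    · exact h2 (by linear_combination h)

theorem nonempty_mulEquiv_of_tetrahedral [Finite F] (h2 : (2 : F) ≠ 0) (h3 : (3 : F) ≠ 0)
    (hneg : -1 ∈ A) (hA : Nat.card A = 24) (hc : HasSelfCentralizing A 6)
    (hall : ∀ g ∈ A, (g = 1 ∨ g = -1) ∨ g.1.trace = 0 ∨ g.1.trace ^ 2 = 1) :
    Nonempty (A ≃* SL₂ (ZMod 3)) := by
  obtain ⟨a, hao, hac⟩ := hc
  have hao' : orderOf a.1 = 6 := by rw [Subgroup.orderOf_coe, hao]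
  have h6 : a.1 ^ 6 = 1 := hao' ▸ pow_orderOf_eq_one a.1
  obtain ⟨h₁, h₂⟩ := ne_one_and_ne_neg_one (a := a.1) (by omega)
  have hat := (trace_sq_eq_one_of_pow_six h2 h6).resolve_left (by tauto)
  obtain ⟨g, hg⟩ := exists_conj_notMem (P := {a, a⁻¹}) (k := 2) a (by
    rw [Nat.card_coe_set_eq]; exact (Set.ncard_insert_le a {a⁻¹}).trans (by rw [Set.ncard_singleton])) (by rw [hac, hA]; omega)
  obtain ⟨b, hb⟩ : ∃ b : A, b = g * a * g⁻¹ := ⟨_, rfl⟩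
  have hbt : b.1.1.trace = a.1.1.trace := by rw [hb]; exact trace_conj a.1 g.1
  rw [← hb] at hg
  have ht0 : a.1.1.trace ≠ 0 := by
    intro h; rw [h] at hat; simp at hat
  have htn : a.1.1.trace ≠ -a.1.1.trace := by
    intro h
    apply mul_ne_zero h2 ht0
    linear_combination h
  have hab : (a * b).1.1.trace = 0 ∨ (a * b).1.1.trace ^ 2 = 1 := by
    refine (hall _ (a * b).2).resolve_left ?_
    rintro (h | h)
    · exact hg (Or.inr (eq_inv_of_mul_eq_one_right (Subtype.ext h)))
    · apply htn
      have h' : b.1 = -a.1⁻¹ := by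
        rw [← mul_right_inj a.1, mul_neg, mul_inv_cancel]; exact h
      have := hbt
      rw [h', trace_neg, trace_inv] at this
      exact this.symm
  have habi : (a * b⁻¹).1.1.trace = 0 ∨ (a * b⁻¹).1.1.trace ^ 2 = 1 := by
    refine (hall _ (a * b⁻¹).2).resolve_left ?_
    rintro (h | h)
    · exact hg (Or.inl (mul_inv_eq_one.mp (Subtype.ext h)).symm)
    · apply htn
      have h' : a.1 = -b.1 := by
        rw [← mul_left_inj b.1⁻¹, neg_mul, mul_inv_cancel]; exact h
      have := congrArg (fun x => x.1.trace) h'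
      rw [trace_neg, hbt] at this
      exact this
  have hx : (a * b⁻¹).1.1.trace = 1 - (a * b).1.1.trace := by
    have := trace_mul_inv a.1 b.1
    rw [hbt, ← pow_two, hat] at this
    exact this
  rw [hx] at habi
  suffices ∃ c : A, c.1.1.trace = a.1.1.trace ∧ (a * c).1.1.trace = 0 by
    obtain ⟨c, hc, hac⟩ := this
    rcases sq_eq_sq_iff_eq_or_eq_neg.mp (hat.trans (one_pow 2).symm) with h | h
    · exact nonempty_mulEquiv_three (a := a) (b := c) h2 h (hc.trans h) hac hA
    · refine nonempty_mulEquiv_three (a := ⟨_, neg_mem_of_mem hneg a.2⟩)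
        (b := ⟨_, neg_mem_of_mem hneg c.2⟩) h2 ?_ ?_ ?_ hA
      · rw [trace_neg, h, neg_neg]
      · rw [trace_neg, hc, h, neg_neg]
      · change ((-a.1) * (-c.1)).1.trace = 0
        rw [neg_mul_neg]
        exact hac
  rcases hab with h | h
  · exact ⟨b, hbt, h⟩
  · refine ⟨b⁻¹, (trace_inv b.1).trans hbt, ?_⟩
    rw [hx]
    rcases habi with h' | h'
    · exact h'
    · rcases sq_eq_sq_iff_eq_or_eq_neg.mp (h.trans (one_pow 2).symm) with h1 | h1
      · rw [h1, sub_self]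
      · rw [h1] at h'
        exact absurd (by linear_combination h') h3

end Generators

section Dichotomy

variable {F : Type*} [Field F] [Finite F] {A : Subgroup (SL₂ F)}

/-- The classification over an arbitrary finite field in which `2` is invertible. -/
theorem classification (h2 : (2 : F) ≠ 0) (hA : A ≠ ⊤)
    (hdvd : Nat.card F + 1 ∣ Nat.card (centralImage A)) :
    -1 ∈ A ∧
    ((Nat.card A = 2 * (Nat.card F + 1) ∧
        Nonempty (centralImage A ≃* DihedralGroup ((Nat.card F + 1) / 2))) ∨
      ((Nat.card F = 5 ∨ Nat.card F = 11) ∧ Nonempty (A ≃* SL₂ (ZMod 3))) ∨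
      ((Nat.card F = 7 ∨ Nat.card F = 23) ∧ Nat.card A = 48 ∧ (∃! x : A, orderOf x = 2) ∧
        Nonempty (A ⧸ Subgroup.center A ≃* Equiv.Perm (Fin 4))) ∨
      ((Nat.card F = 9 ∨ Nat.card F = 11 ∨ Nat.card F = 19 ∨ Nat.card F = 29 ∨ Nat.card F = 59) ∧
        Nonempty (A ≃* SL₂ (ZMod 5)))) := by
  have hodd := odd_natCard h2
  have hq1 : 1 < Nat.card F := Finite.one_lt_card
  have hneg : -1 ∈ A := neg_one_mem_of_even h2 (dvd_trans (by omega) hdvd)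
  have hdvd' : 2 * (Nat.card F + 1) ∣ Nat.card A := by
    rw [card_eq_two_mul_card_centralImage h2 hneg]
    exact Nat.mul_dvd_mul_left 2 hdvd
  have hq : (Nat.card F : F) = 0 := by
    have := Fintype.ofFinite F
    rw [Nat.card_eq_fintype_card]; exact Nat.cast_card_eq_zero F
  refine ⟨hneg, ?_⟩
  by_cases hmod : ∀ g ∈ A, g.1.trace = 2 → g = 1
  · rcases nonmodular_cases h2 hneg hmod hdvd' with ⟨h, hc⟩ | ⟨hF, h, hc, hall⟩ |
      ⟨hF, h, hc, hc4, hall⟩ | ⟨hF, h, hc, hc4, hall⟩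
    · exact Or.inl ⟨h, nonempty_centralImage_mulEquiv_dihedralGroup h2 hneg hmod
        (by omega) (by omega) (by rwa [show 2 * ((Nat.card F + 1) / 2) = Nat.card F + 1 by omega])⟩
    · refine Or.inr (Or.inl ⟨hF, nonempty_mulEquiv_of_tetrahedral h2 (fun h3 => ?_) hneg h hc hall⟩)
      rcases hF with h' | h' <;> rw [h'] at hq <;> push_cast at hq
      · exact h2 (by linear_combination hq - h3)
      · exact h2 (by linear_combination hq - 3 * h3)
    · refine Or.inr (Or.inr (Or.inl ⟨hF, h, existsUnique_orderOf_eq_two h2 hneg,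
        nonempty_quotient_center_mulEquiv_of_octahedral h2 (fun h3 => ?_) hneg h hc hc4 hall⟩))
      rcases hF with h' | h' <;> rw [h'] at hq <;> push_cast at hq
      · exact one_ne_zero (α := F) (by linear_combination hq - 2 * h3)
      · exact h2 (by linear_combination hq - 7 * h3)
    · obtain ⟨t, ht, htc⟩ := exists_trace_eq_zero_of_hasSelfCentralizing h2 hc4
      exact Or.inr (Or.inr (Or.inr ⟨Or.inr hF,
        nonempty_mulEquiv_of_icosahedral h2 hneg h hc ⟨t, ht, by omega⟩ hall⟩))
  · push Not at hmod
    obtain ⟨u, hu, hut, hu1⟩ := hmod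
    obtain ⟨hF, h, hc, ht, hall⟩ := (modular_cases h2 hneg hdvd' hu hu1 hut).resolve_left hA
    exact Or.inr (Or.inr (Or.inr ⟨Or.inl hF, nonempty_mulEquiv_of_icosahedral h2 hneg h hc ht hall⟩))

end Dichotomy

end Dickson

/-- Let `p` be an odd prime, `q = p^a`, `K = SL₂(𝔽_q)` and `Z = Z(K)`.
Let `A` be a proper subgroup of `K` such that `q + 1` divides the order of the image of
`A` in `K/Z`.  Then `-I ∈ A`, and either `A` has order `2(q+1)` and `A/⟨-I⟩` (i.e. the
image of `A` in `K/Z`, since `Z = ⟨-I⟩`) is dihedral of order `q + 1`, or one of the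
finitely many exceptional cases holds. -/
theorem dickson_corollary_odd_char (p a : ℕ) [Fact p.Prime] (hodd : Odd p) (ha : 1 ≤ a)
    (A : Subgroup (Matrix.SpecialLinearGroup (Fin 2) (GaloisField p a)))
    (hA : A ≠ ⊤)
    (hdvd : p ^ a + 1 ∣
      Nat.card (A.map (QuotientGroup.mk'
        (Subgroup.center (Matrix.SpecialLinearGroup (Fin 2) (GaloisField p a)))))) :
    (-1 : Matrix.SpecialLinearGroup (Fin 2) (GaloisField p a)) ∈ A ∧
    ((Nat.card A = 2 * (p ^ a + 1) ∧
        Nonempty ((A.map (QuotientGroup.mk'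
          (Subgroup.center (Matrix.SpecialLinearGroup (Fin 2) (GaloisField p a))))) ≃*
            DihedralGroup ((p ^ a + 1) / 2))) ∨
      (p ^ a = 5 ∧ Nonempty (A ≃* Matrix.SpecialLinearGroup (Fin 2) (ZMod 3))) ∨
      (p ^ a = 7 ∧ Nat.card A = 48 ∧ (∃! x : A, orderOf x = 2) ∧
        Nonempty ((A ⧸ Subgroup.center A) ≃* Equiv.Perm (Fin 4))) ∨
      (p ^ a = 9 ∧ Nonempty (A ≃* Matrix.SpecialLinearGroup (Fin 2) (ZMod 5))) ∨
      (p ^ a = 11 ∧ (Nonempty (A ≃* Matrix.SpecialLinearGroup (Fin 2) (ZMod 3)) ∨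
        Nonempty (A ≃* Matrix.SpecialLinearGroup (Fin 2) (ZMod 5)))) ∨
      (p ^ a = 19 ∧ Nonempty (A ≃* Matrix.SpecialLinearGroup (Fin 2) (ZMod 5))) ∨
      (p ^ a = 23 ∧ Nat.card A = 48 ∧ (∃! x : A, orderOf x = 2) ∧
        Nonempty ((A ⧸ Subgroup.center A) ≃* Equiv.Perm (Fin 4))) ∨
      (p ^ a = 29 ∧ Nonempty (A ≃* Matrix.SpecialLinearGroup (Fin 2) (ZMod 5))) ∨
      (p ^ a = 59 ∧ Nonempty (A ≃* Matrix.SpecialLinearGroup (Fin 2) (ZMod 5)))) := by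
  have hq : Nat.card (GaloisField p a) = p ^ a := GaloisField.card p a (by omega)
  have : Finite (GaloisField p a) := Nat.finite_of_card_ne_zero (by
    rw [hq]; exact pow_ne_zero _ (Fact.out : p.Prime).ne_zero)
  have h2 : (2 : GaloisField p a) ≠ 0 := by
    intro h
    have h1 : ((2 : ℕ) : GaloisField p a) = 0 := by exact_mod_cast h
    rw [CharP.cast_eq_zero_iff (GaloisField p a) p] at h1
    rw [(Nat.prime_dvd_prime_iff_eq Fact.out Nat.prime_two).mp h1] at hodd
    exact absurd hodd (by decide)
  obtain ⟨hneg, h⟩ := Dickson.classification h2 hA (by rw [hq]; exact hdvd)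
  rw [hq] at h
  refine ⟨hneg, ?_⟩
  rcases h with h | ⟨hF | hF, h⟩ | ⟨hF | hF, h⟩ | ⟨hF | hF | hF | hF | hF, h⟩
  · exact Or.inl h
  · exact Or.inr (Or.inl ⟨hF, h⟩)
  · exact Or.inr (Or.inr (Or.inr (Or.inr (Or.inl ⟨hF, Or.inl h⟩))))
  · exact Or.inr (Or.inr (Or.inl ⟨hF, h⟩))
  · exact Or.inr (Or.inr (Or.inr (Or.inr (Or.inr (Or.inr (Or.inl ⟨hF, h⟩))))))
  · exact Or.inr (Or.inr (Or.inr (Or.inl ⟨hF, h⟩)))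
  · exact Or.inr (Or.inr (Or.inr (Or.inr (Or.inl ⟨hF, Or.inr h⟩))))
  · exact Or.inr (Or.inr (Or.inr (Or.inr (Or.inr (Or.inl ⟨hF, h⟩)))))
  · exact Or.inr (Or.inr (Or.inr (Or.inr (Or.inr (Or.inr (Or.inr (Or.inl ⟨hF, h⟩)))))))
  · exact Or.inr (Or.inr (Or.inr (Or.inr (Or.inr (Or.inr (Or.inr (Or.inr ⟨hF, h⟩)))))))
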